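/- arXiv:1005.2863 — 4 statements merged into one kernel-verified Lean document; each statement's English description precedes it below -/
import Mathlib

section
/- There exists a constant C' > 0 such that for all sufficiently large n: |{G ∈ 𝓕(n) : γ(G) > C'·√n·(log n)^{3/2}}| < n^{−3n}·b(n). (All logarithms are base 2.) -/
open Filter

noncomputable section

/-- A colored graph on `Fin n`: a simple graph whose edges are partitioned
into red and blue edges. -/
structure ColoredGraph (n : ℕ) where
  red : SimpleGraph (Fin n)
  blue : SimpleGraph (Fin n)
  disj : ∀ x y, ¬ (red.Adj x y ∧ blue.Adj x y)

namespace ColoredGraph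

variable {n : ℕ}

/-- The underlying (uncolored) simple graph. -/
def graph (G : ColoredGraph n) : SimpleGraph (Fin n) := G.red ⊔ G.blue

/-- Adjacency in a colored graph. -/
def Adj (G : ColoredGraph n) (x y : Fin n) : Prop := G.graph.Adj x y

/-- The neighborhood of a vertex. -/
def nbhd (G : ColoredGraph n) (x : Fin n) : Set (Fin n) := {y | G.Adj x y}

/-- `Γ(Q)`, the external neighborhood of a set of vertices. -/
def nbhdSet (G : ColoredGraph n) (Q : Set (Fin n)) : Set (Fin n) :=
  (⋃ x ∈ Q, G.nbhd x) \ Q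

/-- The degree of a vertex. -/
def deg (G : ColoredGraph n) (x : Fin n) : ℕ := (G.nbhd x).ncard

open scoped Classical in
/-- Indicator that the edge `xy` is blue. -/
def blueInd (G : ColoredGraph n) (x y : Fin n) : ℕ := if G.blue.Adj x y then 1 else 0

/-- Odd-blue-triangle-free: no triangle with an odd number of blue edges. -/
def OBTF (G : ColoredGraph n) : Prop :=
  ∀ x y z : Fin n, G.Adj x y → G.Adj y z → G.Adj x z →
    ¬ Odd (G.blueInd x y + G.blueInd y z + G.blueInd x z)

/-- The colored graph induced on the vertex set `A` is blue-bipartite: there is a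
partition `U ⊔ (A \ U)` of `A` such that blue edges within `A` cross the partition
and red edges within `A` do not. -/
def BlueBipartiteOn (G : ColoredGraph n) (A : Set (Fin n)) : Prop :=
  ∃ U ⊆ A, ∀ x ∈ A, ∀ y ∈ A,
    (G.blue.Adj x y → (x ∈ U ↔ y ∉ U)) ∧ (G.red.Adj x y → (x ∈ U ↔ y ∈ U))

/-- Blue-bipartite colored graph. -/
def BlueBipartite (G : ColoredGraph n) : Prop := G.BlueBipartiteOn Set.univ

/-- `κ(G)`: the minimum size of a vertex set whose removal leaves a blue-bipartite graph. -/
def kappa (G : ColoredGraph n) : ℕ :=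
  sInf {k | ∃ K : Set (Fin n), K.ncard = k ∧ G.BlueBipartiteOn Kᶜ}

end ColoredGraph

/-- `𝓕(n)`: the set of OBTF colored graphs on `[n]`. -/
def obtfSet (n : ℕ) : Set (ColoredGraph n) := {G | G.OBTF}

/-- `F(n) = |𝓕(n)|`. -/
def Fnum (n : ℕ) : ℕ := (obtfSet n).ncard

/-- `𝓑(n)`: the set of blue-bipartite colored graphs on `[n]`. -/
def bbSet (n : ℕ) : Set (ColoredGraph n) := {G | G.BlueBipartite}

/-- `|𝓑(n)|`. -/
def Bnum (n : ℕ) : ℕ := (bbSet n).ncard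

/-- `b(n) = 2^{n(n+1)/2 - 1}`. -/
def bnum (n : ℕ) : ℕ := 2 ^ (n * (n + 1) / 2 - 1)

/-- Deleting a set of edges from a colored graph. -/
def ColoredGraph.deleteEdges {n : ℕ} (G : ColoredGraph n) (E : Set (Sym2 (Fin n))) :
    ColoredGraph n where
  red := G.red.deleteEdges E
  blue := G.blue.deleteEdges E
  disj := by
    intro x y h
    rw [SimpleGraph.deleteEdges_adj, SimpleGraph.deleteEdges_adj] at h
    exact G.disj x y ⟨h.1.1, h.2.1⟩

/-- `γ(G)`: the minimum number of edges whose removal leaves a blue-bipartite graph. -/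
def gamma {n : ℕ} (G : ColoredGraph n) : ℕ :=
  sInf {k | ∃ E : Set (Sym2 (Fin n)), E ⊆ G.graph.edgeSet ∧ E.ncard = k ∧
    (G.deleteEdges E).BlueBipartite}

/-- Entropy-type bound on the number of small subsets. -/
theorem card_small (κ : ℝ) (hκ : 0 < κ) : ∃ ε : ℝ, 0 < ε ∧ ∀ (α : Type) [DecidableEq α]
    (U : Finset α) (L : ℕ), (L : ℝ) ≤ ε * (U.card : ℝ) →
    (((U.powerset.filter (fun Z => Z.card ≤ L)).card : ℕ) : ℝ) ≤ (2 : ℝ) ^ (κ * (U.card : ℝ)) := by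
  set t : ℝ := min 1 ((2 : ℝ) ^ (κ / 2) - 1) with ht
  have h1 : (1 : ℝ) < (2 : ℝ) ^ (κ / 2) := Real.one_lt_rpow (by norm_num) (by positivity)
  have ht0 : 0 < t := lt_min one_pos (by linarith)
  have ht1 : t ≤ 1 := min_le_left _ _
  have ht2 : t + 1 ≤ (2 : ℝ) ^ (κ / 2) := by
    have := min_le_right 1 ((2 : ℝ) ^ (κ / 2) - 1)
    linarith
  set l : ℝ := - Real.logb 2 t with hl
  have hl0 : 0 ≤ l := by
    have := Real.logb_nonpos (b := 2) (by norm_num) ht0.le ht1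
    linarith
  have htl : (2 : ℝ) ^ (-l) = t := by
    rw [hl, neg_neg]
    exact Real.rpow_logb (by norm_num) (by norm_num) ht0
  refine ⟨κ / (2 * (l + 1)), by positivity, ?_⟩
  intro α _ U L hL
  have hsum : (((U.powerset.filter (fun Z => Z.card ≤ L)).card : ℕ) : ℝ) * t ^ L ≤ (t + 1) ^ U.card := by
    rw [← Finset.sum_pow_mul_eq_add_pow]
    simp only [one_pow, mul_one]
    calc (((U.powerset.filter (fun Z => Z.card ≤ L)).card : ℕ) : ℝ) * t ^ L
        = ∑ Z ∈ U.powerset.filter (fun Z => Z.card ≤ L), t ^ L := by simp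
      _ ≤ ∑ Z ∈ U.powerset.filter (fun Z => Z.card ≤ L), t ^ Z.card := by
          apply Finset.sum_le_sum
          intro Z hZ
          exact pow_le_pow_of_le_one ht0.le ht1 (Finset.mem_filter.1 hZ).2
      _ ≤ ∑ Z ∈ U.powerset, t ^ Z.card := by
          apply Finset.sum_le_sum_of_subset_of_nonneg (Finset.filter_subset _ _)
          intros; positivity
  have h3 : (t + 1) ^ U.card ≤ (2 : ℝ) ^ (κ / 2 * U.card) := by
    rw [Real.rpow_mul (by norm_num), Real.rpow_natCast]
    exact pow_le_pow_left₀ (by positivity) ht2 _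
  have h4 : (t ^ L) = (2 : ℝ) ^ (- (l * L)) := by
    rw [← htl, ← Real.rpow_natCast, ← Real.rpow_mul (by norm_num)]
    ring_nf
  rw [h4] at hsum
  have h5 : (((U.powerset.filter (fun Z => Z.card ≤ L)).card : ℕ) : ℝ) ≤
      (2 : ℝ) ^ (κ / 2 * U.card) * (2 : ℝ) ^ (l * L) := by
    have h6 : (2 : ℝ) ^ (- (l * L)) * (2 : ℝ) ^ (l * L) = 1 := by
      rw [← Real.rpow_add (by norm_num)]; simp
    have h7 : (0 : ℝ) < (2 : ℝ) ^ (l * L) := by positivity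
    calc _ = (((U.powerset.filter (fun Z => Z.card ≤ L)).card : ℕ) : ℝ) *
          ((2 : ℝ) ^ (- (l * L)) * (2 : ℝ) ^ (l * L)) := by rw [h6, mul_one]
      _ = _ * (2 : ℝ) ^ (- (l * L)) * (2 : ℝ) ^ (l * L) := by ring
      _ ≤ _ := mul_le_mul_of_nonneg_right (hsum.trans h3) h7.le
  refine h5.trans ?_
  rw [← Real.rpow_add (by norm_num)]
  apply Real.rpow_le_rpow_of_exponent_le (by norm_num)
  have h8 : l * L ≤ κ / 2 * U.card := by
    calc l * L ≤ (l + 1) * L := by nlinarith [(Nat.cast_nonneg L : (0:ℝ) ≤ L)]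
      _ ≤ (l + 1) * (κ / (2 * (l + 1)) * U.card) := by gcongr
      _ = κ / 2 * U.card := by field_simp
  linarith

/-- Splitting a family of sets over `U`. -/
theorem card_split {α : Type} [DecidableEq α] (T U : Finset α) (hU : U ⊆ T)
    (F : Finset (Finset α)) (hF : ∀ E ∈ F, E ⊆ T) :
    F.card ≤ 2 ^ (T.card - U.card) * (F.image (fun E => E ∩ U)).card := by
  have : F.card ≤ ((T \ U).powerset ×ˢ (F.image (fun E => E ∩ U))).card := by
    apply Finset.card_le_card_of_injOn (fun E => (E \ U, E ∩ U))
    · intro E hE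
      simp only [Finset.coe_product, Set.mem_prod, Finset.mem_coe, Finset.mem_powerset]
      exact ⟨Finset.sdiff_subset_sdiff (hF E hE) (le_refl _), Finset.mem_image_of_mem _ hE⟩
    · intro E _ E' _ h
      simp only [Prod.mk.injEq] at h
      rw [← Finset.sdiff_union_inter E U, h.1, h.2, Finset.sdiff_union_inter]
  rwa [Finset.card_product, Finset.card_powerset, Finset.card_sdiff_of_subset hU] at this

/-- Encoding bound. -/
theorem card_le_pi {α ι L : Type} [Fintype ι] [DecidableEq ι] [DecidableEq L]
    (F : Finset α) (φ : α → ι → L) (R : ι → Finset L) (hφ : Set.InjOn φ F)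
    (hR : ∀ a ∈ F, ∀ i, φ a i ∈ R i) : F.card ≤ ∏ i, (R i).card := by
  rw [← Fintype.card_piFinset]
  apply Finset.card_le_card_of_injOn φ _ hφ
  intro a ha
  simp only [Finset.mem_coe, Fintype.mem_piFinset]
  exact hR a ha

theorem card_le_sum_fiber {α β : Type} [DecidableEq α] (F : Finset α) (D : Finset β)
    (F' : β → Finset α) (h : ∀ a ∈ F, ∃ d ∈ D, a ∈ F' d) (B : ℝ)
    (hB : ∀ d ∈ D, ((F' d).card : ℝ) ≤ B) : (F.card : ℝ) ≤ D.card * B := by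
  have h1 : F ⊆ D.biUnion F' := by
    intro a ha
    obtain ⟨d, hd, h⟩ := h a ha
    exact Finset.mem_biUnion.2 ⟨d, hd, h⟩
  have h2 : F.card ≤ ∑ d ∈ D, (F' d).card := (Finset.card_le_card h1).trans Finset.card_biUnion_le
  calc (F.card : ℝ) ≤ ((∑ d ∈ D, (F' d).card : ℕ) : ℝ) := by exact_mod_cast h2
    _ = ∑ d ∈ D, ((F' d).card : ℝ) := by push_cast; rfl
    _ ≤ ∑ d ∈ D, B := Finset.sum_le_sum hB
    _ = D.card * B := by simp

abbrev Sg (n : ℕ) := Fin n → Fin n → SignType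

/-- signed graph without unbalanced triangles -/
structure IsS {n : ℕ} (s : Sg n) : Prop where
  symm : ∀ x y, s x y = s y x
  diag : ∀ x, s x x = 0
  tri : ∀ x y z, s x y * s y z * s x z ≠ -1

/-- pairs x < y -/
def Tp (n : ℕ) : Finset (Fin n × Fin n) := Finset.univ.filter (fun p => p.1 < p.2)

theorem card_Tp (n : ℕ) : (Tp n).card = n * (n - 1) / 2 := by
  have h := Finset.card_filter_add_card_filter_not (s := (Finset.univ : Finset (Fin n × Fin n)).filter (fun p => p.1 ≠ p.2)) (fun p => p.1 < p.2)
  have h1 : ((Finset.univ : Finset (Fin n × Fin n)).filter (fun p => p.1 ≠ p.2)).card = n * (n-1) := by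
    have := Finset.offDiag_card (Finset.univ : Finset (Fin n))
    simp only [Finset.card_univ, Fintype.card_fin] at this
    rw [Nat.mul_sub, mul_one, ← this]
    congr 1
    ext p; simp [Finset.mem_offDiag]
  have h2 : (((Finset.univ : Finset (Fin n × Fin n)).filter (fun p => p.1 ≠ p.2)).filter (fun p => p.1 < p.2)) = Tp n := by
    ext p; simp only [Tp, Finset.mem_filter, Finset.mem_univ, true_and]
    constructor
    · exact fun h => h.2
    · exact fun h => ⟨h.ne, h⟩
  have h3 : (((Finset.univ : Finset (Fin n × Fin n)).filter (fun p => p.1 ≠ p.2)).filter (fun p => ¬ p.1 < p.2)).card = (Tp n).card := by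
    apply Finset.card_bij (fun p _ => p.swap)
    · intro p hp
      simp only [Tp, Finset.mem_filter, Finset.mem_univ, true_and, Prod.fst_swap, Prod.snd_swap] at hp ⊢
      exact lt_of_le_of_ne (not_lt.1 hp.2) (Ne.symm hp.1)
    · intro p _ q _ h; exact Prod.swap_injective h
    · intro p hp
      simp only [Tp, Finset.mem_filter, Finset.mem_univ, true_and] at hp
      refine ⟨p.swap, ?_, by simp⟩
      simp only [Finset.mem_filter, Finset.mem_univ, true_and, Prod.fst_swap, Prod.snd_swap]
      exact ⟨hp.ne', not_lt.2 hp.le⟩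
  rw [h2, h3, h1] at h
  omega

theorem sg_ext {n : ℕ} {s s' : Sg n} (hs : ∀ x y, s x y = s y x) (hd : ∀ x, s x x = 0)
    (hs' : ∀ x y, s' x y = s' y x) (hd' : ∀ x, s' x x = 0)
    (h : ∀ x y, x < y → s x y = s' x y) : s = s' := by
  funext x y
  rcases lt_trichotomy x y with hxy | hxy | hxy
  · exact h x y hxy
  · subst hxy; rw [hd, hd']
  · rw [hs, hs']; exact h y x hxy

def restr {n : ℕ} (W : Finset (Fin n)) (s : Sg n) : Sg n :=
  fun x y => if x ∈ W ∧ y ∈ W then s x y else 0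

theorem restr_symm {n : ℕ} (W : Finset (Fin n)) (s : Sg n) (hs : ∀ x y, s x y = s y x) (x y : Fin n) :
    restr W s x y = restr W s y x := by
  unfold restr
  rw [hs x y]
  simp only [and_comm]

theorem step_bound {n m : ℕ} (G : Finset (Sg n)) (hG : ∀ s ∈ G, ∀ x y, s x y = s y x)
    (W : Finset (Fin n)) (q : Fin m → Fin n) (hq : ∀ j, q j ∈ W)
    (R : Fin n → Finset (Fin m → SignType)) (ρ L : ℕ) (hρ : 1 ≤ ρ) (hR : ∀ x, (R x).card ≤ ρ)
    (h : ∀ s ∈ G, ∃ Z : Finset (Fin n), Z.card ≤ L ∧ ∀ x ∈ W, x ∉ Z → (fun j => s x (q j)) ∈ R x) :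
    (G.image (restr W)).card ≤ (G.image (restr (W \ Finset.univ.image q))).card *
      (((Finset.univ : Finset (Fin n)).powerset.filter (fun Z => Z.card ≤ L)).card *
        ((3 ^ m) ^ L * ρ ^ W.card)) := by
  classical
  set Q := Finset.univ.image q with hQ
  set 𝒯 : Finset (Fin n → Fin m → SignType) :=
    ((Finset.univ : Finset (Fin n)).powerset.filter (fun Z => Z.card ≤ L)).biUnion
      (fun Z => Fintype.piFinset (fun x => if x ∈ W then (if x ∈ Z then Finset.univ else R x) else {0}))
    with hT
  have hTc : 𝒯.card ≤ ((Finset.univ : Finset (Fin n)).powerset.filter (fun Z => Z.card ≤ L)).card *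
        ((3 ^ m) ^ L * ρ ^ W.card) := by
    refine (Finset.card_biUnion_le_card_mul _ _ _ ?_)
    intro Z hZ
    rw [Fintype.card_piFinset]
    calc _ ≤ ∏ x : Fin n, ((if x ∈ Z then 3 ^ m else 1) * (if x ∈ W then ρ else 1)) := by
          apply Finset.prod_le_prod'
          intro x _
          have h3 : 1 ≤ 3 ^ m := Nat.one_le_pow _ _ (by norm_num)
          by_cases hx : x ∈ W <;> by_cases hz : x ∈ Z <;> simp only [hx, hz, if_true, if_false]
          · rw [Finset.card_univ, Fintype.card_fun, Fintype.card_fin]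
            have : Fintype.card SignType = 3 := rfl
            rw [this]
            exact Nat.le_mul_of_pos_right _ hρ
          · simpa using hR x
          · simpa using h3
          · simp
      _ = (3 ^ m) ^ Z.card * ρ ^ W.card := by
          rw [Finset.prod_mul_distrib]
          simp [Finset.prod_ite, Finset.filter_mem_eq_inter]
      _ ≤ _ := by
          apply Nat.mul_le_mul_right
          exact Nat.pow_le_pow_right (Nat.one_le_pow _ _ (by norm_num)) (Finset.mem_filter.1 hZ).2
  refine le_trans ?_ (Nat.mul_le_mul_left _ hTc)
  rw [← Finset.card_product]
  apply Finset.card_le_card_of_injOn (fun r => (restr (W \ Q) r, fun x j => r x (q j)))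
  · intro r hr
    simp only [Finset.mem_coe, Finset.mem_image] at hr
    obtain ⟨s, hs, rfl⟩ := hr
    simp only [Finset.coe_product, Set.mem_prod, Finset.mem_coe]
    constructor
    · refine Finset.mem_image.2 ⟨s, hs, ?_⟩
      funext x y
      unfold restr
      by_cases hx : x ∈ W \ Q ∧ y ∈ W \ Q
      · simp only [hx]
        simp [(Finset.mem_sdiff.1 hx.1).1, (Finset.mem_sdiff.1 hx.2).1]
      · simp only [hx, if_false]
    · obtain ⟨Z, hZ, hZ'⟩ := h s hs
      rw [hT, Finset.mem_biUnion]
      refine ⟨Z, by simp [hZ], ?_⟩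
      rw [Fintype.mem_piFinset]
      intro x
      by_cases hx : x ∈ W <;> by_cases hz : x ∈ Z
      · simp [hx, hz]
      · simp only [hx, hz, if_true, if_false]
        have := hZ' x hx hz
        simpa [restr, hx, hq] using this
      · simp only [hx, if_false, Finset.mem_singleton]
        funext j; simp [restr, hx]
      · simp only [hx, if_false, Finset.mem_singleton]
        funext j; simp [restr, hx]
  · intro r hr r' hr' heq
    simp only [Finset.mem_coe, Finset.mem_image] at hr hr'
    obtain ⟨s, hs, rfl⟩ := hr
    obtain ⟨s', hs', rfl⟩ := hr'
    simp only [Prod.mk.injEq] at heq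
    obtain ⟨h1, h2⟩ := heq
    have hsy := restr_symm W s (hG s hs)
    have hsy' := restr_symm W s' (hG s' hs')
    funext x y
    by_cases hx : x ∈ W
    swap
    · simp [restr, hx]
    by_cases hy : y ∈ W
    swap
    · simp [restr, hy]
    by_cases hxq : x ∈ Q
    · obtain ⟨j, _, rfl⟩ := Finset.mem_image.1 hxq
      rw [hsy, hsy']
      exact congrFun (congrFun h2 y) j
    by_cases hyq : y ∈ Q
    · obtain ⟨j, _, rfl⟩ := Finset.mem_image.1 hyq
      exact congrFun (congrFun h2 x) j
    have := congrFun (congrFun h1 x) y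
    unfold restr at this ⊢
    simpa [hx, hy, hxq, hyq] using this

structure Cfg {n : ℕ} (P : Fin n → Fin n → Prop) (τ : Sg n) (k : ℕ) (s : Sg n) : Prop where
  symm : ∀ x y, s x y = s y x
  diag : ∀ x, s x x = 0
  opt : ∀ x y, x ≠ y → ¬ P x y → s x y = 0 ∨ s x y = τ x y
  cod : ∀ x y, P x y → (Finset.univ.filter (fun z => s z x ≠ 0 ∧ s z y ≠ 0)).card ≤ k

theorem triangle_step {n k : ℕ} (P : Fin n → Fin n → Prop) (τ : Sg n)
    (G : Finset (Sg n)) (hG : ∀ s ∈ G, Cfg P τ k s) (W : Finset (Fin n)) (a b c : Fin n)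
    (ha : a ∈ W) (hb : b ∈ W) (hc : c ∈ W) (hab : P a b) (hac : P a c) (hbc : P b c) :
    (G.image (restr W)).card ≤ (G.image (restr (W \ Finset.univ.image ![a, b, c]))).card *
      (((Finset.univ : Finset (Fin n)).powerset.filter (fun Z => Z.card ≤ 4 * k + 4)).card *
        ((3 ^ 3) ^ (4 * k + 4) * 7 ^ W.card)) := by
  classical
  apply step_bound G (fun s hs => (hG s hs).symm) W ![a, b, c] (by intro j; fin_cases j <;> simpa)
    (fun _ => Finset.univ.filter (fun t : Fin 3 → SignType => (t 0 = 0 ∨ t 1 = 0) ∧ (t 0 = 0 ∨ t 2 = 0) ∧ (t 1 = 0 ∨ t 2 = 0)))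
    7 (4 * k + 4) (by norm_num)
  · intro _; decide
  · intro s hs
    have h1 := (hG s hs).cod a b hab
    have h2 := (hG s hs).cod a c hac
    have h3 := (hG s hs).cod b c hbc
    refine ⟨(Finset.univ.filter (fun z => s z a ≠ 0 ∧ s z b ≠ 0)) ∪
      ((Finset.univ.filter (fun z => s z a ≠ 0 ∧ s z c ≠ 0)) ∪
      (Finset.univ.filter (fun z => s z b ≠ 0 ∧ s z c ≠ 0))), ?_, ?_⟩
    · refine (Finset.card_union_le _ _).trans ?_
      have := Finset.card_union_le (Finset.univ.filter (fun z => s z a ≠ 0 ∧ s z c ≠ 0))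
        (Finset.univ.filter (fun z => s z b ≠ 0 ∧ s z c ≠ 0))
      omega
    · intro x _ hx
      simp only [Finset.mem_union, Finset.mem_filter, Finset.mem_univ, true_and, not_or, not_and_or, not_not] at hx
      simpa using hx

theorem c4card (a b : SignType) : (Finset.univ.filter (fun t : Fin 4 → SignType =>
    (t 0 = 0 ∨ t 0 = a) ∧ (t 1 = 0 ∨ t 1 = b) ∧ ((t 0 = 0 ∧ t 1 = 0) ∨ (t 2 = 0 ∧ t 3 = 0)))).card ≤ 12 := by
  revert a b; decide

theorem c4card' (a b : SignType) : (Finset.univ.filter (fun t : Fin 4 → SignType =>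
    (t 2 = 0 ∨ t 2 = a) ∧ (t 3 = 0 ∨ t 3 = b) ∧ ((t 0 = 0 ∧ t 1 = 0) ∨ (t 2 = 0 ∧ t 3 = 0)))).card ≤ 12 := by
  revert a b; decide

theorem c4_step {n k : ℕ} (P : Fin n → Fin n → Prop) (hPs : ∀ x y, P x y → P y x) (τ : Sg n)
    (G : Finset (Sg n)) (hG : ∀ s ∈ G, Cfg P τ k s) (W : Finset (Fin n)) (a b c d : Fin n)
    (ha : a ∈ W) (hb : b ∈ W) (hc : c ∈ W) (hd : d ∈ W) (hac : P a c) (had : P a d) (hbc : P b c) (hbd : P b d)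
    (htf : ∀ x ∈ W, ∀ y ∈ W, ∀ z ∈ W, P x y → P x z → P y z → False) :
    (G.image (restr W)).card ≤ (G.image (restr (W \ Finset.univ.image ![a, b, c, d]))).card *
      (((Finset.univ : Finset (Fin n)).powerset.filter (fun Z => Z.card ≤ 4 * k + 4)).card *
        ((3 ^ 4) ^ (4 * k + 4) * 12 ^ W.card)) := by
  classical
  apply step_bound G (fun s hs => (hG s hs).symm) W ![a, b, c, d] (by intro j; fin_cases j <;> simpa)
    (fun x => if ¬ P x a ∧ ¬ P x b then
      Finset.univ.filter (fun t : Fin 4 → SignType =>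
    (t 0 = 0 ∨ t 0 = τ x a) ∧ (t 1 = 0 ∨ t 1 = τ x b) ∧ ((t 0 = 0 ∧ t 1 = 0) ∨ (t 2 = 0 ∧ t 3 = 0)))
     else Finset.univ.filter (fun t : Fin 4 → SignType =>
    (t 2 = 0 ∨ t 2 = τ x c) ∧ (t 3 = 0 ∨ t 3 = τ x d) ∧ ((t 0 = 0 ∧ t 1 = 0) ∨ (t 2 = 0 ∧ t 3 = 0))))
    12 (4 * k + 4) (by norm_num)
  · intro x
    split_ifs
    · exact c4card _ _
    · exact c4card' _ _
  · intro s hs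
    have h1 := (hG s hs).cod a c hac
    have h2 := (hG s hs).cod a d had
    have h3 := (hG s hs).cod b c hbc
    have h4 := (hG s hs).cod b d hbd
    refine ⟨{a, b, c, d} ∪ (((Finset.univ.filter (fun z => s z a ≠ 0 ∧ s z c ≠ 0)) ∪
      (Finset.univ.filter (fun z => s z a ≠ 0 ∧ s z d ≠ 0))) ∪
      ((Finset.univ.filter (fun z => s z b ≠ 0 ∧ s z c ≠ 0)) ∪
      (Finset.univ.filter (fun z => s z b ≠ 0 ∧ s z d ≠ 0)))), ?_, ?_⟩
    · refine (Finset.card_union_le _ _).trans ?_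
      have h5 : ({a, b, c, d} : Finset (Fin n)).card ≤ 4 := Finset.card_le_four
      have h6 := Finset.card_union_le ((Finset.univ.filter (fun z => s z a ≠ 0 ∧ s z c ≠ 0)) ∪
      (Finset.univ.filter (fun z => s z a ≠ 0 ∧ s z d ≠ 0))) ((Finset.univ.filter (fun z => s z b ≠ 0 ∧ s z c ≠ 0)) ∪
      (Finset.univ.filter (fun z => s z b ≠ 0 ∧ s z d ≠ 0)))
      have h7 := Finset.card_union_le (Finset.univ.filter (fun z => s z a ≠ 0 ∧ s z c ≠ 0))
        (Finset.univ.filter (fun z => s z a ≠ 0 ∧ s z d ≠ 0))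
      have h8 := Finset.card_union_le (Finset.univ.filter (fun z => s z b ≠ 0 ∧ s z c ≠ 0))
        (Finset.univ.filter (fun z => s z b ≠ 0 ∧ s z d ≠ 0))
      omega
    · intro x hxW hx
      simp only [Finset.mem_union, Finset.mem_insert, Finset.mem_singleton, Finset.mem_filter, Finset.mem_univ, true_and, not_or, not_and_or, not_not] at hx
      obtain ⟨⟨n1, n2, n3, n4⟩, ⟨e1, e2⟩, e3, e4⟩ := hx
      have key : (s x a = 0 ∧ s x b = 0) ∨ (s x c = 0 ∧ s x d = 0) := by tauto
      split_ifs with hP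
      · simp only [Finset.mem_filter, Finset.mem_univ, true_and]
        exact ⟨(hG s hs).opt x a n1 hP.1, (hG s hs).opt x b n2 hP.2, key⟩
      · have hPc : ¬ P x c := by
          intro hxc
          apply hP
          exact ⟨fun hxa => htf x hxW a ha c hc hxa hxc hac, fun hxb => htf x hxW b hb c hc hxb hxc hbc⟩
        have hPd : ¬ P x d := by
          intro hxc
          apply hP
          exact ⟨fun hxa => htf x hxW a ha d hd hxa hxc had, fun hxb => htf x hxW b hb d hd hxb hxc hbd⟩
        simp only [Finset.mem_filter, Finset.mem_univ, true_and]
        exact ⟨(hG s hs).opt x c n3 hPc, (hG s hs).opt x d n4 hPd, key⟩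

open scoped Classical in
noncomputable def eP {n : ℕ} (P : Fin n → Fin n → Prop) (W : Finset (Fin n)) : ℕ :=
  ((W ×ˢ W).filter (fun p => P p.1 p.2)).card

theorem eP_sdiff {n : ℕ} (P : Fin n → Fin n → Prop) (W Q : Finset (Fin n)) (hQ : Q ⊆ W) :
    eP P W ≤ eP P (W \ Q) + 2 * Q.card * W.card := by
  classical
  have : (W ×ˢ W).filter (fun p => P p.1 p.2) ⊆
      ((W \ Q) ×ˢ (W \ Q)).filter (fun p => P p.1 p.2) ∪ (Q ×ˢ W ∪ W ×ˢ Q) := by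
    intro p hp
    simp only [Finset.mem_filter, Finset.mem_product, Finset.mem_union, Finset.mem_sdiff] at hp ⊢
    tauto
  have h2 := Finset.card_le_card this
  have h3 := h2.trans (Finset.card_union_le _ _)
  have h4 := Finset.card_union_le (Q ×ˢ W) (W ×ˢ Q)
  simp only [Finset.card_product] at h4
  unfold eP
  nlinarith

theorem eP_base {n : ℕ} (P : Fin n → Fin n → Prop) (W : Finset (Fin n))
    (h : ∀ a ∈ W, ∀ b ∈ W, ∀ c ∈ W, ∀ d ∈ W, a ≠ b → c ≠ d → P a c → P a d → P b c → P b d → False) :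
    (eP P W) ^ 2 ≤ 2 * n ^ 3 := by
  classical
  have hw : W.card ≤ n := by simpa using Finset.card_le_univ W
  have e1 : eP P W = ∑ x ∈ W, (W.filter (fun y => P x y)).card := by
    unfold eP
    rw [Finset.card_filter, Finset.sum_product]
    simp only [Finset.card_filter]
  have e2 : ∑ x ∈ W, (W.filter (fun y => P x y)).card ^ 2 ≤ 2 * n ^ 2 := by
    have : ∑ x ∈ W, (W.filter (fun y => P x y)).card ^ 2 =
        ∑ q ∈ W ×ˢ W, (W.filter (fun x => P x q.1 ∧ P x q.2)).card := by
      simp only [Finset.card_filter]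
      rw [Finset.sum_comm]
      apply Finset.sum_congr rfl
      intro x _
      rw [sq, Finset.sum_mul_sum, Finset.sum_product]
      apply Finset.sum_congr rfl; intro y _
      apply Finset.sum_congr rfl; intro z _
      by_cases h1 : P x y <;> by_cases h2 : P x z <;> simp [h1, h2]
    rw [this]
    calc _ ≤ ∑ q ∈ W ×ˢ W, (1 + if q.1 = q.2 then n else 0) := by
          apply Finset.sum_le_sum
          intro q hq
          rw [Finset.mem_product] at hq
          by_cases hqq : q.1 = q.2
          · rw [if_pos hqq]
            exact ((Finset.card_filter_le _ _).trans hw).trans (by omega)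
          · rw [if_neg hqq, add_zero, Finset.card_le_one]
            intro a ha b hb
            rw [Finset.mem_filter] at ha hb
            by_contra hab
            exact h a ha.1 b hb.1 q.1 hq.1 q.2 hq.2 hab hqq ha.2.1 ha.2.2 hb.2.1 hb.2.2
      _ = W.card * W.card + W.card * n := by
          rw [Finset.sum_add_distrib, Finset.sum_product (f := fun q => if q.1 = q.2 then n else 0)]
          simp
      _ ≤ 2 * n ^ 2 := by nlinarith
  rw [e1]
  have := sq_sum_le_card_mul_sum_sq (s := W) (f := fun x => (W.filter (fun y => P x y)).card)
  calc _ ≤ W.card * ∑ x ∈ W, (W.filter (fun y => P x y)).card ^ 2 := this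
    _ ≤ n * (2 * n ^ 2) := Nat.mul_le_mul hw e2
    _ = _ := by ring

theorem pairs_lt {n : ℕ} (W : Finset (Fin n)) :
    2 * ((W ×ˢ W).filter (fun p => p.1 < p.2)).card ≤ W.card ^ 2 := by
  classical
  have h1 : ((W ×ˢ W).filter (fun p => p.2 < p.1)).card = ((W ×ˢ W).filter (fun p => p.1 < p.2)).card := by
    apply Finset.card_bij (fun p _ => p.swap)
    · intro p hp; simp only [Finset.mem_filter, Finset.mem_product, Prod.fst_swap, Prod.snd_swap] at hp ⊢; tauto
    · intro p _ q _ h; exact Prod.swap_injective h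
    · intro p hp; refine ⟨p.swap, ?_, by simp⟩
      simp only [Finset.mem_filter, Finset.mem_product, Prod.fst_swap, Prod.snd_swap] at hp ⊢; tauto
  have h2 : ((W ×ˢ W).filter (fun p => p.1 < p.2)).card + ((W ×ˢ W).filter (fun p => p.2 < p.1)).card ≤ (W ×ˢ W).card := by
    rw [← Finset.card_union_of_disjoint]
    · apply Finset.card_le_card
      intro p hp
      simp only [Finset.mem_union, Finset.mem_filter] at hp; tauto
    · rw [Finset.disjoint_left]
      intro p hp hq
      rw [Finset.mem_filter] at hp hq
      exact lt_asymm hp.2 hq.2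
  rw [Finset.card_product] at h2
  rw [sq]; omega

theorem base_count {n k : ℕ} (P : Fin n → Fin n → Prop) (τ : Sg n)
    (G : Finset (Sg n)) (hG : ∀ s ∈ G, Cfg P τ k s) (W : Finset (Fin n)) :
    (G.image (restr W)).card ≤ 2 ^ ((W ×ˢ W).filter (fun p => p.1 < p.2)).card * 2 ^ (eP P W) := by
  classical
  have := card_le_pi (G.image (restr W)) (fun r (p : Fin n × Fin n) => if p.1 < p.2 then r p.1 p.2 else 0)
    (fun p => if (p.1 ∈ W ∧ p.2 ∈ W) ∧ p.1 < p.2 then (if P p.1 p.2 then Finset.univ else {0, τ p.1 p.2}) else {0})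
    ?_ ?_
  · refine this.trans ?_
    calc _ ≤ ∏ p : Fin n × Fin n, ((if (p.1 ∈ W ∧ p.2 ∈ W) ∧ p.1 < p.2 then 2 else 1) *
          (if (p.1 ∈ W ∧ p.2 ∈ W) ∧ P p.1 p.2 then 2 else 1)) := by
          apply Finset.prod_le_prod'
          intro p _
          by_cases h1 : (p.1 ∈ W ∧ p.2 ∈ W) ∧ p.1 < p.2
          · rw [if_pos h1, if_pos h1]
            by_cases h2 : P p.1 p.2
            · rw [if_pos h2, if_pos ⟨h1.1, h2⟩]; decide
            · rw [if_neg h2, if_neg (fun h => h2 h.2)]; exact Finset.card_le_two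
          · rw [if_neg h1, if_neg h1]
            split_ifs <;> simp
      _ = _ := by
          rw [Finset.prod_mul_distrib, Finset.prod_ite, Finset.prod_ite]
          simp only [Finset.prod_const, one_pow, mul_one, eP]
          congr 3
          · ext p; simp
          · ext p; simp
  · intro r hr r' hr' h
    simp only [Finset.mem_coe, Finset.mem_image] at hr hr'
    obtain ⟨s, hs, rfl⟩ := hr
    obtain ⟨s', hs', rfl⟩ := hr'
    apply sg_ext (restr_symm W s (hG s hs).symm) _ (restr_symm W s' (hG s' hs').symm)
    · intro x; simp [restr, (hG s' hs').diag]
    · intro x y hxy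
      have := congrFun h (x, y)
      simpa [hxy] using this
    · intro x; simp [restr, (hG s hs).diag]
  · intro r hr p
    simp only [Finset.mem_image] at hr
    obtain ⟨s, hs, rfl⟩ := hr
    by_cases h1 : p.1 < p.2
    · by_cases h2 : p.1 ∈ W ∧ p.2 ∈ W
      · by_cases h3 : P p.1 p.2
        · simp [h1, h2, h3]
        · have := (hG s hs).opt p.1 p.2 h1.ne h3
          simp only [h1, h2, h3, restr, and_self, if_true, if_false, Finset.mem_insert, Finset.mem_singleton]
          exact this
      · simp [h1, h2, restr]
    · simp [h1]

theorem logb7 : (7 : ℝ) ≤ (2 : ℝ) ^ (2.82 : ℝ) := by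
  have h : (7 : ℝ) ^ (50 : ℕ) ≤ ((2 : ℝ) ^ (2.82 : ℝ)) ^ (50 : ℕ) := by
    rw [← Real.rpow_natCast ((2 : ℝ) ^ (2.82 : ℝ)), ← Real.rpow_mul (by norm_num)]
    have : (2.82 : ℝ) * ((50 : ℕ) : ℝ) = ((141 : ℕ) : ℝ) := by norm_num
    rw [this, Real.rpow_natCast]; norm_num
  exact le_of_pow_le_pow_left₀ (by norm_num) (by positivity) h

theorem logb12 : (12 : ℝ) ≤ (2 : ℝ) ^ (3.6 : ℝ) := by
  have h : (12 : ℝ) ^ (5 : ℕ) ≤ ((2 : ℝ) ^ (3.6 : ℝ)) ^ (5 : ℕ) := by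
    rw [← Real.rpow_natCast ((2 : ℝ) ^ (3.6 : ℝ)), ← Real.rpow_mul (by norm_num)]
    have : (3.6 : ℝ) * ((5 : ℕ) : ℝ) = ((18 : ℕ) : ℝ) := by norm_num
    rw [this, Real.rpow_natCast]; norm_num
  exact le_of_pow_le_pow_left₀ (by norm_num) (by positivity) h

theorem A1_step {n k m ρ : ℕ} (P : Fin n → Fin n → Prop)
    (G : Finset (Sg n)) (W : Finset (Fin n)) (q : Fin m → Fin n) (hq : ∀ j, q j ∈ W) (hqi : Function.Injective q)
    (K E0 lr : ℝ) (hK0 : 0 ≤ K) (hm3 : 3 ≤ m) (hm4 : m ≤ 4)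
    (hK : ((((Finset.univ : Finset (Fin n)).powerset.filter (fun Z => Z.card ≤ 4 * k + 4)).card : ℝ)) *
      (3 ^ 4) ^ (4 * k + 4) ≤ (2 : ℝ) ^ K)
    (hlr : (ρ : ℝ) ≤ 2 ^ lr) (hlr2 : lr ≤ m - 0.06 * m)
    (hs : (G.image (restr W)).card ≤ (G.image (restr (W \ Finset.univ.image q))).card *
      (((Finset.univ : Finset (Fin n)).powerset.filter (fun Z => Z.card ≤ 4 * k + 4)).card *
        ((3 ^ m) ^ (4 * k + 4) * ρ ^ W.card)))
    (ih : ((G.image (restr (W \ Finset.univ.image q))).card : ℝ) ≤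
      (2 : ℝ) ^ (((W \ Finset.univ.image q).card : ℝ) ^ 2 / 2 - 0.03 * eP P (W \ Finset.univ.image q)
        + (K + 8) * (W \ Finset.univ.image q).card + 2 * E0)) :
    ((G.image (restr W)).card : ℝ) ≤
      (2 : ℝ) ^ ((W.card : ℝ) ^ 2 / 2 - 0.03 * eP P W + (K + 8) * W.card + 2 * E0) := by
  classical
  set Q := Finset.univ.image q with hQdef
  have hQW : Q ⊆ W := by
    intro x hx
    rw [hQdef, Finset.mem_image] at hx
    obtain ⟨j, _, rfl⟩ := hx; exact hq j
  have hQc : Q.card = m := by rw [hQdef, Finset.card_image_of_injective _ hqi]; simp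
  have hW' : ((W \ Q).card : ℝ) = W.card - m := by
    rw [Finset.card_sdiff_of_subset hQW, Nat.cast_sub (Finset.card_le_card hQW), hQc]
  have he : (eP P W : ℝ) ≤ eP P (W \ Q) + 2 * m * W.card := by
    have := eP_sdiff P W Q hQW
    rw [hQc] at this; exact_mod_cast this
  rw [hW'] at ih
  set w : ℝ := (W.card : ℝ) with hw
  have hw0 : 0 ≤ w := by positivity
  have hm3' : (3 : ℝ) ≤ m := by exact_mod_cast hm3
  have hm4' : (m : ℝ) ≤ 4 := by exact_mod_cast hm4
  set C : ℝ := ((((Finset.univ : Finset (Fin n)).powerset.filter (fun Z => Z.card ≤ 4 * k + 4)).card : ℝ))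
  have h1 : C * (3 ^ m) ^ (4 * k + 4) ≤ 2 ^ K := by
    refine le_trans ?_ hK
    gcongr
    norm_num
  have h2 : (ρ : ℝ) ^ W.card ≤ 2 ^ (lr * w) := by
    rw [Real.rpow_mul (by norm_num), hw, Real.rpow_natCast]
    gcongr
  calc ((G.image (restr W)).card : ℝ) ≤ (G.image (restr (W \ Q))).card * (C * (3 ^ m) ^ (4 * k + 4) * ρ ^ W.card) := by
        have : ((G.image (restr W)).card : ℝ) ≤ (((G.image (restr (W \ Q))).card *
      (((Finset.univ : Finset (Fin n)).powerset.filter (fun Z => Z.card ≤ 4 * k + 4)).card *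
        ((3 ^ m) ^ (4 * k + 4) * ρ ^ W.card)) : ℕ) : ℝ) := by exact_mod_cast hs
        push_cast at this
        rw [mul_assoc C]
        exact this
    _ ≤ (2 : ℝ) ^ ((w - m) ^ 2 / 2 - 0.03 * eP P (W \ Q) + (K + 8) * (w - m) + 2 * E0) * (2 ^ K * 2 ^ (lr * w)) := by
        gcongr
    _ ≤ _ := by
        rw [← Real.rpow_add (by norm_num), ← Real.rpow_add (by norm_num)]
        apply Real.rpow_le_rpow_of_exponent_le (by norm_num)
        nlinarith [mul_le_mul_of_nonneg_right hlr2 hw0, mul_le_mul_of_nonneg_right hm3' hK0]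

theorem A1 {n k : ℕ} (P : Fin n → Fin n → Prop) (hPs : ∀ x y, P x y → P y x) (hPi : ∀ x, ¬ P x x) (τ : Sg n)
    (G : Finset (Sg n)) (hG : ∀ s ∈ G, Cfg P τ k s) (K E0 : ℝ) (hK0 : 0 ≤ K)
    (hK : ((((Finset.univ : Finset (Fin n)).powerset.filter (fun Z => Z.card ≤ 4 * k + 4)).card : ℝ)) *
      (3 ^ 4) ^ (4 * k + 4) ≤ (2 : ℝ) ^ K) (hE0 : 0 ≤ E0) (hE : (2 : ℝ) * n ^ 3 ≤ E0 ^ 2) :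
    ∀ (w : ℕ) (W : Finset (Fin n)), W.card = w → ((G.image (restr W)).card : ℝ) ≤
      (2 : ℝ) ^ ((W.card : ℝ) ^ 2 / 2 - 0.03 * eP P W + (K + 8) * W.card + 2 * E0) := by
  classical
  intro w
  induction w using Nat.strong_induction_on with
  | _ w ih =>
  intro W hW
  have hlt : ∀ {m : ℕ} (q : Fin m → Fin n) (hq : ∀ j, q j ∈ W) (j : Fin m), (W \ Finset.univ.image q).card < w := by
    intro m q hq j
    rw [← hW]
    apply Finset.card_lt_card
    refine ⟨Finset.sdiff_subset, fun h => ?_⟩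
    have := h (hq j)
    simp at this
  by_cases ht : ∀ x ∈ W, ∀ y ∈ W, ∀ z ∈ W, P x y → P x z → P y z → False
  · by_cases hc : ∀ a ∈ W, ∀ b ∈ W, ∀ c ∈ W, ∀ d ∈ W, a ≠ b → c ≠ d → P a c → P a d → P b c → P b d → False
    · have h1 : (eP P W : ℝ) ≤ E0 := by
        have := eP_base P W hc
        apply le_of_sq_le_sq _ hE0
        refine le_trans ?_ hE
        exact_mod_cast this
      have h2 := base_count P τ G hG W
      have h3 := pairs_lt W
      have h2' : ((G.image (restr W)).card : ℝ) ≤ 2 ^ ((((W ×ˢ W).filter (fun p => p.1 < p.2)).card : ℝ)) * 2 ^ (eP P W : ℝ) := by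
        rw [Real.rpow_natCast, Real.rpow_natCast]; exact_mod_cast h2
      refine h2'.trans ?_
      rw [← Real.rpow_add (by norm_num)]
      apply Real.rpow_le_rpow_of_exponent_le (by norm_num)
      have h3' : 2 * ((((W ×ˢ W).filter (fun p => p.1 < p.2)).card : ℝ)) ≤ (W.card : ℝ) ^ 2 := by exact_mod_cast h3
      have h4 : 0 ≤ (K + 8) * (W.card : ℝ) := by positivity
      linarith
    · push Not at hc
      obtain ⟨a, ha, b, hb, c, hc, d, hd, hab, hcd, hac, had, hbc, hbd, -⟩ := hc
      have hq : ∀ j, ![a, b, c, d] j ∈ W := by intro j; fin_cases j <;> simpa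
      have hne : ∀ {x y}, P x y → x ≠ y := by rintro x y h rfl; exact hPi _ h
      have hinj : Function.Injective ![a, b, c, d] := by
        intro i j hij
        have := hne hac; have := hne had; have := hne hbc; have := hne hbd
        fin_cases i <;> fin_cases j <;> simp_all
      refine A1_step P G W ![a, b, c, d] hq hinj K E0 3.6 hK0 (by norm_num) (by norm_num) hK logb12 (by norm_num)
        (c4_step P hPs τ G hG W a b c d ha hb hc hd hac had hbc hbd ht) ?_
      exact ih _ (hlt _ hq 0) _ rfl
  · push Not at ht
    obtain ⟨a, ha, b, hb, c, hc, hab, hac, hbc, -⟩ := ht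
    have hq : ∀ j, ![a, b, c] j ∈ W := by intro j; fin_cases j <;> simpa
    have hne : ∀ {x y}, P x y → x ≠ y := by rintro x y h rfl; exact hPi _ h
    have hinj : Function.Injective ![a, b, c] := by
      intro i j hij
      have := hne hab; have := hne hac; have := hne hbc
      fin_cases i <;> fin_cases j <;> simp_all
    refine A1_step P G W ![a, b, c] hq hinj K E0 2.82 hK0 (by norm_num) (by norm_num) hK logb7 (by norm_num)
      (triangle_step P τ G hG W a b c ha hb hc hab hac hbc) ?_
    exact ih _ (hlt _ hq 0) _ rfl

theorem A1_univ {n k : ℕ} (P : Fin n → Fin n → Prop) (hPs : ∀ x y, P x y → P y x) (hPi : ∀ x, ¬ P x x) (τ : Sg n)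
    (G : Finset (Sg n)) (hG : ∀ s ∈ G, Cfg P τ k s) (K E0 : ℝ) (hK0 : 0 ≤ K)
    (hK : ((((Finset.univ : Finset (Fin n)).powerset.filter (fun Z => Z.card ≤ 4 * k + 4)).card : ℝ)) *
      (3 ^ 4) ^ (4 * k + 4) ≤ (2 : ℝ) ^ K) (hE0 : 0 ≤ E0) (hE : (2 : ℝ) * n ^ 3 ≤ E0 ^ 2) :
    (G.card : ℝ) ≤ (2 : ℝ) ^ ((n : ℝ) ^ 2 / 2 - 0.03 * eP P Finset.univ + (K + 8) * n + 2 * E0) := by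
  have := A1 P hPs hPi τ G hG K E0 hK0 hK hE0 hE n Finset.univ (by simp)
  have h2 : G.image (restr Finset.univ) = G := by
    have : (restr Finset.univ : Sg n → Sg n) = id := by
      funext s x y; simp [restr]
    rw [this, Finset.image_id]
  rw [h2] at this
  simpa using this

theorem sampling {n : ℕ} (q k : ℕ) (s : Sg n) (h : n ^ 2 * (n - (k + 1)) ^ q < n ^ q) :
    ∃ t : Fin q → Fin n, ∀ x y, k < (Finset.univ.filter (fun z => s z x ≠ 0 ∧ s z y ≠ 0)).card →
      ∃ i, s (t i) x ≠ 0 ∧ s (t i) y ≠ 0 := by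
  classical
  by_contra hcon
  push Not at hcon
  set bad : Finset (Fin n × Fin n) := Finset.univ.filter
    (fun p => k < (Finset.univ.filter (fun z => s z p.1 ≠ 0 ∧ s z p.2 ≠ 0)).card) with hbad
  have h1 : (Finset.univ : Finset (Fin q → Fin n)) ⊆ bad.biUnion (fun p =>
      Fintype.piFinset (fun _ => Finset.univ.filter (fun z => ¬ (s z p.1 ≠ 0 ∧ s z p.2 ≠ 0)))) := by
    intro t _
    obtain ⟨x, y, hk, hxy⟩ := hcon t
    refine Finset.mem_biUnion.2 ⟨(x, y), ?_, ?_⟩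
    · rw [hbad, Finset.mem_filter]; exact ⟨Finset.mem_univ _, hk⟩
    · rw [Fintype.mem_piFinset]
      intro i
      rw [Finset.mem_filter]
      exact ⟨Finset.mem_univ _, fun hh => hh.2 (hxy i hh.1)⟩
  have h2 := Finset.card_le_card h1
  have h3 := h2.trans (Finset.card_biUnion_le_card_mul _ _ ((n - (k + 1)) ^ q) ?_)
  · rw [Finset.card_univ, Fintype.card_fun, Fintype.card_fin, Fintype.card_fin] at h3
    have h4 : bad.card ≤ n ^ 2 := by
      refine (Finset.card_le_univ _).trans ?_
      simp [sq]
    have := Nat.mul_le_mul_right ((n - (k + 1)) ^ q) h4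
    omega
  · intro p hp
    rw [hbad, Finset.mem_filter] at hp
    rw [Fintype.card_piFinset, Finset.prod_const, Finset.card_univ, Fintype.card_fin]
    apply Nat.pow_le_pow_left
    have := Finset.card_filter_add_card_filter_not (s := (Finset.univ : Finset (Fin n))) (fun z => s z p.1 ≠ 0 ∧ s z p.2 ≠ 0)
    rw [Finset.card_univ, Fintype.card_fin] at this
    have := hp.2
    omega

def Pd {n q : ℕ} (d : Fin q → Fin n → SignType) (x y : Fin n) : Prop :=
  x ≠ y ∧ ∀ i, d i x = 0 ∨ d i y = 0

open scoped Classical in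
noncomputable def td {n q : ℕ} (d : Fin q → Fin n → SignType) : Sg n := fun x y =>
  if h : ∃ i, d i x ≠ 0 ∧ d i y ≠ 0 then d h.choose x * d h.choose y else 0

theorem Pd_symm {n q : ℕ} (d : Fin q → Fin n → SignType) (x y : Fin n) (h : Pd d x y) : Pd d y x :=
  ⟨h.1.symm, fun i => (h.2 i).symm⟩

theorem Pd_irrefl {n q : ℕ} (d : Fin q → Fin n → SignType) (x : Fin n) : ¬ Pd d x x :=
  fun h => h.1 rfl

theorem sign_aux : ∀ a b c : SignType, a * c * b ≠ -1 → a ≠ 0 → b ≠ 0 → c = 0 ∨ c = a * b := by decide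

theorem cfg_of {n q k : ℕ} (s : Sg n) (hs : IsS s) (t : Fin q → Fin n)
    (ht : ∀ x y, k < (Finset.univ.filter (fun z => s z x ≠ 0 ∧ s z y ≠ 0)).card →
      ∃ i, s (t i) x ≠ 0 ∧ s (t i) y ≠ 0) :
    Cfg (Pd (fun i x => s (t i) x)) (td (fun i x => s (t i) x)) k s := by
  classical
  refine ⟨hs.symm, hs.diag, ?_, ?_⟩
  · intro x y hxy hP
    have h : ∃ i, s (t i) x ≠ 0 ∧ s (t i) y ≠ 0 := by
      by_contra hcon
      push Not at hcon
      refine hP ⟨hxy, fun i => ?_⟩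
      by_cases hx : s (t i) x = 0
      · exact Or.inl hx
      · exact Or.inr (hcon i hx)
    have : td (fun i x => s (t i) x) x y = s (t h.choose) x * s (t h.choose) y := by
      unfold td; rw [dif_pos h]
    rw [this]
    exact sign_aux _ _ _ (hs.tri (t h.choose) x y) h.choose_spec.1 h.choose_spec.2
  · intro x y hP
    by_contra hcon
    obtain ⟨i, hi⟩ := ht x y (not_le.1 hcon)
    rcases hP.2 i with h | h
    · exact hi.1 h
    · exact hi.2 h

/-- support -/
def Sup {n : ℕ} (s : Sg n) : Finset (Fin n × Fin n) := (Tp n).filter (fun p => s p.1 p.2 ≠ 0)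

theorem small_P_count {n q k : ℕ} (d : Fin q → Fin n → SignType) (F : Finset (Sg n))
    (hF : ∀ s ∈ F, Cfg (Pd d) (td d) k s) :
    F.card ≤ (F.image Sup).card * 2 ^ (eP (Pd d) Finset.univ) := by
  classical
  have h1 : F.card ≤ ((F.image Sup) ×ˢ ((Tp n).filter (fun p => Pd d p.1 p.2)).powerset).card := by
    apply Finset.card_le_card_of_injOn (fun s => (Sup s, ((Tp n).filter (fun p => Pd d p.1 p.2)).filter (fun p => s p.1 p.2 = -1)))
    · intro s hs
      simp only [Finset.coe_product, Set.mem_prod, Finset.mem_coe, Finset.mem_powerset]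
      exact ⟨Finset.mem_image_of_mem _ hs, Finset.filter_subset _ _⟩
    · intro s hs s' hs' h
      simp only [Prod.mk.injEq] at h
      obtain ⟨ha, hb⟩ := h
      have cs := hF s hs
      have cs' := hF s' hs'
      apply sg_ext cs.symm cs.diag cs'.symm cs'.diag
      intro x y hxy
      have hT : (x, y) ∈ Tp n := by simp [Tp, hxy]
      have ha' := Finset.ext_iff.1 ha (x, y)
      have hb' := Finset.ext_iff.1 hb (x, y)
      simp only [Sup, Finset.mem_filter, hT, true_and] at ha' hb'
      by_cases hP : Pd d x y
      · simp only [hP, true_and] at hb'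
        generalize s x y = a at *
        generalize s' x y = b at *
        clear ha hb hT
        revert a b; decide
      · have o := cs.opt x y hxy.ne hP
        have o' := cs'.opt x y hxy.ne hP
        generalize s x y = a at *
        generalize s' x y = b at *
        generalize td d x y = c at *
        by_cases hz : a = 0
        · have : b = 0 := by by_contra hb0; exact (ha'.2 hb0) hz
          rw [hz, this]
        · have hz' := ha'.1 hz
          rw [o.resolve_left hz, o'.resolve_left hz']
  rw [Finset.card_product, Finset.card_powerset] at h1
  refine h1.trans (Nat.mul_le_mul_left _ (Nat.pow_le_pow_right (by norm_num) ?_))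
  apply Finset.card_le_card
  intro p hp
  rw [Finset.mem_filter] at hp ⊢
  exact ⟨by simp, hp.2⟩

def ND {n : ℕ} (ρ ε : ℝ) (E : Finset (Fin n × Fin n)) : Prop :=
  ∃ X Y : Finset (Fin n), ε * n ≤ X.card ∧ ε * n ≤ Y.card ∧
    (((X ×ˢ Y).filter (fun p => p ∈ E ∨ p.swap ∈ E)).card : ℝ) < ρ * (X.card * Y.card)

open scoped Classical in
theorem ND_count : ∃ ρ : ℝ, 0 < ρ ∧ ∀ ε : ℝ, 0 < ε → ∀ n : ℕ, 2 ≤ ε ^ 2 * n →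
    ((((Tp n).powerset.filter (ND ρ ε)).card : ℕ) : ℝ) ≤ 4 ^ n * (2 : ℝ) ^ (((Tp n).card : ℝ) - ε ^ 2 * n ^ 2 / 8) := by
  obtain ⟨e, he, hsmall⟩ := card_small (1/2) (by norm_num)
  refine ⟨e / 4, by positivity, ?_⟩
  intro ε hε n hn
  have hn0 : (0:ℝ) ≤ n := by positivity
  have h4 : (4 : ℝ) ^ n = (((Finset.univ : Finset (Finset (Fin n) × Finset (Fin n))).card : ℕ) : ℝ) := by
    rw [Finset.card_univ, Fintype.card_prod, Fintype.card_finset, Fintype.card_fin]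
    push_cast
    rw [← mul_pow]; norm_num
  rw [h4]
  apply card_le_sum_fiber _ _ (fun XY => (Tp n).powerset.filter (fun E => ε * n ≤ XY.1.card ∧ ε * n ≤ XY.2.card ∧
    (((XY.1 ×ˢ XY.2).filter (fun p => p ∈ E ∨ p.swap ∈ E)).card : ℝ) < e / 4 * (XY.1.card * XY.2.card)))
  · intro E hE
    rw [Finset.mem_filter] at hE
    obtain ⟨hT, X, Y, h⟩ := hE
    exact ⟨(X, Y), Finset.mem_univ _, Finset.mem_filter.2 ⟨hT, h⟩⟩
  · rintro ⟨X, Y⟩ -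
    simp only
    by_cases hX : ε * n ≤ X.card ∧ ε * n ≤ Y.card
    swap
    · rw [Finset.filter_false_of_mem]
      · simp only [Finset.card_empty, Nat.cast_zero]; positivity
      · intro E _ h; exact hX ⟨h.1, h.2.1⟩
    obtain ⟨hX, hY⟩ := hX
    have hXY : (ε * n) * (ε * n) ≤ (X.card : ℝ) * Y.card := by gcongr
    set U := (Tp n).filter (fun p => (p.1 ∈ X ∧ p.2 ∈ Y) ∨ (p.2 ∈ X ∧ p.1 ∈ Y)) with hU
    have hUT : U ⊆ Tp n := Finset.filter_subset _ _
    have hUc : X.card * Y.card ≤ 2 * U.card + n := by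
      have : X ×ˢ Y ⊆ (U ∪ U.image Prod.swap) ∪ (Finset.univ : Finset (Fin n)).image (fun x => (x, x)) := by
        rintro ⟨x, y⟩ hp
        rw [Finset.mem_product] at hp
        simp only [Finset.mem_union, Finset.mem_image, hU, Tp, Finset.mem_filter, Finset.mem_univ, true_and]
        rcases lt_trichotomy x y with hxy | hxy | hxy
        · exact Or.inl (Or.inl ⟨hxy, Or.inl hp⟩)
        · exact Or.inr ⟨x, by rw [hxy]⟩
        · exact Or.inl (Or.inr ⟨(y, x), ⟨hxy, Or.inr hp⟩, rfl⟩)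
      have h := Finset.card_le_card this
      rw [Finset.card_product] at h
      have h1 := Finset.card_union_le (U ∪ U.image Prod.swap) ((Finset.univ : Finset (Fin n)).image (fun x => (x, x)))
      have h2 := Finset.card_union_le U (U.image Prod.swap)
      have h3 : (U.image Prod.swap).card ≤ U.card := Finset.card_image_le
      have h4 : ((Finset.univ : Finset (Fin n)).image (fun x => (x, x))).card ≤ n := by
        simpa using (Finset.card_image_le (s := (Finset.univ : Finset (Fin n))) (f := fun x => (x, x)))
      omega
    have hUc' : (X.card : ℝ) * Y.card ≤ 2 * U.card + n := by exact_mod_cast hUc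
    have hUc2 : (X.card : ℝ) * Y.card ≤ 4 * U.card := by nlinarith
    set F := (Tp n).powerset.filter (fun E => ε * n ≤ X.card ∧ ε * n ≤ Y.card ∧
      (((X ×ˢ Y).filter (fun p => p ∈ E ∨ p.swap ∈ E)).card : ℝ) < e / 4 * (X.card * Y.card)) with hF
    have hs := card_split (Tp n) U hUT F (by
      intro E hE; rw [hF, Finset.mem_filter, Finset.mem_powerset] at hE; exact hE.1)
    have him : F.image (fun E => E ∩ U) ⊆ U.powerset.filter (fun Z => Z.card ≤ ⌊e * U.card⌋₊) := by
      intro Z hZ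
      rw [Finset.mem_image] at hZ
      obtain ⟨E, hE, rfl⟩ := hZ
      rw [hF, Finset.mem_filter, Finset.mem_powerset] at hE
      rw [Finset.mem_filter, Finset.mem_powerset]
      refine ⟨Finset.inter_subset_right, ?_⟩
      apply Nat.le_floor
      have h1 : (E ∩ U).card ≤ ((X ×ˢ Y).filter (fun p => p ∈ E ∨ p.swap ∈ E)).card := by
        apply Finset.card_le_card_of_injOn (fun p => if p.1 ∈ X ∧ p.2 ∈ Y then p else p.swap)
        · intro p hp
          simp only [Finset.mem_coe, Finset.mem_inter, hU, Finset.mem_filter] at hp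
          simp only [Finset.mem_coe, Finset.mem_filter, Finset.mem_product]
          by_cases h : p.1 ∈ X ∧ p.2 ∈ Y
          · rw [if_pos h]; exact ⟨h, Or.inl hp.1⟩
          · rw [if_neg h]
            refine ⟨hp.2.2.resolve_left h, Or.inr ?_⟩
            rw [Prod.swap_swap]; exact hp.1
        · intro p hp p' hp' h
          have hl : p.1 < p.2 := by
            have := hUT (Finset.mem_inter.1 hp).2
            simpa [Tp] using this
          have hl' : p'.1 < p'.2 := by
            have := hUT (Finset.mem_inter.1 hp').2
            simpa [Tp] using this
          simp only at h
          split_ifs at h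
          · exact h
          · rw [h] at hl; exact absurd hl (lt_asymm hl')
          · rw [← h] at hl'; exact absurd hl' (lt_asymm hl)
          · exact Prod.swap_injective h
      have h2 : ((E ∩ U).card : ℝ) ≤ ((X ×ˢ Y).filter (fun p => p ∈ E ∨ p.swap ∈ E)).card := by exact_mod_cast h1
      have := hE.2.2.2
      nlinarith
    have hc := hsmall _ U ⌊e * U.card⌋₊ (Nat.floor_le (by positivity))
    have him' : (((F.image (fun E => E ∩ U)).card : ℕ) : ℝ) ≤ (2 : ℝ) ^ (1 / 2 * (U.card : ℝ)) :=
      le_trans (by exact_mod_cast Finset.card_le_card him) hc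
    have hs' : (F.card : ℝ) ≤ (2 : ℝ) ^ (((Tp n).card - U.card : ℕ) : ℝ) * (F.image (fun E => E ∩ U)).card := by
      rw [Real.rpow_natCast]; exact_mod_cast hs
    refine hs'.trans ?_
    calc _ ≤ (2 : ℝ) ^ (((Tp n).card - U.card : ℕ) : ℝ) * (2 : ℝ) ^ (1 / 2 * (U.card : ℝ)) := by gcongr
      _ ≤ _ := by
        rw [← Real.rpow_add (by norm_num), Nat.cast_sub (Finset.card_le_card hUT)]
        apply Real.rpow_le_rpow_of_exponent_le (by norm_num)
        nlinarith

def Disp {n : ℕ} (ρ ε : ℝ) (s : Sg n) : Prop :=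
  ∀ X Y : Finset (Fin n), ε * n ≤ X.card → ε * n ≤ Y.card →
    ρ * (X.card * Y.card) ≤ (((X ×ˢ Y).filter (fun p => s p.1 p.2 ≠ 0)).card : ℝ)

theorem ND_of_not_disp {n : ℕ} (ρ ε : ℝ) (s : Sg n) (hs : IsS s) (h : ¬ Disp ρ ε s) : ND ρ ε (Sup s) := by
  classical
  unfold Disp at h
  push Not at h
  obtain ⟨X, Y, hX, hY, h⟩ := h
  refine ⟨X, Y, hX, hY, ?_⟩
  have hcongr : (X ×ˢ Y).filter (fun p => p ∈ Sup s ∨ p.swap ∈ Sup s) = (X ×ˢ Y).filter (fun p => s p.1 p.2 ≠ 0) := by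
    apply Finset.filter_congr
    intro p _
    simp only [Sup, Tp, Finset.mem_filter, Finset.mem_univ, true_and, Prod.fst_swap, Prod.snd_swap]
    rw [hs.symm p.2 p.1]
    constructor
    · tauto
    · intro h
      rcases lt_trichotomy p.1 p.2 with h1 | h1 | h1
      · exact Or.inl ⟨h1, h⟩
      · rw [h1, hs.diag] at h; exact absurd rfl h
      · exact Or.inr ⟨h1, h⟩
  rw [hcongr]
  exact h

theorem sampling_num (e : ℝ) (he : 0 < e) (n q : ℕ) (hn : 2 ≤ n) (hq : 3 * Real.log n / e ≤ q) :
    n ^ 2 * (n - (⌊e * n⌋₊ + 1)) ^ q < n ^ q := by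
  have hn' : (2 : ℝ) ≤ n := by exact_mod_cast hn
  have h1 : ((n - (⌊e * n⌋₊ + 1) : ℕ) : ℝ) ≤ n * Real.exp (-e) := by
    rcases le_total n (⌊e * n⌋₊ + 1) with h | h
    · rw [Nat.sub_eq_zero_of_le h]; push_cast; positivity
    · rw [Nat.cast_sub h]; push_cast
      have h2 := Nat.lt_floor_add_one (e * (n : ℝ))
      have h3 := Real.add_one_le_exp (-e)
      nlinarith
  have h2 : (n : ℝ) ^ 2 * ((n - (⌊e * n⌋₊ + 1) : ℕ) : ℝ) ^ q < (n : ℝ) ^ q := by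
    calc _ ≤ (n : ℝ) ^ 2 * (n * Real.exp (-e)) ^ q := by gcongr
      _ = (n : ℝ) ^ q * ((n : ℝ) ^ 2 * Real.exp (-(e * q))) := by
          rw [mul_pow, ← Real.exp_nat_mul]; ring_nf
      _ ≤ (n : ℝ) ^ q * ((n : ℝ) ^ 2 * Real.exp (-(3 * Real.log n))) := by
          rw [div_le_iff₀ he] at hq
          have : Real.exp (-(e * q)) ≤ Real.exp (-(3 * Real.log n)) := Real.exp_le_exp.2 (by linarith)
          gcongr
      _ = (n : ℝ) ^ q * (1 / n) := by
          have : Real.exp (-(3 * Real.log n)) = 1 / (n : ℝ) ^ 3 := by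
            rw [Real.exp_neg, show (3 : ℝ) * Real.log n = ((3 : ℕ) : ℝ) * Real.log n by norm_num, Real.exp_nat_mul, Real.exp_log (by linarith)]; simp
          rw [this]; field_simp
      _ < (n : ℝ) ^ q * 1 := by
          apply mul_lt_mul_of_pos_left _ (by positivity)
          rw [div_lt_one (by linarith)]; linarith
      _ = _ := mul_one _
  exact_mod_cast h2

theorem ev_log (c A B : ℝ) (hc : 0 < c) : ∀ᶠ n : ℕ in atTop, A + B * Real.log n ≤ c * n := by
  have h1 := (Real.isLittleO_log_id_atTop.comp_tendsto tendsto_natCast_atTop_atTop).bound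
    (c := c / (2 * (|B| + 1))) (by positivity)
  have h2 := tendsto_natCast_atTop_atTop.eventually_ge_atTop (α := ℕ) (2 * A / c : ℝ)
  filter_upwards [h1, h2, eventually_ge_atTop 1] with n h1 h2 h3
  simp only [Function.comp, id, Real.norm_eq_abs] at h1
  have hn : (1 : ℝ) ≤ n := by exact_mod_cast h3
  rw [abs_of_nonneg (Real.log_nonneg hn), abs_of_nonneg (by linarith : (0:ℝ) ≤ n)] at h1
  rw [div_le_iff₀ hc] at h2
  have hl := Real.log_nonneg hn
  have h5 : (|B| + 1) * Real.log n ≤ c * n / 2 := by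
    calc _ ≤ (|B| + 1) * (c / (2 * (|B| + 1)) * n) := by gcongr
      _ = _ := by field_simp
  have h6 : B * Real.log n ≤ |B| * Real.log n := by gcongr; exact le_abs_self B
  nlinarith

theorem Tp_le (n : ℕ) : ((Tp n).card : ℝ) ≤ (n : ℝ) ^ 2 / 2 := by
  rw [card_Tp]
  have h : n * (n - 1) / 2 * 2 ≤ n * n := (Nat.div_mul_le_self _ _).trans (Nat.mul_le_mul_left _ (by omega))
  have h' : ((n * (n - 1) / 2 : ℕ) : ℝ) * 2 ≤ n * n := by exact_mod_cast h
  nlinarith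

open scoped Classical in
theorem nondisp_count : ∃ ρ : ℝ, 0 < ρ ∧ ∀ ε : ℝ, 0 < ε → ∃ c : ℝ, 0 < c ∧ ∀ᶠ n : ℕ in atTop,
    (((Finset.univ.filter (fun s : Sg n => IsS s ∧ ¬ Disp ρ ε s)).card : ℕ) : ℝ) ≤
      (2 : ℝ) ^ ((n : ℝ) ^ 2 / 2 - c * n ^ 2) := by
  obtain ⟨ρ, hρ, hND⟩ := ND_count
  refine ⟨ρ, hρ, fun ε hε => ?_⟩
  set δ : ℝ := ε ^ 2 / 16 with hδ
  have hδ0 : 0 < δ := by positivity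
  set c : ℝ := 0.03 * δ / 8 with hc
  have hc0 : 0 < c := by positivity
  obtain ⟨e0, he0, hsmall⟩ := card_small (c / 2) (by positivity)
  set e : ℝ := min (e0 / 8) (c / 112) with he
  have hepos : 0 < e := lt_min (by positivity) (by positivity)
  have hee0 : e ≤ e0 / 8 := min_le_left _ _
  have hec : e ≤ c / 112 := min_le_right _ _
  refine ⟨c, hc0, ?_⟩
  have ge := fun (a : ℝ) => tendsto_natCast_atTop_atTop.eventually_ge_atTop (α := ℕ) a
  filter_upwards [ge (2 / ε ^ 2), ge (8 / e0), ge (112 / c), ge (2 / c ^ 2), eventually_ge_atTop 2,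
    ev_log c 10 (6 / e) hc0] with n n1 n2 n3 n4 n5 n6
  have hn2 : (2 : ℝ) ≤ n := by exact_mod_cast n5
  have hn0 : (0 : ℝ) ≤ n := by linarith
  rw [div_le_iff₀ (by positivity)] at n1 n2 n3 n4
  set q : ℕ := ⌈3 * Real.log n / e⌉₊ with hq
  have hlog : 0 ≤ Real.log n := Real.log_nonneg (by linarith)
  have hq1 : 3 * Real.log n / e ≤ q := Nat.le_ceil _
  have hq2 : (q : ℝ) ≤ 3 * Real.log n / e + 1 := (Nat.ceil_lt_add_one (by positivity)).le
  have hqn : 8 + 2 * (q : ℝ) ≤ c * n := by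
    have : 6 / e * Real.log n = 2 * (3 * Real.log n / e) := by ring
    linarith
  set k : ℕ := ⌊e * n⌋₊ with hk
  have hkn : (k : ℝ) ≤ e * n := Nat.floor_le (by positivity)
  have hK : ((((Finset.univ : Finset (Fin n)).powerset.filter (fun Z => Z.card ≤ 4 * k + 4)).card : ℝ)) *
      (3 ^ 4) ^ (4 * k + 4) ≤ (2 : ℝ) ^ (c * n) := by
    have a1 := hsmall _ (Finset.univ : Finset (Fin n)) (4 * k + 4) (by
      rw [Finset.card_univ, Fintype.card_fin]; push_cast; nlinarith)
    rw [Finset.card_univ, Fintype.card_fin] at a1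
    have a2 : ((3 : ℝ) ^ 4) ^ (4 * k + 4) ≤ (2 : ℝ) ^ (c / 2 * n) := by
      calc ((3 : ℝ) ^ 4) ^ (4 * k + 4) ≤ ((2 : ℝ) ^ 7) ^ (4 * k + 4) := by gcongr; norm_num
        _ = (2 : ℝ) ^ (((7 * (4 * k + 4) : ℕ)) : ℝ) := by rw [Real.rpow_natCast, ← pow_mul]
        _ ≤ _ := by
          apply Real.rpow_le_rpow_of_exponent_le (by norm_num)
          push_cast; nlinarith
    calc _ ≤ (2 : ℝ) ^ (c / 2 * n) * (2 : ℝ) ^ (c / 2 * n) := by gcongr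
      _ = _ := by rw [← Real.rpow_add (by norm_num)]; ring_nf
  set F := Finset.univ.filter (fun s : Sg n => IsS s ∧ ¬ Disp ρ ε s) with hF
  have hD : (((Finset.univ : Finset (Fin q → Fin n → SignType)).card : ℕ) : ℝ) ≤ (2 : ℝ) ^ (2 * (q : ℝ) * n) := by
    rw [Finset.card_univ, Fintype.card_fun, Fintype.card_fun, Fintype.card_fin, Fintype.card_fin]
    have h3 : Fintype.card SignType = 3 := rfl
    rw [h3]
    push_cast
    calc (((3 : ℝ) ^ n) ^ q) ≤ (((2 : ℝ) ^ 2) ^ n) ^ q := by gcongr; norm_num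
      _ = _ := by
        rw [← pow_mul, ← pow_mul, ← Real.rpow_natCast]; push_cast; ring_nf
  have main := card_le_sum_fiber F (Finset.univ : Finset (Fin q → Fin n → SignType))
    (fun d => F.filter (fun s => Cfg (Pd d) (td d) k s)) (by
      intro s hs
      have hs' := hs
      rw [hF, Finset.mem_filter] at hs'
      obtain ⟨t, ht⟩ := sampling q k s (sampling_num e hepos n q n5 hq1)
      exact ⟨fun i x => s (t i) x, Finset.mem_univ _, Finset.mem_filter.2 ⟨hs, cfg_of s hs'.2.1 t ht⟩⟩)
    ((2 : ℝ) ^ ((n : ℝ) ^ 2 / 2 - c * n ^ 2 - 2 * (q : ℝ) * n)) ?_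
  · refine main.trans ?_
    calc _ ≤ (2 : ℝ) ^ (2 * (q : ℝ) * n) * (2 : ℝ) ^ ((n : ℝ) ^ 2 / 2 - c * n ^ 2 - 2 * (q : ℝ) * n) := by gcongr
      _ = _ := by rw [← Real.rpow_add (by norm_num)]; ring_nf
  intro d _
  have hcfg : ∀ s ∈ F.filter (fun s => Cfg (Pd d) (td d) k s), Cfg (Pd d) (td d) k s := by
    intro s hs; exact (Finset.mem_filter.1 hs).2
  have hq0 : (0 : ℝ) ≤ q := by positivity
  rcases le_total (δ * n ^ 2) (eP (Pd d) Finset.univ : ℝ) with hcase | hcase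
  · have := A1_univ (Pd d) (Pd_symm d) (Pd_irrefl d) (td d) _ hcfg (c * n) (c * n ^ 2) (by positivity) hK (by positivity)
      (by nlinarith [mul_le_mul_of_nonneg_right n4 (by positivity : (0:ℝ) ≤ n ^ 3)])
    refine this.trans ?_
    apply Real.rpow_le_rpow_of_exponent_le (by norm_num)
    have e1 : 0.03 * (δ * n ^ 2) = 8 * (c * n ^ 2) := by rw [hc]; ring
    have e2 := mul_le_mul_of_nonneg_right hqn hn0
    have e3 : 0 ≤ c * (n : ℝ) ^ 2 := by positivity
    nlinarith
  · have h1 := small_P_count d _ hcfg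
    have h2 : ((F.filter (fun s => Cfg (Pd d) (td d) k s)).image Sup) ⊆ (Tp n).powerset.filter (ND ρ ε) := by
      intro E hE
      rw [Finset.mem_image] at hE
      obtain ⟨s, hs, rfl⟩ := hE
      rw [Finset.mem_filter, hF, Finset.mem_filter] at hs
      rw [Finset.mem_filter, Finset.mem_powerset]
      exact ⟨Finset.filter_subset _ _, ND_of_not_disp ρ ε s hs.1.2.1 hs.1.2.2⟩
    have h3 := hND ε hε n (by linarith)
    have h4 : (((((F.filter (fun s => Cfg (Pd d) (td d) k s)).image Sup)).card : ℕ) : ℝ) ≤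
      4 ^ n * (2 : ℝ) ^ (((Tp n).card : ℝ) - ε ^ 2 * n ^ 2 / 8) :=
      le_trans (by exact_mod_cast Finset.card_le_card h2) h3
    have h5 : ((F.filter (fun s => Cfg (Pd d) (td d) k s)).card : ℝ) ≤
      (((((F.filter (fun s => Cfg (Pd d) (td d) k s)).image Sup)).card : ℕ) : ℝ) * (2 : ℝ) ^ (eP (Pd d) Finset.univ : ℝ) := by
      rw [Real.rpow_natCast]; exact_mod_cast h1
    have h6 : (4 : ℝ) ^ n = (2 : ℝ) ^ (2 * (n : ℝ)) := by
      rw [Real.rpow_mul (by norm_num), Real.rpow_natCast]; norm_num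
    refine h5.trans ?_
    calc _ ≤ (2 : ℝ) ^ (2 * (n : ℝ)) * (2 : ℝ) ^ (((Tp n).card : ℝ) - ε ^ 2 * n ^ 2 / 8) * (2 : ℝ) ^ (eP (Pd d) Finset.univ : ℝ) := by
          rw [← h6]; gcongr
      _ ≤ _ := by
        rw [← Real.rpow_add (by norm_num), ← Real.rpow_add (by norm_num)]
        apply Real.rpow_le_rpow_of_exponent_le (by norm_num)
        have e2 := mul_le_mul_of_nonneg_right hqn hn0
        have e3 : 0 ≤ δ * (n : ℝ) ^ 2 := by positivity
        have e4 : ε ^ 2 * (n : ℝ) ^ 2 / 8 = 2 * (δ * n ^ 2) := by rw [hδ]; ring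
        have e5 : c * (n : ℝ) ^ 2 = 0.00375 * (δ * n ^ 2) := by rw [hc]; ring
        have e6 := Tp_le n
        have e7 : (8 + 2 * (q : ℝ)) * n ≤ c * (n : ℝ) ^ 2 := by
          calc _ ≤ _ := e2
            _ = _ := by ring
        rw [e5] at e7 ⊢
        rw [e4]
        clear_value c δ
        linarith

/-- switching -/
def sw {n : ℕ} (f : Fin n → SignType) (s : Sg n) : Sg n := fun x y => f x * f y * s x y

def bd {n : ℕ} (s : Sg n) (x : Fin n) : Finset (Fin n) := Finset.univ.filter (fun y => s x y = -1)
def rd {n : ℕ} (s : Sg n) (x : Fin n) : Finset (Fin n) := Finset.univ.filter (fun y => s x y = 1)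
def Bc {n : ℕ} (s : Sg n) : Finset (Fin n × Fin n) := Finset.univ.filter (fun p => s p.1 p.2 = -1)
def nb {n : ℕ} (s : Sg n) (x : Fin n) : Finset (Fin n) := Finset.univ.filter (fun y => s x y ≠ 0)

theorem mem_bd {n : ℕ} {s : Sg n} {x y : Fin n} : y ∈ bd s x ↔ s x y = -1 := by simp [bd]
theorem mem_rd {n : ℕ} {s : Sg n} {x y : Fin n} : y ∈ rd s x ↔ s x y = 1 := by simp [rd]
theorem mem_nb {n : ℕ} {s : Sg n} {x y : Fin n} : y ∈ nb s x ↔ s x y ≠ 0 := by simp [nb]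
theorem mem_Bc {n : ℕ} {s : Sg n} {p : Fin n × Fin n} : p ∈ Bc s ↔ s p.1 p.2 = -1 := by simp [Bc]

theorem sw_IsS {n : ℕ} (f : Fin n → SignType) (s : Sg n) (hs : IsS s) :
    IsS (sw f s) := by
  refine ⟨?_, ?_, ?_⟩
  · intro x y; unfold sw; rw [hs.symm x y, mul_comm (f x)]
  · intro x; simp [sw, hs.diag]
  · intro x y z
    have h := hs.tri x y z
    unfold sw
    generalize s x y = a at *
    generalize s y z = b at *
    generalize s x z = c at *
    generalize f x = u
    generalize f y = v
    generalize f z = w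
    revert a b c u v w; decide

theorem sw_ne {n : ℕ} (f : Fin n → SignType) (hf : ∀ x, f x ≠ 0) (s : Sg n) (x y : Fin n) :
    sw f s x y ≠ 0 ↔ s x y ≠ 0 := by
  simp [sw, hf]

theorem sw_Disp {n : ℕ} (f : Fin n → SignType) (hf : ∀ x, f x ≠ 0) (s : Sg n) {ρ ε : ℝ} (h : Disp ρ ε s) :
    Disp ρ ε (sw f s) := by
  intro X Y hX hY
  simp only [sw_ne f hf]
  exact h X Y hX hY

theorem Zsmall {n : ℕ} {ρ ε : ℝ} (hε : 0 < ε) (hn : 0 < n) (s : Sg n) (hs : IsS s) (hd : Disp ρ ε s) (A : Finset (Fin n))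
    (hA : ε * n ≤ A.card) :
    ((Finset.univ.filter (fun x => (((A ∩ nb s x).card : ℕ) : ℝ) < ρ * A.card)).card : ℝ) < ε * n := by
  by_contra hcon
  push Not at hcon
  set Z := Finset.univ.filter (fun x => (((A ∩ nb s x).card : ℕ) : ℝ) < ρ * A.card) with hZ
  have h := hd Z A hcon hA
  have h1 : ((Z ×ˢ A).filter (fun p => s p.1 p.2 ≠ 0)).card = ∑ x ∈ Z, (A ∩ nb s x).card := by
    rw [Finset.card_filter, Finset.sum_product]
    apply Finset.sum_congr rfl
    intro x _
    rw [← Finset.card_filter]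
    congr 1
    ext y; simp [nb]
  rw [h1] at h
  push_cast at h
  have hpos : (0 : ℝ) < Z.card := lt_of_lt_of_le (by positivity) hcon
  have hne : Z.Nonempty := by
    rw [← Finset.card_pos]; exact_mod_cast hpos
  have h2 : ∑ x ∈ Z, (((A ∩ nb s x).card : ℕ) : ℝ) < ∑ x ∈ Z, ρ * A.card := by
    apply Finset.sum_lt_sum_of_nonempty hne
    intro x hx
    rw [hZ, Finset.mem_filter] at hx; exact hx.2
  rw [Finset.sum_const, nsmul_eq_mul] at h2
  linarith

theorem sgn_a : ∀ a b c a' b' : SignType, a * b = 1 → a' * b' = -1 → a * c * a' ≠ -1 → b * c * b' ≠ -1 → c = 0 := by decide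
theorem sgn_b : ∀ a : SignType, a ≠ 0 → a ≠ 1 → a = -1 := by decide
theorem sgn_c : ∀ a : SignType, a ≠ 0 → a ≠ -1 → a = 1 := by decide
theorem sgn_d : ∀ a b c v f f' : SignType, c ≠ 0 → a ≠ 0 → b ≠ 0 → a * v = f → b * v = f' → a * b * c ≠ -1 → f * f' * c ≠ -1 := by decide

theorem disp_f {n : ℕ} {ρ ε : ℝ} (hε : 0 < ε) (hε1 : ε ≤ 1) (hρ : 0 < ρ) (h1 : ε ≤ ρ) (h2 : ε ≤ ρ ^ 2) (h3 : 2 * ε ≤ ρ ^ 3)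
    (hn : 0 < n) (s : Sg n) (hs : IsS s) (hd : Disp ρ ε s) :
    ∃ f : Fin n → SignType, (∀ x, f x ≠ 0) ∧ ((Bc (sw f s)).card : ℝ) ≤ 2 * ε * n ^ 2 := by
  classical
  have hn' : (0 : ℝ) < n := by exact_mod_cast hn
  -- a vertex of large degree
  have hv : ∃ v, ρ * n ≤ (nb s v).card := by
    by_contra hcon
    push Not at hcon
    have := Zsmall hε hn s hs hd Finset.univ (by simp; nlinarith)
    rw [Finset.filter_true_of_mem] at this
    · simp at this; nlinarith
    · intro x _; simpa using hcon x
  obtain ⟨v, hv⟩ := hv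
  set D := nb s v with hD
  have hDε : ε * n ≤ D.card := by nlinarith
  have hYY : ∀ x, ((D.filter (fun y => s x y * s v y = 1)).card : ℝ) < ε * n ∨
      ((D.filter (fun y => s x y * s v y = -1)).card : ℝ) < ε * n := by
    intro x
    by_contra hcon
    push Not at hcon
    obtain ⟨ha, hb⟩ := hcon
    have h := hd _ _ ha hb
    have hem : ((D.filter (fun y => s x y * s v y = 1)) ×ˢ (D.filter (fun y => s x y * s v y = -1))).filter
        (fun p => s p.1 p.2 ≠ 0) = ∅ := by
      apply Finset.filter_false_of_mem
      intro p hp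
      rw [Finset.mem_product, Finset.mem_filter, Finset.mem_filter] at hp
      have t1 := hs.tri x p.1 p.2
      have t2 := hs.tri v p.1 p.2
      simp only [ne_eq, not_not]
      exact sgn_a _ _ _ _ _ hp.1.2 hp.2.2 t1 t2
    · rw [hem] at h
      simp only [Finset.card_empty, Nat.cast_zero] at h
      have hp : 0 < ε * n := by positivity
      have := mul_pos hρ (mul_pos (lt_of_lt_of_le hp ha) (lt_of_lt_of_le hp hb))
      linarith
  set f : Fin n → SignType := fun x => if ((D.filter (fun y => s x y * s v y = -1)).card : ℝ) < ε * n then 1 else -1 with hf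
  have hW : ∀ x, ((D.filter (fun y => s x y ≠ 0 ∧ s x y * s v y ≠ f x)).card : ℝ) < ε * n := by
    intro x
    have hvy : ∀ y ∈ D, s v y ≠ 0 := by intro y hy; simpa [hD, nb] using hy
    by_cases hx : ((D.filter (fun y => s x y * s v y = -1)).card : ℝ) < ε * n
    · have hfx : f x = 1 := by simp only [hf]; rw [if_pos hx]
      refine lt_of_le_of_lt ?_ hx
      rw [hfx]
      norm_cast
      apply Finset.card_le_card
      intro y hy
      rw [Finset.mem_filter] at hy ⊢
      exact ⟨hy.1, sgn_b _ (mul_ne_zero hy.2.1 (hvy y hy.1)) hy.2.2⟩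
    · have hfx : f x = -1 := by simp only [hf]; rw [if_neg hx]
      refine lt_of_le_of_lt ?_ ((hYY x).resolve_right hx)
      rw [hfx]
      norm_cast
      apply Finset.card_le_card
      intro y hy
      rw [Finset.mem_filter] at hy ⊢
      exact ⟨hy.1, sgn_c _ (mul_ne_zero hy.2.1 (hvy y hy.1)) hy.2.2⟩
  refine ⟨f, ?_, ?_⟩
  · intro x; simp only [hf]; split_ifs <;> decide
  set Z := Finset.univ.filter (fun x => (((D ∩ nb s x).card : ℕ) : ℝ) < ρ * D.card) with hZ
  have hZc := Zsmall hε hn s hs hd D hDε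
  rw [← hZ] at hZc
  set Zx : Fin n → Finset (Fin n) := fun x => Finset.univ.filter (fun x' => ((((D ∩ nb s x) ∩ nb s x').card : ℕ) : ℝ) < ρ * (D ∩ nb s x).card) with hZx
  have hDx : ∀ x, x ∉ Z → ρ * D.card ≤ (D ∩ nb s x).card := by
    intro x hx
    rw [hZ, Finset.mem_filter] at hx
    simpa using hx
  have hDx2 : ∀ x, x ∉ Z → ρ ^ 2 * n ≤ (D ∩ nb s x).card := by
    intro x hx
    have := hDx x hx
    nlinarith
  have hZxc : ∀ x, x ∉ Z → ((Zx x).card : ℝ) < ε * n := by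
    intro x hx
    exact Zsmall hε hn s hs hd _ (le_trans (by nlinarith) (hDx2 x hx))
  have hbad : ∀ x x', x ∉ Z → x' ∉ Zx x → sw f s x x' ≠ -1 := by
    intro x x' hx hx' hb
    have k1 : ρ * (D ∩ nb s x).card ≤ ((D ∩ nb s x) ∩ nb s x').card := by
      rw [hZx, Finset.mem_filter] at hx'
      simpa using hx'
    have k2 : (D ∩ nb s x) ∩ nb s x' ⊆ D.filter (fun y => s x y ≠ 0 ∧ s x y * s v y ≠ f x) ∪
        D.filter (fun y => s x' y ≠ 0 ∧ s x' y * s v y ≠ f x') := by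
      intro y hy
      simp only [Finset.mem_inter, nb, Finset.mem_filter, Finset.mem_univ, true_and] at hy
      obtain ⟨⟨hyD, hyx⟩, hyx'⟩ := hy
      rw [Finset.mem_union, Finset.mem_filter, Finset.mem_filter]
      by_contra hcon
      push Not at hcon
      obtain ⟨q1, q2⟩ := hcon
      have q1 := q1 hyD hyx
      have q2 := q2 hyD hyx'
      have hne : s x x' ≠ 0 := by
        intro h0
        simp [sw, h0] at hb
      have t := hs.tri x y x'
      rw [hs.symm y x'] at t
      exact sgn_d _ _ _ _ _ _ hne hyx hyx' q1 q2 t hb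
    have k3 := (Finset.card_le_card k2).trans (Finset.card_union_le _ _)
    have k3' : (((D ∩ nb s x) ∩ nb s x').card : ℝ) ≤ (D.filter (fun y => s x y ≠ 0 ∧ s x y * s v y ≠ f x)).card +
        (D.filter (fun y => s x' y ≠ 0 ∧ s x' y * s v y ≠ f x')).card := by exact_mod_cast k3
    have k4 := hW x
    have k5 := hW x'
    have k6 := hDx2 x hx
    have k7 : ρ * (ρ ^ 2 * n) ≤ ρ * (D ∩ nb s x).card := by gcongr
    have k8 : 2 * ε * n ≤ ρ ^ 3 * n := by gcongr
    nlinarith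
  have hcount : Bc (sw f s) ⊆ Z ×ˢ Finset.univ ∪ (Finset.univ.filter (fun x => x ∉ Z)).biUnion (fun x => {x} ×ˢ Zx x) := by
    rintro ⟨x, x'⟩ hp
    simp only [Bc, Finset.mem_filter, Finset.mem_univ, true_and] at hp
    simp only [Finset.mem_union, Finset.mem_product, Finset.mem_biUnion, Finset.mem_filter, Finset.mem_univ, true_and, and_true, Finset.mem_singleton]
    by_cases hx : x ∈ Z
    · exact Or.inl hx
    · refine Or.inr ⟨x, hx, rfl, ?_⟩
      by_contra hx'
      exact hbad x x' hx hx' hp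
  have l1 := (Finset.card_le_card hcount).trans (Finset.card_union_le _ _)
  have l2 : (((Finset.univ.filter (fun x => x ∉ Z)).biUnion (fun x => {x} ×ˢ Zx x)).card : ℝ) ≤ n * (ε * n) := by
    have m1 : (((Finset.univ.filter (fun x => x ∉ Z)).biUnion (fun x => {x} ×ˢ Zx x)).card : ℝ) ≤
        ∑ x ∈ Finset.univ.filter (fun x => x ∉ Z), ((({x} ×ˢ Zx x).card : ℕ) : ℝ) := by
      exact_mod_cast Finset.card_biUnion_le
    refine m1.trans ?_
    calc _ ≤ ∑ x ∈ Finset.univ.filter (fun x => x ∉ Z), ε * n := by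
          apply Finset.sum_le_sum
          intro x hx
          rw [Finset.mem_filter] at hx
          rw [Finset.card_product, Finset.card_singleton, one_mul]
          exact (hZxc x hx.2).le
      _ ≤ ∑ x : Fin n, ε * n := by
          apply Finset.sum_le_sum_of_subset_of_nonneg (Finset.filter_subset _ _)
          intros; positivity
      _ = _ := by simp
  have l3 : ((Bc (sw f s)).card : ℝ) ≤ (Z ×ˢ (Finset.univ : Finset (Fin n))).card +
    ((Finset.univ.filter (fun x => x ∉ Z)).biUnion (fun x => {x} ×ˢ Zx x)).card := by exact_mod_cast l1
  rw [Finset.card_product, Finset.card_univ, Fintype.card_fin] at l3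
  push_cast at l3
  nlinarith

theorem Bc_split {n : ℕ} (s : Sg n) (hs : IsS s) (v : Fin n) :
    (Bc s).card = ((Bc s).filter (fun p => p.1 ≠ v ∧ p.2 ≠ v)).card + 2 * (bd s v).card := by
  classical
  have h1 : Bc s = ((Bc s).filter (fun p => p.1 ≠ v ∧ p.2 ≠ v)) ∪ ((bd s v).image (fun y => (v, y)) ∪ (bd s v).image (fun y => (y, v))) := by
    ext ⟨x, y⟩
    simp only [Bc, bd, Finset.mem_union, Finset.mem_filter, Finset.mem_image, Finset.mem_univ, true_and, Prod.mk.injEq]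
    constructor
    · intro h
      by_cases hx : x = v
      · subst hx; exact Or.inr (Or.inl ⟨y, h, rfl, rfl⟩)
      · by_cases hy : y = v
        · subst hy; exact Or.inr (Or.inr ⟨x, by rw [hs.symm]; exact h, rfl, rfl⟩)
        · exact Or.inl ⟨h, hx, hy⟩
    · rintro (h | ⟨z, h, rfl, rfl⟩ | ⟨z, h, rfl, rfl⟩)
      · exact h.1
      · exact h
      · rw [hs.symm]; exact h
  have h2 : ((bd s v).image (fun y => (v, y))).card = (bd s v).card :=
    Finset.card_image_of_injective _ (by intro a b h; simpa using h)
  have h3 : ((bd s v).image (fun y => (y, v))).card = (bd s v).card :=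
    Finset.card_image_of_injective _ (by intro a b h; simpa using h)
  conv_lhs => rw [h1]
  rw [Finset.card_union_of_disjoint, Finset.card_union_of_disjoint, h2, h3, two_mul]
  · rw [Finset.disjoint_left]
    rintro ⟨x, y⟩ ha hb
    simp only [bd, Finset.mem_filter, Finset.mem_image, Finset.mem_univ, true_and, Prod.mk.injEq] at ha hb
    obtain ⟨a, ha, rfl, rfl⟩ := ha
    obtain ⟨b, hb, rfl, -⟩ := hb
    rw [hs.diag] at hb; exact absurd hb (by decide)
  · rw [Finset.disjoint_left]
    rintro ⟨x, y⟩ ha hb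
    simp only [Finset.mem_union, Finset.mem_filter, Finset.mem_image, Prod.mk.injEq] at ha hb
    rcases hb with ⟨a, _, h, _⟩ | ⟨a, _, _, h⟩
    · exact ha.2.1 h.symm
    · exact ha.2.2 h.symm

theorem min_deg {n : ℕ} (s : Sg n) (hs : IsS s) (f : Fin n → SignType) (hf : ∀ x, f x ≠ 0)
    (hmin : ∀ g : Fin n → SignType, (∀ x, g x ≠ 0) → (Bc (sw f s)).card ≤ (Bc (sw g s)).card) (v : Fin n) :
    (bd (sw f s) v).card ≤ (rd (sw f s) v).card := by
  classical
  set g : Fin n → SignType := fun x => if x = v then - f x else f x with hg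
  have hg0 : ∀ x, g x ≠ 0 := by
    intro x; simp only [hg]; have := hf x; split_ifs
    · simpa using this
    · exact this
  have h := hmin g hg0
  rw [Bc_split _ (sw_IsS f s hs) v, Bc_split _ (sw_IsS g s hs) v] at h
  have h1 : (Bc (sw f s)).filter (fun p => p.1 ≠ v ∧ p.2 ≠ v) = (Bc (sw g s)).filter (fun p => p.1 ≠ v ∧ p.2 ≠ v) := by
    ext p
    simp only [Finset.mem_filter, mem_Bc, sw, hg]
    constructor
    · rintro ⟨a, b, c⟩; rw [if_neg b, if_neg c]; exact ⟨a, b, c⟩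
    · rintro ⟨a, b, c⟩; rw [if_neg b, if_neg c] at a; exact ⟨a, b, c⟩
  have h2 : bd (sw g s) v = rd (sw f s) v := by
    ext y
    simp only [mem_bd, mem_rd, sw, hg]
    by_cases hy : y = v
    · subst hy; simp [hs.diag]
    · simp only [if_true, if_neg hy]
      generalize f v = a
      generalize f y = b
      generalize s v y = c
      revert a b c; decide
  rw [h1, h2] at h
  omega

theorem sgn_e : ∀ a b c : SignType, a = -1 → b = 1 → a * c * b ≠ -1 → c ≠ 0 → c = -1 := by decide

theorem disp_struct {n : ℕ} {ρ ε εb : ℝ} (hε : 0 < ε) (hε1 : ε ≤ 1) (hρ : 0 < ρ) (h1 : ε ≤ ρ) (h2 : ε ≤ ρ ^ 2) (h3 : 2 * ε ≤ ρ ^ 3)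
    (hb : ε ≤ εb) (hb2 : 2 * ε < ρ * εb ^ 2)
    (hn : 0 < n) (s : Sg n) (hs : IsS s) (hd : Disp ρ ε s) :
    ∃ f : Fin n → SignType, (∀ x, f x ≠ 0) ∧
      ∀ x, (bd (sw f s) x).card ≤ (rd (sw f s) x).card ∧ ((bd (sw f s) x).card : ℝ) < εb * n := by
  classical
  have hn' : (0 : ℝ) < n := by exact_mod_cast hn
  obtain ⟨f0, hf0, hB0⟩ := disp_f hε hε1 hρ h1 h2 h3 hn s hs hd
  obtain ⟨f, hf, hmin⟩ := Finset.exists_min_image (Finset.univ.filter (fun f : Fin n → SignType => ∀ x, f x ≠ 0))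
    (fun f => (Bc (sw f s)).card) ⟨f0, by simpa using hf0⟩
  simp only [Finset.mem_filter, Finset.mem_univ, true_and] at hf hmin
  have hB : ((Bc (sw f s)).card : ℝ) ≤ 2 * ε * n ^ 2 := le_trans (by exact_mod_cast hmin f0 hf0) hB0
  refine ⟨f, hf, fun v => ?_⟩
  have hle := min_deg s hs f hf hmin v
  refine ⟨hle, ?_⟩
  by_contra hcon
  push Not at hcon
  have hle' : ((bd (sw f s) v).card : ℝ) ≤ (rd (sw f s) v).card := by exact_mod_cast hle
  have hr : εb * n ≤ (rd (sw f s) v).card := hcon.trans hle'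
  have hd' := sw_Disp f hf s hd
  have hs' := sw_IsS f s hs
  have h := hd' (bd (sw f s) v) (rd (sw f s) v) (by nlinarith) (by nlinarith)
  have hsub : ((bd (sw f s) v) ×ˢ (rd (sw f s) v)).filter (fun p => sw f s p.1 p.2 ≠ 0) ⊆ Bc (sw f s) := by
    intro p hp
    simp only [Finset.mem_filter, Finset.mem_product, bd, rd, Bc, Finset.mem_univ, true_and] at hp ⊢
    exact sgn_e _ _ _ hp.1.1 hp.1.2 (hs'.tri v p.1 p.2) hp.2
  have hc : ((((bd (sw f s) v) ×ˢ (rd (sw f s) v)).filter (fun p => sw f s p.1 p.2 ≠ 0)).card : ℝ) ≤ (Bc (sw f s)).card := by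
    exact_mod_cast Finset.card_le_card hsub
  have hb0 : 0 < εb := lt_of_lt_of_le hε hb
  have hm : (εb * n) * (εb * n) ≤ ((bd (sw f s) v).card : ℝ) * (rd (sw f s) v).card := by gcongr
  have hm2 : ρ * ((εb * n) * (εb * n)) ≤ ρ * (((bd (sw f s) v).card : ℝ) * (rd (sw f s) v).card) := by gcongr
  have hm3 : 2 * ε * n ^ 2 < ρ * εb ^ 2 * n ^ 2 := by
    apply mul_lt_mul_of_pos_right hb2; positivity
  nlinarith

def oo {n : ℕ} (x y : Fin n) : Fin n × Fin n := if x < y then (x, y) else (y, x)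
def Red {n : ℕ} (s : Sg n) : Finset (Fin n × Fin n) := (Tp n).filter (fun p => s p.1 p.2 = 1)

theorem oo_mem_Tp {n : ℕ} {x y : Fin n} (h : x ≠ y) : oo x y ∈ Tp n := by
  unfold oo Tp
  split_ifs with h1
  · simpa using h1
  · simp; exact lt_of_le_of_ne (not_lt.1 h1) h.symm

theorem oo_mem_Red {n : ℕ} {s : Sg n} (hs : IsS s) {x y : Fin n} (h : x ≠ y) : oo x y ∈ Red s ↔ s x y = 1 := by
  have h1 := oo_mem_Tp h
  unfold Red
  rw [Finset.mem_filter]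
  simp only [h1, true_and]
  unfold oo
  split_ifs
  · rfl
  · simp only; rw [hs.symm]

theorem oo_eq {n : ℕ} {x y x' y' : Fin n} (h : oo x y = oo x' y') : (x = x' ∧ y = y') ∨ (x = y' ∧ y = x') := by
  unfold oo at h
  split_ifs at h <;> simp only [Prod.mk.injEq] at h <;> tauto

theorem redcount1 {n m : ℕ} (w : Fin m × Bool → Fin n) (hw : Function.Injective w)
    (F : Finset (Finset (Fin n × Fin n))) (hF : ∀ E ∈ F, E ⊆ Tp n)
    (hF2 : ∀ E ∈ F, ∀ i x, (∀ j, w j ≠ x) → ¬ (oo (w (i, false)) x ∈ E ∧ oo (w (i, true)) x ∈ E)) :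
    2 * m * (n - 2 * m) ≤ (Tp n).card ∧
    F.card ≤ 2 ^ ((Tp n).card - 2 * m * (n - 2 * m)) * 3 ^ (m * (n - 2 * m)) := by
  classical
  have hcx : Fintype.card {x : Fin n // ∀ j, w j ≠ x} = n - 2 * m := by
    rw [Fintype.card_subtype]
    have : (Finset.univ.filter (fun x => ∀ j, w j ≠ x)) = Finset.univ \ Finset.univ.image w := by
      ext x; simp
    rw [this, Finset.card_sdiff_of_subset (Finset.subset_univ _), Finset.card_image_of_injective _ hw]
    simp [mul_comm]
  set φ : (Fin m × Bool) × {x : Fin n // ∀ j, w j ≠ x} → Fin n × Fin n := fun q => oo (w q.1) q.2.1 with hφ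
  have hφi : Function.Injective φ := by
    rintro ⟨a, x, hx⟩ ⟨a', x', hx'⟩ h
    rcases oo_eq h with ⟨h1, h2⟩ | ⟨h1, h2⟩
    · simp only at h1 h2
      have := hw h1
      subst this; subst h2; rfl
    · exact absurd h1 (hx' a)
  set U := Finset.univ.image φ with hU
  have hUc : U.card = 2 * m * (n - 2 * m) := by
    rw [hU, Finset.card_image_of_injective _ hφi, Finset.card_univ, Fintype.card_prod, hcx]
    simp [mul_comm]
  have hUT : U ⊆ Tp n := by
    intro p hp
    rw [hU, Finset.mem_image] at hp
    obtain ⟨⟨a, x, hx⟩, -, rfl⟩ := hp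
    exact oo_mem_Tp (hx a)
  have hs := card_split (Tp n) U hUT F hF
  have hi := card_le_pi (F.image (fun E => E ∩ U))
    (fun Z (q : Fin m × {x : Fin n // ∀ j, w j ≠ x}) => (decide (φ ((q.1, false), q.2) ∈ Z), decide (φ ((q.1, true), q.2) ∈ Z)))
    (fun _ => Finset.univ.filter (fun t : Bool × Bool => t ≠ (true, true))) ?_ ?_
  · have h3 : (Finset.univ.filter (fun t : Bool × Bool => t ≠ (true, true))).card = 3 := by decide
    rw [Finset.prod_const, h3, Finset.card_univ, Fintype.card_prod, hcx, Fintype.card_fin] at hi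
    rw [hUc] at hs
    refine ⟨?_, hs.trans (Nat.mul_le_mul_left _ hi)⟩
    rw [← hUc]; exact Finset.card_le_card hUT
  · intro Z hZ Z' hZ' h
    simp only [Finset.mem_coe, Finset.mem_image] at hZ hZ'
    obtain ⟨E, hE, rfl⟩ := hZ
    obtain ⟨E', hE', rfl⟩ := hZ'
    ext p
    by_cases hp : p ∈ U
    · rw [hU, Finset.mem_image] at hp
      obtain ⟨⟨⟨i, b⟩, x⟩, -, rfl⟩ := hp
      have := congrFun h (i, x)
      simp only [Prod.mk.injEq, decide_eq_decide] at this
      cases b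
      · exact this.1
      · exact this.2
    · simp [hp]
  · intro Z hZ q
    rw [Finset.mem_image] at hZ
    obtain ⟨E, hE, rfl⟩ := hZ
    simp only [Finset.mem_filter, Finset.mem_univ, true_and, ne_eq, Prod.mk.injEq, decide_eq_true_eq]
    intro h
    exact hF2 E hE q.1 q.2.1 q.2.2 ⟨(Finset.mem_inter.1 h.1).1, (Finset.mem_inter.1 h.2).1⟩

theorem redcount2 {n : ℕ} (X Y : Finset (Fin n)) (hXY : Disjoint X Y)
    (F : Finset (Finset (Fin n × Fin n))) (hF : ∀ E ∈ F, E ⊆ Tp n)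
    (hF2 : ∀ E ∈ F, ∀ x ∈ X, ∀ y ∈ Y, oo x y ∉ E) :
    X.card * Y.card ≤ (Tp n).card ∧ F.card ≤ 2 ^ ((Tp n).card - X.card * Y.card) := by
  classical
  set U := (X ×ˢ Y).image (fun p => oo p.1 p.2) with hU
  have hne : ∀ x ∈ X, ∀ y ∈ Y, x ≠ y := by
    rintro x hx y hy rfl; exact Finset.disjoint_left.1 hXY hx hy
  have hUc : U.card = X.card * Y.card := by
    rw [hU, Finset.card_image_of_injOn, Finset.card_product]
    rintro ⟨x, y⟩ h ⟨x', y'⟩ h' he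
    simp only [Finset.coe_product, Set.mem_prod, Finset.mem_coe] at h h'
    rcases oo_eq he with ⟨h1, h2⟩ | ⟨h1, h2⟩
    · simp only at h1 h2; rw [h1, h2]
    · exact absurd h1 (hne _ h.1 _ h'.2)
  have hUT : U ⊆ Tp n := by
    intro p hp
    rw [hU, Finset.mem_image] at hp
    obtain ⟨q, hq, rfl⟩ := hp
    rw [Finset.mem_product] at hq
    exact oo_mem_Tp (hne _ hq.1 _ hq.2)
  have hs := card_split (Tp n) U hUT F hF
  have h1 : (F.image (fun E => E ∩ U)).card ≤ 1 := by
    have : F.image (fun E => E ∩ U) ⊆ {∅} := by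
      intro Z hZ
      rw [Finset.mem_image] at hZ
      obtain ⟨E, hE, rfl⟩ := hZ
      rw [Finset.mem_singleton, Finset.eq_empty_iff_forall_notMem]
      intro p hp
      rw [Finset.mem_inter, hU, Finset.mem_image] at hp
      obtain ⟨hpE, q, hq, rfl⟩ := hp
      rw [Finset.mem_product] at hq
      exact hF2 E hE _ hq.1 _ hq.2 hpE
    simpa using Finset.card_le_card this
  rw [hUc] at hs
  refine ⟨by rw [← hUc]; exact Finset.card_le_card hUT, hs.trans ?_⟩
  calc _ ≤ 2 ^ ((Tp n).card - X.card * Y.card) * 1 := Nat.mul_le_mul_left _ h1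
    _ = _ := mul_one _

/-- blue matching -/
structure Mt {n m : ℕ} (s : Sg n) (u v : Fin m → Fin n) : Prop where
  ui : Function.Injective u
  vi : Function.Injective v
  uv : ∀ i j, u i ≠ v j
  bl : ∀ i, s (u i) (v i) = -1

/-- maximality -/
def Touch {n m : ℕ} (s : Sg n) (u v : Fin m → Fin n) : Prop :=
  ∀ x y, s x y = -1 → (∃ i, u i = x ∨ v i = x) ∨ (∃ i, u i = y ∨ v i = y)

theorem exists_max {n : ℕ} (s : Sg n) (hs : IsS s) :
    ∃ m, m ≤ n ∧ ∃ u v : Fin m → Fin n, Mt s u v ∧ Touch s u v := by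
  classical
  set m := Nat.findGreatest (fun m => ∃ u v : Fin m → Fin n, Mt s u v) n with hm
  have h0 : ∃ u v : Fin 0 → Fin n, Mt s u v :=
    ⟨Fin.elim0, Fin.elim0, fun i => i.elim0, fun i => i.elim0, fun i => i.elim0, fun i => i.elim0⟩
  obtain ⟨u, v, huv⟩ := Nat.findGreatest_spec (P := fun m => ∃ u v : Fin m → Fin n, Mt s u v) (Nat.zero_le n) h0
  rw [← hm] at u v
  refine ⟨m, Nat.findGreatest_le n, ?_⟩
  obtain ⟨u, v, huv⟩ := Nat.findGreatest_spec (P := fun m => ∃ u v : Fin m → Fin n, Mt s u v) (Nat.zero_le n) h0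
  refine ⟨u, v, huv, ?_⟩
  intro x y hxy
  by_contra hcon
  push Not at hcon
  obtain ⟨h1, h2⟩ := hcon
  have hne : x ≠ y := by rintro rfl; rw [hs.diag] at hxy; exact absurd hxy (by decide)
  have hM : Mt s (Fin.cons x u : Fin (_ + 1) → Fin n) (Fin.cons y v : Fin (_ + 1) → Fin n) := by
    refine ⟨?_, ?_, ?_, ?_⟩
    · rw [Fin.cons_injective_iff]
      refine ⟨?_, huv.ui⟩
      rintro ⟨i, hi⟩; exact (h1 i).1 hi
    · rw [Fin.cons_injective_iff]
      refine ⟨?_, huv.vi⟩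
      rintro ⟨i, hi⟩; exact (h2 i).2 hi
    · intro i j
      refine Fin.cases ?_ (fun i => ?_) i <;> refine Fin.cases ?_ (fun j => ?_) j
      · simpa using hne
      · simpa using (h1 j).2.symm
      · simpa using (h2 i).1
      · simpa using huv.uv i j
    · intro i
      refine Fin.cases ?_ (fun i => ?_) i
      · simpa using hxy
      · simpa using huv.bl i
  have hle : m + 1 ≤ n := by
    have := Fintype.card_le_of_injective _ hM.ui
    simpa using this
  have := Nat.le_findGreatest (P := fun m => ∃ u v : Fin m → Fin n, Mt s u v) hle ⟨_, _, hM⟩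
  omega

theorem Red_inj {n m : ℕ} (u v : Fin m → Fin n) (b b' : Fin m → Finset (Fin n)) (S : Finset (Sg n))
    (hS : ∀ s ∈ S, IsS s ∧ Touch s u v ∧ (∀ i, bd s (u i) = b i) ∧ (∀ i, bd s (v i) = b' i)) :
    S.card ≤ (S.image Red).card := by
  classical
  apply le_of_eq
  symm
  apply Finset.card_image_of_injOn
  have key : ∀ s ∈ S, ∀ s' ∈ S, ∀ x y, s x y = -1 → s' x y = -1 := by
    intro s hs s' hs' x y h
    obtain ⟨i1, t, hb, hb'⟩ := hS s hs
    obtain ⟨i1', t', hc, hc'⟩ := hS s' hs'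
    rcases t x y h with ⟨i, hi | hi⟩ | ⟨i, hi | hi⟩
    · subst hi
      rw [← mem_bd, hc, ← hb, mem_bd]; exact h
    · subst hi
      rw [← mem_bd, hc', ← hb', mem_bd]; exact h
    · subst hi
      rw [i1'.symm, ← mem_bd, hc, ← hb, mem_bd, i1.symm]; exact h
    · subst hi
      rw [i1'.symm, ← mem_bd, hc', ← hb', mem_bd, i1.symm]; exact h
  intro s hs s' hs' h
  have i1 := (hS s hs).1
  have i1' := (hS s' hs').1
  apply sg_ext i1.symm i1.diag i1'.symm i1'.diag
  intro x y hxy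
  have k1 := key s hs s' hs' x y
  have k2 := key s' hs' s hs x y
  have k3 : s x y = 1 ↔ s' x y = 1 := by
    rw [← oo_mem_Red i1 hxy.ne, ← oo_mem_Red i1' hxy.ne, h]
  generalize s x y = a at *
  generalize s' x y = c at *
  clear key h
  revert a c; decide

theorem Touch_Bc {n m : ℕ} (s : Sg n) (hs : IsS s) (u v : Fin m → Fin n) (ht : Touch s u v) (D : ℝ)
    (hD : ∀ x, ((bd s x).card : ℝ) ≤ D) : ((Bc s).card : ℝ) ≤ 4 * m * D := by
  classical
  have h1 : Bc s ⊆ (Finset.univ : Finset (Fin m)).biUnion (fun i =>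
      ((bd s (u i)).image (fun y => (u i, y)) ∪ (bd s (v i)).image (fun y => (v i, y))) ∪
      ((bd s (u i)).image (fun y => (y, u i)) ∪ (bd s (v i)).image (fun y => (y, v i)))) := by
    rintro ⟨x, y⟩ hp
    rw [mem_Bc] at hp
    simp only [Finset.mem_biUnion, Finset.mem_univ, true_and, Finset.mem_union, Finset.mem_image, mem_bd, Prod.mk.injEq]
    simp only at hp
    have hp' := hp
    rw [hs.symm] at hp'
    rcases ht x y hp with ⟨i, hi | hi⟩ | ⟨i, hi | hi⟩
    · exact ⟨i, Or.inl (Or.inl ⟨y, by rw [hi]; exact hp, hi, rfl⟩)⟩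
    · exact ⟨i, Or.inl (Or.inr ⟨y, by rw [hi]; exact hp, hi, rfl⟩)⟩
    · exact ⟨i, Or.inr (Or.inl ⟨x, by rw [hi]; exact hp', rfl, hi⟩)⟩
    · exact ⟨i, Or.inr (Or.inr ⟨x, by rw [hi]; exact hp', rfl, hi⟩)⟩
  have h2 := (Finset.card_le_card h1).trans Finset.card_biUnion_le
  have h3 : ((Bc s).card : ℝ) ≤ ∑ i : Fin m, (((((bd s (u i)).image (fun y => (u i, y)) ∪ (bd s (v i)).image (fun y => (v i, y))) ∪
      ((bd s (u i)).image (fun y => (y, u i)) ∪ (bd s (v i)).image (fun y => (y, v i)))).card : ℕ) : ℝ) := by exact_mod_cast h2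
  refine h3.trans ?_
  calc _ ≤ ∑ i : Fin m, 4 * D := by
        apply Finset.sum_le_sum
        intro i _
        have a1 := Finset.card_union_le ((bd s (u i)).image (fun y => (u i, y)) ∪ (bd s (v i)).image (fun y => (v i, y)))
          ((bd s (u i)).image (fun y => (y, u i)) ∪ (bd s (v i)).image (fun y => (y, v i)))
        have a2 := Finset.card_union_le ((bd s (u i)).image (fun y => (u i, y))) ((bd s (v i)).image (fun y => (v i, y)))
        have a3 := Finset.card_union_le ((bd s (u i)).image (fun y => (y, u i))) ((bd s (v i)).image (fun y => (y, v i)))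
        have b1 : ((bd s (u i)).image (fun y => (u i, y))).card ≤ (bd s (u i)).card := Finset.card_image_le
        have b2 : ((bd s (v i)).image (fun y => (v i, y))).card ≤ (bd s (v i)).card := Finset.card_image_le
        have b3 : ((bd s (u i)).image (fun y => (y, u i))).card ≤ (bd s (u i)).card := Finset.card_image_le
        have b4 : ((bd s (v i)).image (fun y => (y, v i))).card ≤ (bd s (v i)).card := Finset.card_image_le
        have c1 := hD (u i)
        have c2 := hD (v i)
        have : ((((bd s (u i)).image (fun y => (u i, y)) ∪ (bd s (v i)).image (fun y => (v i, y))) ∪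
          ((bd s (u i)).image (fun y => (y, u i)) ∪ (bd s (v i)).image (fun y => (y, v i)))).card) ≤
          2 * (bd s (u i)).card + 2 * (bd s (v i)).card := by omega
        have h5 : ((((((bd s (u i)).image (fun y => (u i, y)) ∪ (bd s (v i)).image (fun y => (v i, y))) ∪
          ((bd s (u i)).image (fun y => (y, u i)) ∪ (bd s (v i)).image (fun y => (y, v i)))).card) : ℕ) : ℝ) ≤
          2 * (bd s (u i)).card + 2 * (bd s (v i)).card := by exact_mod_cast this
        linarith
    _ = _ := by simp; ring

/-- Generic encoding over matchings with blue neighbourhoods in `R`. -/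
theorem match_enc {n m : ℕ} (R : Finset (Finset (Fin n))) (F : Finset (Sg n))
    (hF : ∀ s ∈ F, IsS s ∧ (∀ x, bd s x ∈ R) ∧ ∃ u v : Fin m → Fin n, Mt s u v ∧ Touch s u v) (B : ℝ)
    (hB0 : 0 ≤ B)
    (hB : ∀ (u v : Fin m → Fin n) (S : Finset (Sg n)), S ⊆ F → (∀ s ∈ S, IsS s ∧ Mt s u v ∧ Touch s u v) →
      (((S.image Red).card : ℕ) : ℝ) ≤ B) :
    (F.card : ℝ) ≤ (n : ℝ) ^ (2 * m) * (R.card : ℝ) ^ (2 * m) * B := by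
  classical
  have h := card_le_sum_fiber F
    ((Finset.univ : Finset (Fin m → Fin n)) ×ˢ ((Finset.univ : Finset (Fin m → Fin n)) ×ˢ
      ((Fintype.piFinset (fun _ : Fin m => R)) ×ˢ (Fintype.piFinset (fun _ : Fin m => R)))))
    (fun d => F.filter (fun s => Mt s d.1 d.2.1 ∧ Touch s d.1 d.2.1 ∧ (∀ i, bd s (d.1 i) = d.2.2.1 i) ∧
      (∀ i, bd s (d.2.1 i) = d.2.2.2 i)))
    (by
      intro s hs
      obtain ⟨h1, h2, u, v, h3, h4⟩ := hF s hs
      refine ⟨(u, v, fun i => bd s (u i), fun i => bd s (v i)), ?_, ?_⟩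
      · simp [Fintype.mem_piFinset, h2]
      · rw [Finset.mem_filter]; exact ⟨hs, h3, h4, fun _ => rfl, fun _ => rfl⟩) B (by
      rintro ⟨u, v, b, b'⟩ -
      have h1 := Red_inj u v b b' (F.filter (fun s => Mt s u v ∧ Touch s u v ∧ (∀ i, bd s (u i) = b i) ∧
        (∀ i, bd s (v i) = b' i))) (by
          intro s hs
          rw [Finset.mem_filter] at hs
          exact ⟨(hF s hs.1).1, hs.2.2⟩)
      have h2 := hB u v (F.filter (fun s => Mt s u v ∧ Touch s u v ∧ (∀ i, bd s (u i) = b i) ∧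
        (∀ i, bd s (v i) = b' i))) (Finset.filter_subset _ _) (by
          intro s hs
          rw [Finset.mem_filter] at hs
          exact ⟨(hF s hs.1).1, hs.2.1, hs.2.2.1⟩)
      exact le_trans (by exact_mod_cast h1) h2)
  refine h.trans (le_of_eq ?_)
  simp only [Finset.card_product, Finset.card_univ, Fintype.card_piFinset, Fintype.card_fun, Fintype.card_fin,
    Finset.prod_const]
  push_cast
  ring

theorem logb3 : (3 : ℝ) ≤ (2 : ℝ) ^ (1.6 : ℝ) := by
  have h : (3 : ℝ) ^ (5 : ℕ) ≤ ((2 : ℝ) ^ (1.6 : ℝ)) ^ (5 : ℕ) := by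
    rw [← Real.rpow_natCast ((2 : ℝ) ^ (1.6 : ℝ)), ← Real.rpow_mul (by norm_num)]
    have : (1.6 : ℝ) * ((5 : ℕ) : ℝ) = ((8 : ℕ) : ℝ) := by norm_num
    rw [this, Real.rpow_natCast]; norm_num
  exact le_of_pow_le_pow_left₀ (by norm_num) (by positivity) h

theorem npow_eq (n m : ℕ) (hn : 2 ≤ n) : (n : ℝ) ^ m = (2 : ℝ) ^ (m * Real.logb 2 n) := by
  have hn' : (0 : ℝ) < n := by positivity
  rw [mul_comm, Real.rpow_mul (by norm_num), Real.rpow_logb (by norm_num) (by norm_num) hn', Real.rpow_natCast]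

theorem sgn_g : ∀ a b c : SignType, a = -1 → b = 1 → c = 1 → a * b * c ≠ -1 → False := by decide

theorem C1_red {n m : ℕ} (hm : 2 ≤ m) (u v : Fin m → Fin n) (S : Finset (Sg n))
    (hS : ∀ s ∈ S, IsS s ∧ Mt s u v) :
    (((S.image Red).card : ℕ) : ℝ) ≤ (2 : ℝ) ^ (((Tp n).card : ℝ) - m * n / 15) := by
  classical
  rcases S.eq_empty_or_nonempty with rfl | ⟨s0, hs0⟩
  · simp only [Finset.image_empty, Finset.card_empty, Nat.cast_zero]; positivity
  have hM := (hS s0 hs0).2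
  have h2m : 2 * m ≤ n := by
    have hi : Function.Injective (Sum.elim u v) := hM.ui.sumElim hM.vi hM.uv
    have := Fintype.card_le_of_injective _ hi
    simp at this; omega
  set m' := m / 2 with hm'
  have hle : m' ≤ m := Nat.div_le_self _ _
  set w : Fin m' × Bool → Fin n := fun q => if q.2 then v (Fin.castLE hle q.1) else u (Fin.castLE hle q.1) with hw
  have hwi : Function.Injective w := by
    rintro ⟨i, b⟩ ⟨j, c⟩ h
    simp only [hw] at h
    cases b <;> cases c <;> simp only [if_true, if_false, Bool.false_eq_true] at h
    · have := Fin.castLE_injective hle (hM.ui h); rw [this]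
    · exact absurd h (hM.uv _ _)
    · exact absurd h.symm (hM.uv _ _)
    · have := Fin.castLE_injective hle (hM.vi h); rw [this]
  obtain ⟨h1, h2⟩ := redcount1 w hwi (S.image Red) (by
    intro E hE
    rw [Finset.mem_image] at hE
    obtain ⟨s, hs, rfl⟩ := hE
    exact Finset.filter_subset _ _) (by
    intro E hE i x hx ⟨ha, hb⟩
    rw [Finset.mem_image] at hE
    obtain ⟨s, hs, rfl⟩ := hE
    have hI := (hS s hs).1
    rw [oo_mem_Red hI (hx _)] at ha hb
    have ha' : s (u (Fin.castLE hle i)) x = 1 := ha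
    have hb' : s (v (Fin.castLE hle i)) x = 1 := hb
    exact sgn_g _ _ _ ((hS s hs).2.bl (Fin.castLE hle i)) hb' ha' (hI.tri _ _ _))
  set j : ℕ := m' * (n - 2 * m') with hj
  have h1' : 2 * j ≤ (Tp n).card := by rw [hj, ← mul_assoc]; exact h1
  have h2' : (S.image Red).card ≤ 2 ^ ((Tp n).card - 2 * j) * 3 ^ j := by rw [hj, ← mul_assoc]; exact h2
  have h3 : (((S.image Red).card : ℕ) : ℝ) ≤ (2 : ℝ) ^ (((Tp n).card - 2 * j : ℕ) : ℝ) * 3 ^ j := by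
    rw [Real.rpow_natCast]; exact_mod_cast h2'
  refine h3.trans ?_
  have h4 : (3 : ℝ) ^ j ≤ (2 : ℝ) ^ (1.6 * (j : ℝ)) := by
    rw [Real.rpow_mul (by norm_num), Real.rpow_natCast]
    exact pow_le_pow_left₀ (by norm_num) logb3 j
  have h5 : (m : ℝ) * n ≤ 6 * j := by
    have a1 : m ≤ 3 * m' := by omega
    have a2 : n ≤ 2 * (n - 2 * m') := by omega
    have a3 : m * n ≤ (3 * m') * (2 * (n - 2 * m')) := Nat.mul_le_mul a1 a2
    have a4 : m * n ≤ 6 * j := by rw [hj]; calc _ ≤ _ := a3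
                                    _ = _ := by ring
    exact_mod_cast a4
  calc _ ≤ (2 : ℝ) ^ (((Tp n).card - 2 * j : ℕ) : ℝ) * (2 : ℝ) ^ (1.6 * (j : ℝ)) := by gcongr
    _ ≤ _ := by
      rw [← Real.rpow_add (by norm_num), Nat.cast_sub h1']
      apply Real.rpow_le_rpow_of_exponent_le (by norm_num)
      push_cast
      linarith

theorem C1 {n m : ℕ} (hn : 2 ≤ n) (hm : 300 * Real.logb 2 n ≤ m) (hl : 2 * Real.logb 2 n ≤ 0.006 * n)
    (R : Finset (Finset (Fin n))) (hR : (R.card : ℝ) ≤ (2 : ℝ) ^ (0.01 * (n : ℝ))) (F : Finset (Sg n))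
    (hF : ∀ s ∈ F, IsS s ∧ (∀ x, bd s x ∈ R) ∧ ∃ u v : Fin m → Fin n, Mt s u v ∧ Touch s u v) :
    (F.card : ℝ) ≤ (2 : ℝ) ^ (((Tp n).card : ℝ) - 8 * n * Real.logb 2 n) := by
  have hn2 : (2 : ℝ) ≤ n := by exact_mod_cast hn
  have hl1 : 1 ≤ Real.logb 2 n := by
    rw [Real.le_logb_iff_rpow_le (by norm_num) (by linarith)]; simpa using hn2
  have hm2 : 2 ≤ m := by
    have : (2 : ℝ) ≤ m := by linarith
    exact_mod_cast this
  have h := match_enc R F hF ((2 : ℝ) ^ (((Tp n).card : ℝ) - m * n / 15)) (by positivity)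
    (fun u v S _ hS => C1_red hm2 u v S (fun s hs => ⟨(hS s hs).1, (hS s hs).2.1⟩))
  refine h.trans ?_
  have h1 : (R.card : ℝ) ^ (2 * m) ≤ (2 : ℝ) ^ (0.02 * (m : ℝ) * n) := by
    calc _ ≤ ((2 : ℝ) ^ (0.01 * (n : ℝ))) ^ (2 * m) := by gcongr
      _ = _ := by rw [← Real.rpow_natCast, ← Real.rpow_mul (by norm_num)]; push_cast; ring_nf
  rw [npow_eq n (2 * m) hn]
  set l := Real.logb 2 n with hldef
  calc _ ≤ (2 : ℝ) ^ (((2 * m : ℕ) : ℝ) * l) * (2 : ℝ) ^ (0.02 * (m : ℝ) * n) * (2 : ℝ) ^ (((Tp n).card : ℝ) - m * n / 15) := by gcongr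
    _ ≤ _ := by
      rw [← Real.rpow_add (by norm_num), ← Real.rpow_add (by norm_num)]
      apply Real.rpow_le_rpow_of_exponent_le (by norm_num)
      push_cast
      have e1 : (m : ℝ) * (2 * l) ≤ m * (0.006 * n) := by gcongr
      have e2 : (300 * l) * n ≤ m * n := by gcongr
      have e3 : 0 ≤ l * n := by positivity
      nlinarith

theorem C2_red {n : ℕ} (t : ℝ) (S : Finset (Sg n))
    (hS : ∀ s ∈ S, IsS s ∧ ∃ x, t ≤ ((bd s x).card : ℝ) * (rd s x).card) :
    (((S.image Red).card : ℕ) : ℝ) ≤ (2 : ℝ) ^ (2 * (n : ℝ) + (((Tp n).card : ℝ) - t)) := by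
  classical
  have h4 : (2 : ℝ) ^ (2 * (n : ℝ)) = (((Finset.univ : Finset (Finset (Fin n) × Finset (Fin n))).card : ℕ) : ℝ) := by
    rw [Finset.card_univ, Fintype.card_prod, Fintype.card_finset, Fintype.card_fin, Real.rpow_mul (by norm_num), Real.rpow_natCast]
    push_cast
    rw [← mul_pow]; norm_num
  rw [Real.rpow_add (by norm_num), h4]
  apply card_le_sum_fiber _ _ (fun XY => (Tp n).powerset.filter (fun E => Disjoint XY.1 XY.2 ∧ t ≤ (XY.1.card : ℝ) * XY.2.card ∧
    ∀ x ∈ XY.1, ∀ y ∈ XY.2, oo x y ∉ E))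
  · intro E hE
    rw [Finset.mem_image] at hE
    obtain ⟨s, hs, rfl⟩ := hE
    obtain ⟨hI, x, hx⟩ := hS s hs
    refine ⟨(bd s x, rd s x), Finset.mem_univ _, ?_⟩
    rw [Finset.mem_filter, Finset.mem_powerset]
    have hdis : Disjoint (bd s x) (rd s x) := by
      rw [Finset.disjoint_left]
      intro y h1 h2
      rw [mem_bd] at h1; rw [mem_rd, h1] at h2; exact absurd h2 (by decide)
    refine ⟨Finset.filter_subset _ _, hdis, hx, ?_⟩
    intro y hy z hz h
    rw [oo_mem_Red hI (by rintro rfl; exact Finset.disjoint_left.1 hdis hy hz)] at h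
    rw [mem_bd] at hy
    rw [mem_rd] at hz
    exact sgn_g _ _ _ hy h hz (hI.tri _ _ _)
  · rintro ⟨X, Y⟩ -
    simp only
    by_cases hc : Disjoint X Y ∧ t ≤ (X.card : ℝ) * Y.card
    swap
    · rw [Finset.filter_false_of_mem]
      · simp only [Finset.card_empty, Nat.cast_zero]; positivity
      · intro E _ h; exact hc ⟨h.1, h.2.1⟩
    obtain ⟨h1, h2⟩ := redcount2 X Y hc.1 ((Tp n).powerset.filter (fun E => Disjoint X Y ∧ t ≤ (X.card : ℝ) * Y.card ∧
      ∀ x ∈ X, ∀ y ∈ Y, oo x y ∉ E)) (by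
        intro E hE; rw [Finset.mem_filter, Finset.mem_powerset] at hE; exact hE.1) (by
        intro E hE; rw [Finset.mem_filter] at hE; exact hE.2.2.2)
    have h3 : ((((Tp n).powerset.filter (fun E => Disjoint X Y ∧ t ≤ (X.card : ℝ) * Y.card ∧
      ∀ x ∈ X, ∀ y ∈ Y, oo x y ∉ E)).card : ℕ) : ℝ) ≤ (2 : ℝ) ^ (((Tp n).card - X.card * Y.card : ℕ) : ℝ) := by
      rw [Real.rpow_natCast]; exact_mod_cast h2
    refine h3.trans ?_
    apply Real.rpow_le_rpow_of_exponent_le (by norm_num)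
    rw [Nat.cast_sub h1]
    push_cast
    linarith [hc.2]

theorem C2 {n m : ℕ} (hn : 2 ≤ n) (hm : (m : ℝ) ≤ 300 * Real.logb 2 n) (F : Finset (Sg n))
    (hF : ∀ s ∈ F, IsS s ∧ (∃ u v : Fin m → Fin n, Mt s u v ∧ Touch s u v) ∧
      ∃ x, 1210 * n * Real.logb 2 n ≤ ((bd s x).card : ℝ) * (rd s x).card) (hln : Real.logb 2 n ≤ n) :
    (F.card : ℝ) ≤ (2 : ℝ) ^ (((Tp n).card : ℝ) - 8 * n * Real.logb 2 n) := by
  have hn2 : (2 : ℝ) ≤ n := by exact_mod_cast hn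
  have hl1 : 1 ≤ Real.logb 2 n := by
    rw [Real.le_logb_iff_rpow_le (by norm_num) (by linarith)]; simpa using hn2
  have h := match_enc Finset.univ F (fun s hs => ⟨(hF s hs).1, fun x => Finset.mem_univ _, (hF s hs).2.1⟩)
    ((2 : ℝ) ^ (2 * (n : ℝ) + (((Tp n).card : ℝ) - 1210 * n * Real.logb 2 n))) (by positivity)
    (fun u v S hSF hS => C2_red _ S (fun s hs => ⟨(hS s hs).1, (hF s (hSF hs)).2.2⟩))
  refine h.trans ?_
  rw [npow_eq n (2 * m) hn, Finset.card_univ, Fintype.card_finset, Fintype.card_fin]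
  have h1 : (((2 ^ n : ℕ) : ℝ)) ^ (2 * m) = (2 : ℝ) ^ ((n : ℝ) * (2 * m)) := by
    push_cast
    rw [← pow_mul, ← Real.rpow_natCast]; push_cast; ring_nf
  rw [h1]
  set l := Real.logb 2 n with hldef
  rw [← Real.rpow_add (by norm_num), ← Real.rpow_add (by norm_num)]
  apply Real.rpow_le_rpow_of_exponent_le (by norm_num)
  push_cast
  have e1 : (m : ℝ) * l ≤ 300 * l * n := by
    calc (m : ℝ) * l ≤ 300 * l * l := by gcongr
      _ ≤ _ := by gcongr
  have e2 : (n : ℝ) * m ≤ n * (300 * l) := by gcongr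
  have e3 : (n : ℝ) * 1 ≤ n * l := by gcongr
  nlinarith

theorem sqrt_l (l : ℝ) (hl : 0 ≤ l) : l ^ ((3 : ℝ) / 2) = l * Real.sqrt l := by
  rw [Real.sqrt_eq_rpow]
  rcases hl.eq_or_lt with rfl | h
  · norm_num
  · rw [← Real.rpow_one_add' hl (by norm_num)]; norm_num

open scoped Classical in
theorem A3_count {n : ℕ} (hn : 2 ≤ n) (εb : ℝ) (hl : 2 * Real.logb 2 n ≤ 0.006 * n)
    (hR : (((Finset.univ : Finset (Fin n)).powerset.filter (fun Z => Z.card ≤ ⌊εb * n⌋₊)).card : ℝ) ≤ (2 : ℝ) ^ (0.01 * (n : ℝ))) :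
    (((Finset.univ.filter (fun s : Sg n => IsS s ∧
      (∀ x, (bd s x).card ≤ (rd s x).card ∧ ((bd s x).card : ℝ) < εb * n) ∧
      1200 * Real.sqrt 1210 * Real.sqrt n * Real.logb 2 n ^ ((3 : ℝ) / 2) < ((Bc s).card : ℝ))).card : ℕ) : ℝ) ≤
      (((n + 1) * 2 : ℕ) : ℝ) * (2 : ℝ) ^ (((Tp n).card : ℝ) - 8 * n * Real.logb 2 n) := by
  have hn2 : (2 : ℝ) ≤ n := by exact_mod_cast hn
  have hl1 : 1 ≤ Real.logb 2 n := by
    rw [Real.le_logb_iff_rpow_le (by norm_num) (by linarith)]; simpa using hn2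
  have hD : (((Finset.range (n + 1)) ×ˢ (Finset.univ : Finset Bool)).card) = (n + 1) * 2 := by simp
  rw [← hD]
  set l := Real.logb 2 n with hldef
  set A := Finset.univ.filter (fun s : Sg n => IsS s ∧
      (∀ x, (bd s x).card ≤ (rd s x).card ∧ ((bd s x).card : ℝ) < εb * n) ∧
      1200 * Real.sqrt 1210 * Real.sqrt n * l ^ ((3 : ℝ) / 2) < ((Bc s).card : ℝ)) with hA
  apply card_le_sum_fiber A _ (fun d => A.filter (fun s => (∃ u v : Fin d.1 → Fin n, Mt s u v ∧ Touch s u v) ∧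
    if d.2 = true then 300 * l ≤ d.1 else ((d.1 : ℝ) ≤ 300 * l ∧ ∃ x, 1210 * n * l ≤ ((bd s x).card : ℝ) * (rd s x).card)))
  · intro s hs
    have hs' := hs
    rw [hA, Finset.mem_filter] at hs'
    obtain ⟨-, hI, hd, hB⟩ := hs'
    obtain ⟨m, hmn, u, v, hM, hT⟩ := exists_max s hI
    rcases le_total (300 * l) m with hm | hm
    · refine ⟨(m, true), by simp; omega, ?_⟩
      rw [Finset.mem_filter]
      exact ⟨hs, ⟨u, v, hM, hT⟩, by simpa using hm⟩
    · refine ⟨(m, false), by simp; omega, ?_⟩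
      rw [Finset.mem_filter]
      refine ⟨hs, ⟨u, v, hM, hT⟩, ?_⟩
      simp only [Bool.false_eq_true, if_false]
      refine ⟨hm, ?_⟩
      by_contra hcon
      push Not at hcon
      have h1 : ∀ x, ((bd s x).card : ℝ) ≤ Real.sqrt (1210 * n * l) := by
        intro x
        apply Real.le_sqrt_of_sq_le
        have a1 := hcon x
        have a2 : ((bd s x).card : ℝ) ≤ (rd s x).card := by exact_mod_cast (hd x).1
        have a3 : (0 : ℝ) ≤ (bd s x).card := by positivity
        nlinarith
      have h2 := Touch_Bc s hI u v hT _ h1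
      have h3 : 4 * (m : ℝ) * Real.sqrt (1210 * n * l) ≤ 4 * (300 * l) * Real.sqrt (1210 * n * l) := by gcongr
      rw [sqrt_l l (by linarith)] at hB
      rw [Real.sqrt_mul (by positivity), Real.sqrt_mul (by norm_num)] at h3 h2
      nlinarith
  · rintro ⟨m, b⟩ -
    cases b
    · by_cases hm : (m : ℝ) ≤ 300 * l
      · apply C2 hn hm
        · intro s hs
          rw [Finset.mem_filter, hA, Finset.mem_filter] at hs
          simp only [Bool.false_eq_true, if_false] at hs
          exact ⟨hs.1.2.1, hs.2.1, hs.2.2.2⟩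
        · rw [← hldef]; linarith
      · rw [Finset.filter_false_of_mem]
        · simp only [Finset.card_empty, Nat.cast_zero]; positivity
        · intro s _ h
          simp only [Bool.false_eq_true, if_false] at h
          exact hm h.2.1
    · by_cases hm : 300 * l ≤ (m : ℝ)
      · apply C1 hn hm hl _ hR
        intro s hs
        rw [Finset.mem_filter, hA, Finset.mem_filter] at hs
        refine ⟨hs.1.2.1, ?_, hs.2.1⟩
        intro x
        rw [Finset.mem_filter, Finset.mem_powerset]
        exact ⟨Finset.subset_univ _, Nat.le_floor (hs.1.2.2.1 x).2.le⟩
      · rw [Finset.filter_false_of_mem]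
        · simp only [Finset.card_empty, Nat.cast_zero]; positivity
        · intro s _ h
          simp only [if_true] at h
          exact hm h.2

open scoped Classical in
/-- Sign matrix of a colored graph. -/
noncomputable def sgnOf {n : ℕ} (G : ColoredGraph n) : Sg n :=
  fun x y => if G.red.Adj x y then 1 else if G.blue.Adj x y then -1 else 0

theorem sgnOf_one {n : ℕ} (G : ColoredGraph n) (x y : Fin n) : sgnOf G x y = 1 ↔ G.red.Adj x y := by
  unfold sgnOf
  split_ifs <;> simp_all

theorem sgnOf_neg {n : ℕ} (G : ColoredGraph n) (x y : Fin n) : sgnOf G x y = -1 ↔ G.blue.Adj x y := by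
  have := G.disj x y
  unfold sgnOf
  split_ifs <;> simp_all

theorem sgnOf_inj {n : ℕ} : Function.Injective (sgnOf (n := n)) := by
  intro G H h
  have hr : G.red = H.red := by
    ext x y; rw [← sgnOf_one, ← sgnOf_one, h]
  have hb : G.blue = H.blue := by
    ext x y; rw [← sgnOf_neg, ← sgnOf_neg, h]
  cases G; cases H; simp_all

theorem sgn_adj {n : ℕ} (G : ColoredGraph n) (x y : Fin n) (h : sgnOf G x y ≠ 0) : G.Adj x y := by
  show (G.red ⊔ G.blue).Adj x y
  rw [SimpleGraph.sup_adj, ← sgnOf_one, ← sgnOf_neg]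
  generalize sgnOf G x y = a at *
  revert a; decide

theorem sgn_par : ∀ a b c : SignType, a * b * c = -1 → a ≠ 0 ∧ b ≠ 0 ∧ c ≠ 0 ∧
    Odd ((if a = -1 then 1 else 0) + (if b = -1 then 1 else 0) + (if c = -1 then 1 else 0) : ℕ) := by
  decide

theorem sgnOf_IsS {n : ℕ} (G : ColoredGraph n) (hG : G.OBTF) : IsS (sgnOf G) := by
  refine ⟨?_, ?_, ?_⟩
  · intro x y; unfold sgnOf; 
    by_cases h1 : G.red.Adj x y
    · rw [if_pos h1, if_pos h1.symm]
    · have h1' : ¬ G.red.Adj y x := fun h => h1 h.symm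
      rw [if_neg h1, if_neg h1']
      by_cases h2 : G.blue.Adj x y
      · rw [if_pos h2, if_pos h2.symm]
      · rw [if_neg h2, if_neg (fun h => h2 h.symm)]
  · intro x; simp [sgnOf]
  · intro x y z h
    obtain ⟨h1, h2, h3, h4⟩ := sgn_par _ _ _ h
    refine hG x y z (sgn_adj G _ _ h1) (sgn_adj G _ _ h2) (sgn_adj G _ _ h3) ?_
    have hb : ∀ u v, G.blueInd u v = if sgnOf G u v = -1 then 1 else 0 := by
      intro u v
      unfold ColoredGraph.blueInd
      by_cases h : G.blue.Adj u v
      · rw [if_pos h, if_pos ((sgnOf_neg G u v).2 h)]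
      · rw [if_neg h, if_neg (fun h' => h ((sgnOf_neg G u v).1 h'))]
    rw [hb, hb, hb]
    exact h4

theorem sgn_r : ∀ a b : SignType, a ≠ 0 → b ≠ 0 → a * b * 1 ≠ -1 → (a = 1 ↔ b = 1) := by decide
theorem sgn_bl : ∀ a b : SignType, a ≠ 0 → b ≠ 0 → a * b * (-1) ≠ -1 → (a = 1 ↔ ¬ b = 1) := by decide

theorem gamma_le_Bc {n : ℕ} (G : ColoredGraph n) (f : Fin n → SignType) (hf : ∀ x, f x ≠ 0) :
    gamma G ≤ (Bc (sw f (sgnOf G))).card := by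
  set E : Set (Sym2 (Fin n)) := (fun p : Fin n × Fin n => s(p.1, p.2)) '' (Bc (sw f (sgnOf G)) : Set (Fin n × Fin n)) with hE
  have hc : E.ncard ≤ (Bc (sw f (sgnOf G))).card := by
    have := Set.ncard_image_le (f := fun p : Fin n × Fin n => s(p.1, p.2)) (Finset.finite_toSet (Bc (sw f (sgnOf G))))
    rwa [Set.ncard_coe_finset] at this
  refine le_trans (Nat.sInf_le ⟨E, ?_, rfl, ?_⟩) hc
  · rintro _ ⟨⟨x, y⟩, hp, rfl⟩
    have hp' : sw f (sgnOf G) x y = -1 := mem_Bc.1 hp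
    rw [SimpleGraph.mem_edgeSet]
    refine sgn_adj G x y ?_
    intro h0
    simp [sw, h0] at hp'
  · have key : ∀ x y, s(x, y) ∉ E → f x * f y * sgnOf G x y ≠ -1 := by
      intro x y h h'
      exact h ⟨(x, y), mem_Bc.2 h', rfl⟩
    refine ⟨{x | f x = 1}, Set.subset_univ _, fun x _ y _ => ⟨fun h => ?_, fun h => ?_⟩⟩
    · have h' : (G.blue.deleteEdges E).Adj x y := h
      rw [SimpleGraph.deleteEdges_adj] at h'
      have := key x y h'.2
      rw [(sgnOf_neg G x y).2 h'.1] at this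
      exact sgn_bl _ _ (hf x) (hf y) this
    · have h' : (G.red.deleteEdges E).Adj x y := h
      rw [SimpleGraph.deleteEdges_adj] at h'
      have := key x y h'.2
      rw [(sgnOf_one G x y).2 h'.1] at this
      exact sgn_r _ _ (hf x) (hf y) this

theorem sgn_sq : ∀ a b c : SignType, a ≠ 0 → b ≠ 0 → a * b * (a * b * c) = c := by decide

theorem sw_sw {n : ℕ} (f : Fin n → SignType) (hf : ∀ x, f x ≠ 0) (s : Sg n) : sw f (sw f s) = s := by
  funext x y
  exact sgn_sq _ _ _ (hf x) (hf y)

open scoped Classical in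
theorem count_red {n : ℕ} (K : ℝ) :
    (({G ∈ obtfSet n | K < (gamma G : ℝ)}.ncard : ℕ) : ℝ) ≤
      ((Finset.univ.filter (fun s : Sg n => IsS s ∧ ∀ f : Fin n → SignType, (∀ x, f x ≠ 0) →
        K < ((Bc (sw f s)).card : ℝ))).card : ℝ) := by
  rw [← Set.ncard_image_of_injective _ (sgnOf_inj (n := n)), ← Set.ncard_coe_finset]
  apply Nat.cast_le.2
  apply Set.ncard_le_ncard _ (Finset.finite_toSet _)
  rintro _ ⟨G, ⟨hG, hK⟩, rfl⟩
  simp only [Finset.coe_filter, Finset.mem_univ, true_and, Set.mem_ofPred_eq]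
  exact ⟨sgnOf_IsS G hG, fun f hf => hK.trans_le (by exact_mod_cast gamma_le_Bc G f hf)⟩

theorem two_exp {E a b : ℝ} (ha : a ≤ (2 : ℝ) ^ (E - 2)) (hb : b ≤ (2 : ℝ) ^ (E - 2)) : a + b < (2 : ℝ) ^ E := by
  have h : (2 : ℝ) ^ E = 4 * (2 : ℝ) ^ (E - 2) := by
    rw [Real.rpow_sub (by norm_num)]; norm_num; ring
  have : (0 : ℝ) < (2 : ℝ) ^ (E - 2) := by positivity
  linarith

theorem rhs_eq (n : ℕ) (hn : 2 ≤ n) : (n : ℝ) ^ (-(3 * (n : ℝ))) * (bnum n : ℝ) =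
    (2 : ℝ) ^ ((n : ℝ) ^ 2 / 2 + n / 2 - 1 - 3 * n * Real.logb 2 n) := by
  have hn' : (0 : ℝ) < n := by positivity
  have h1 : (n : ℝ) ^ (-(3 * (n : ℝ))) = (2 : ℝ) ^ (- (3 * n * Real.logb 2 n)) := by
    have h : (n : ℝ) = (2 : ℝ) ^ Real.logb 2 n := (Real.rpow_logb (by norm_num) (by norm_num) hn').symm
    calc (n : ℝ) ^ (-(3 * (n : ℝ))) = ((2 : ℝ) ^ Real.logb 2 n) ^ (-(3 * (n : ℝ))) := by rw [← h]
      _ = _ := by rw [← Real.rpow_mul (by norm_num)]; congr 1; ring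
  have h2 : (bnum n : ℝ) = (2 : ℝ) ^ ((n : ℝ) ^ 2 / 2 + n / 2 - 1) := by
    unfold bnum
    have h3 : n * (n + 1) / 2 * 2 = n * (n + 1) := Nat.div_mul_cancel (Nat.even_mul_succ_self n).two_dvd
    have h4 : 1 ≤ n * (n + 1) / 2 := by nlinarith
    have h5 : ((n * (n + 1) / 2 - 1 : ℕ) : ℝ) = (n : ℝ) ^ 2 / 2 + n / 2 - 1 := by
      rw [Nat.cast_sub h4]
      have : ((n * (n + 1) / 2 : ℕ) : ℝ) * 2 = n * (n + 1) := by exact_mod_cast h3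
      push_cast at this ⊢
      nlinarith
    push_cast
    rw [← h5, Real.rpow_natCast]
  rw [h1, h2, ← Real.rpow_add (by norm_num)]
  congr 1; ring

theorem Tp_eq (n : ℕ) (hn : 1 ≤ n) : ((Tp n).card : ℝ) = (n : ℝ) ^ 2 / 2 - n / 2 := by
  rw [card_Tp]
  obtain ⟨m, rfl⟩ : ∃ m, n = m + 1 := ⟨n - 1, by omega⟩
  have h3 : (m + 1) * m / 2 * 2 = (m + 1) * m := Nat.div_mul_cancel (by rw [mul_comm]; exact (Nat.even_mul_succ_self m).two_dvd)
  have : (((m + 1) * m / 2 : ℕ) : ℝ) * 2 = (m + 1) * m := by exact_mod_cast h3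
  simp only [Nat.add_sub_cancel]
  push_cast at this ⊢
  linarith

open scoped Classical in
theorem disp_part {n : ℕ} (A F : Finset (Sg n))
    (h : ∀ s ∈ F, ∃ f : Fin n → SignType, (∀ x, f x ≠ 0) ∧ sw f s ∈ A) :
    (F.card : ℝ) ≤ (3 : ℝ) ^ n * A.card := by
  have := card_le_sum_fiber F (Finset.univ : Finset (Fin n → SignType))
    (fun f => Finset.univ.filter (fun s => (∀ x, f x ≠ 0) ∧ sw f s ∈ A))
    (by
      intro s hs
      obtain ⟨f, hf, hA⟩ := h s hs
      exact ⟨f, Finset.mem_univ _, Finset.mem_filter.2 ⟨Finset.mem_univ _, hf, hA⟩⟩)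
    (A.card : ℝ)
    (by
      intro f _
      norm_cast
      apply Finset.card_le_card_of_injOn (sw f)
      · intro s hs
        have hs' := (Finset.mem_filter.1 (Finset.mem_coe.1 hs)).2
        exact hs'.2
      · intro s hs t ht hst
        have hs' := (Finset.mem_filter.1 (Finset.mem_coe.1 hs)).2.1
        rw [← sw_sw f hs' s, hst, sw_sw f hs' t])
  refine this.trans (le_of_eq ?_)
  have h3 : Fintype.card SignType = 3 := by decide
  simp [Finset.card_univ, h3]

theorem final_count :
    ∃ C' : ℝ, 0 < C' ∧ ∃ N : ℕ, ∀ n : ℕ, N ≤ n →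
      ({G ∈ obtfSet n |
          C' * Real.sqrt n * Real.logb 2 n ^ ((3 : ℝ) / 2) < (gamma G : ℝ)}.ncard : ℝ) <
        (n : ℝ) ^ (-(3 * (n : ℝ))) * bnum n := by
  classical
  refine ⟨1200 * Real.sqrt 1210, by positivity, ?_⟩
  obtain ⟨ρ, hρ, hND⟩ := nondisp_count
  obtain ⟨εb, hεb, hsm⟩ := card_small 0.01 (by norm_num)
  obtain ⟨ε, hε, he1, he2, he3, he4, he5, he6⟩ : ∃ ε : ℝ, 0 < ε ∧ ε ≤ 1 ∧ ε ≤ ρ ∧ ε ≤ ρ ^ 2 ∧ ε ≤ ρ ^ 3 / 2 ∧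
      ε ≤ εb ∧ ε ≤ ρ * εb ^ 2 / 4 := by
    refine ⟨min 1 (min ρ (min (ρ ^ 2) (min (ρ ^ 3 / 2) (min εb (ρ * εb ^ 2 / 4))))), ?_, ?_⟩
    · simp only [lt_min_iff]
      refine ⟨one_pos, hρ, ?_, ?_, hεb, ?_⟩ <;> positivity
    · have h := le_refl (min 1 (min ρ (min (ρ ^ 2) (min (ρ ^ 3 / 2) (min εb (ρ * εb ^ 2 / 4))))))
      simpa only [le_min_iff] using h
  obtain ⟨c, hc, hcn⟩ := hND ε hε
  have hl2 : 0 < Real.log 2 := Real.log_pos (by norm_num)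
  have e1 := ev_log c 3 (3 / Real.log 2) hc
  have e2 := ev_log 0.006 0 (2 / Real.log 2) (by norm_num)
  have hall := (hcn.and (e1.and (e2.and (eventually_ge_atTop 2))))
  obtain ⟨N, hN⟩ := eventually_atTop.1 hall
  refine ⟨N, fun n hn => ?_⟩
  obtain ⟨h1, h2, h3, h4⟩ := hN n hn
  have hlog : Real.logb 2 n = Real.log n / Real.log 2 := rfl
  set l := Real.logb 2 n with hldef
  have h2' : 3 + 3 * l ≤ c * n := by rw [hlog]; convert h2 using 2; ring
  have h3' : 2 * l ≤ 0.006 * n := by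
    rw [hlog]; refine le_trans (le_of_eq ?_) h3; ring
  have hn2 : (2 : ℝ) ≤ n := by exact_mod_cast h4
  have hl1 : 1 ≤ l := by
    rw [hldef, Real.le_logb_iff_rpow_le (by norm_num) (by linarith)]; simpa using hn2
  have hA := A3_count h4 εb h3' (by
    have := hsm (Fin n) Finset.univ ⌊εb * n⌋₊ (by
      simp only [Finset.card_univ, Fintype.card_fin]
      exact Nat.floor_le (by positivity))
    simp only [Finset.card_univ, Fintype.card_fin] at this
    convert this)
  refine (count_red _).trans_lt ?_
  set A := (Finset.univ.filter (fun s : Sg n => IsS s ∧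
      (∀ x, (bd s x).card ≤ (rd s x).card ∧ ((bd s x).card : ℝ) < εb * n) ∧
      1200 * Real.sqrt 1210 * Real.sqrt n * Real.logb 2 n ^ ((3 : ℝ) / 2) < ((Bc s).card : ℝ))) with hAdef
  set F := (Finset.univ.filter (fun s : Sg n => IsS s ∧ ∀ f : Fin n → SignType, (∀ x, f x ≠ 0) →
        1200 * Real.sqrt 1210 * Real.sqrt n * Real.logb 2 n ^ ((3 : ℝ) / 2) < ((Bc (sw f s)).card : ℝ))) with hF
  set ND := (Finset.univ.filter (fun s : Sg n => IsS s ∧ ¬ Disp ρ ε s)) with hNDd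
  have hsplit : F ⊆ ND ∪ F.filter (fun s => Disp ρ ε s) := by
    intro s hs
    have hs' := (Finset.mem_filter.1 hs).2
    by_cases hd : Disp ρ ε s
    · exact Finset.mem_union_right _ (Finset.mem_filter.2 ⟨hs, hd⟩)
    · exact Finset.mem_union_left _ (Finset.mem_filter.2 ⟨Finset.mem_univ _, hs'.1, hd⟩)
  have hD := disp_part A (F.filter (fun s => Disp ρ ε s)) (by
    intro s hs
    obtain ⟨hs1, hd⟩ := Finset.mem_filter.1 hs
    obtain ⟨hS, hf⟩ := (Finset.mem_filter.1 hs1).2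
    have hpos : 0 < ρ * εb ^ 2 := by positivity
    obtain ⟨f, hf0, hfx⟩ := disp_struct hε he1 hρ he2 he3 (by linarith) he5 (by linarith) (by omega) s hS hd
    exact ⟨f, hf0, Finset.mem_filter.2 ⟨Finset.mem_univ _, sw_IsS f s hS, hfx, hf f hf0⟩⟩)
  have hcard : (F.card : ℝ) ≤ ND.card + (F.filter (fun s => Disp ρ ε s)).card := by
    exact_mod_cast (Finset.card_le_card hsplit).trans (Finset.card_union_le _ _)
  refine hcard.trans_lt ?_
  rw [rhs_eq n h4]
  apply two_exp
  · refine h1.trans (Real.rpow_le_rpow_of_exponent_le (by norm_num) ?_)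
    nlinarith
  · refine hD.trans ?_
    rw [Tp_eq n (by omega)] at hA
    have a1 : (3 : ℝ) ^ n ≤ (2 : ℝ) ^ (2 * (n : ℝ)) := by
      rw [Real.rpow_mul (by norm_num), Real.rpow_natCast]
      exact pow_le_pow_left₀ (by norm_num) (by norm_num) _
    have a2 : (((n + 1) * 2 : ℕ) : ℝ) ≤ (2 : ℝ) ^ (2 + l) := by
      rw [Real.rpow_add (by norm_num), hldef, Real.rpow_logb (by norm_num) (by norm_num) (by linarith)]
      push_cast; norm_num; linarith
    calc (3 : ℝ) ^ n * A.card ≤ (2 : ℝ) ^ (2 * (n : ℝ)) * ((2 : ℝ) ^ (2 + l) * (2 : ℝ) ^ ((n : ℝ) ^ 2 / 2 - n / 2 - 8 * n * l)) := by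
          refine mul_le_mul a1 (hA.trans ?_) (by positivity) (by positivity)
          exact mul_le_mul_of_nonneg_right a2 (by positivity)
      _ = (2 : ℝ) ^ (2 * (n : ℝ) + ((2 + l) + ((n : ℝ) ^ 2 / 2 - n / 2 - 8 * n * l))) := by
          rw [Real.rpow_add (x := 2) (by norm_num) (2 * (n : ℝ)), Real.rpow_add (x := 2) (by norm_num) (2 + l)]
      _ ≤ _ := by
          apply Real.rpow_le_rpow_of_exponent_le (by norm_num)
          nlinarith [mul_nonneg (sub_nonneg.2 hn2) (sub_nonneg.2 hl1)]

/-- Lemma 3.9: there is a constant `C' > 0` such that for large `n`, the number of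
OBTF graphs with `γ(G) > C'√n (log₂ n)^{3/2}` is less than `n^{-3n} b(n)`. -/
theorem gamma_large_count :
    ∃ C' : ℝ, 0 < C' ∧ ∃ N : ℕ, ∀ n : ℕ, N ≤ n →
      ({G ∈ obtfSet n |
          C' * Real.sqrt n * Real.logb 2 n ^ ((3 : ℝ) / 2) < (gamma G : ℝ)}.ncard : ℝ) <
        (n : ℝ) ^ (-(3 * (n : ℝ))) * bnum n := by
  exact final_count
end
end

section
/- Let A > 0, β > 0 and C'' be constants with C'' < A² − β·log 3 (log base 2). For n ≥ 1, let 𝓨(n) be the set of G ∈ 𝓕(n) for which there exists K ⊆ [n] with |K| ≤ β·log n such that G−K is blue-bipartite and there exist disjoint S, T ⊆ [n]∖K, each of size ⌈A·√(n·log n)⌉, with no edge of G between S and T. Then for all sufficiently large n, |𝓨(n)| < 2^{C(n,2) − C''·n·log n}, where C(n,2)=n(n−1)/2. -/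
open Filter

noncomputable section

open scoped Classical in
/-- Status of a pair: `0` non-edge, `1` red, `2` blue. -/
def pcStatus {n : ℕ} (G : ColoredGraph n) (e : Sym2 (Fin n)) : Fin 3 :=
  if e ∈ G.red.edgeSet then 1 else if e ∈ G.blue.edgeSet then 2 else 0

lemma pcStatus_red {n : ℕ} (G : ColoredGraph n) (x y : Fin n) :
    pcStatus G s(x, y) = 1 ↔ G.red.Adj x y := by
  unfold pcStatus
  split_ifs <;> simp_all [SimpleGraph.mem_edgeSet]

lemma pcStatus_blue {n : ℕ} (G : ColoredGraph n) (x y : Fin n) :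
    pcStatus G s(x, y) = 2 ↔ G.blue.Adj x y := by
  have := G.disj x y
  unfold pcStatus
  split_ifs <;> simp_all [SimpleGraph.mem_edgeSet]

lemma pcStatus_zero {n : ℕ} (G : ColoredGraph n) (x y : Fin n) (h : ¬ G.Adj x y) :
    pcStatus G s(x, y) = 0 := by
  have h' : ¬ G.red.Adj x y ∧ ¬ G.blue.Adj x y := by
    simpa [ColoredGraph.Adj, ColoredGraph.graph] using h
  unfold pcStatus
  simp [h'.1, h'.2]

lemma pcStatus_injective {n : ℕ} : Function.Injective (pcStatus (n := n)) := by
  intro G H h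
  have hr : G.red = H.red := by
    ext x y
    rw [← pcStatus_red, ← pcStatus_red, h]
  have hb : G.blue = H.blue := by
    ext x y
    rw [← pcStatus_blue, ← pcStatus_blue, h]
  cases G; cases H; simp_all

/-- Pairs meeting `K`. -/
def pcTouch {n : ℕ} (K : Finset (Fin n)) : Finset (Sym2 (Fin n)) :=
  (K ×ˢ (Finset.univ : Finset (Fin n))).image (fun p => s(p.1, p.2))

/-- Pairs between `S` and `T`. -/
def pcCross {n : ℕ} (S T : Finset (Fin n)) : Finset (Sym2 (Fin n)) :=
  (S ×ˢ T).image (fun p => s(p.1, p.2))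

/-- Pairs of distinct vertices not between `S` and `T`. -/
def pcRest {n : ℕ} (S T : Finset (Fin n)) : Finset (Sym2 (Fin n)) :=
  (Finset.univ.filter (fun e => ¬ e.IsDiag)) \ pcCross S T

lemma pcTouch_card {n : ℕ} (K : Finset (Fin n)) : (pcTouch K).card ≤ K.card * n := by
  refine Finset.card_image_le.trans ?_
  simp

lemma pcRest_card {n : ℕ} (S T : Finset (Fin n)) (h : Disjoint S T) :
    (pcRest S T).card + S.card * T.card = n * (n - 1) / 2 := by
  have h1 : (pcCross S T).card = S.card * T.card := by
    unfold pcCross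
    rw [Finset.card_image_of_injOn, Finset.card_product]
    rintro ⟨a, b⟩ hab ⟨c, d⟩ hcd he
    simp only [Finset.coe_product, Set.mem_prod, Finset.mem_coe] at hab hcd
    simp only [Sym2.eq_iff] at he
    rcases he with ⟨rfl, rfl⟩ | ⟨rfl, rfl⟩
    · rfl
    · exact absurd hcd.2 (Finset.disjoint_left.1 h hab.1)
  have h2 : pcCross S T ⊆ Finset.univ.filter (fun e : Sym2 (Fin n) => ¬ e.IsDiag) := by
    intro e he
    simp only [pcCross, Finset.mem_image, Finset.mem_product] at he
    obtain ⟨⟨a, b⟩, ⟨ha, hb⟩, rfl⟩ := he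
    simp only [Finset.mem_filter, Finset.mem_univ, true_and, Sym2.mk_isDiag_iff]
    rintro rfl
    exact Finset.disjoint_left.1 h ha hb
  have h3 : (Finset.univ.filter (fun e : Sym2 (Fin n) => ¬ e.IsDiag)).card
      = n * (n - 1) / 2 := by
    rw [← Nat.choose_two_right, ← Fintype.card_subtype, Sym2.card_subtype_not_diag,
      Fintype.card_fin]
  rw [← h1, ← h3]
  exact Finset.card_sdiff_add_card_eq_card h2

open scoped Classical in
/-- Allowed statuses of a pair, given the data `K, U, S, T`. -/
def pcAllowed {n : ℕ} (K U S T : Finset (Fin n)) (e : Sym2 (Fin n)) : Finset (Fin 3) :=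
  Finset.univ.filter (fun c => (e ∉ pcRest S T → c = 0) ∧
    (e ∉ pcTouch K → ∀ x y, e = s(x, y) →
      (c = 2 → (x ∈ U ↔ y ∉ U)) ∧ (c = 1 → (x ∈ U ↔ y ∈ U))))

lemma pcAllowed_card {n : ℕ} (K U S T : Finset (Fin n)) (e : Sym2 (Fin n)) :
    (pcAllowed K U S T e).card ≤
      (if e ∈ pcTouch K then 3 else 1) * (if e ∈ pcRest S T then 2 else 1) := by
  by_cases hR : e ∈ pcRest S T
  · by_cases hK : e ∈ pcTouch K
    · have : (pcAllowed K U S T e).card ≤ 3 := by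
        simpa using Finset.card_le_univ (pcAllowed K U S T e)
      simp only [hR, hK, if_true]
      omega
    · simp only [hR, hK, if_true, if_false, one_mul]
      induction e using Sym2.ind with
      | _ x y =>
        by_cases hxy : (x ∈ U ↔ y ∈ U)
        · have : pcAllowed K U S T s(x, y) ⊆ {0, 1} := by
            intro c hc
            simp only [pcAllowed, Finset.mem_filter] at hc
            have h2 := (hc.2.2 hK x y rfl).1
            have : c ≠ 2 := fun h => by have := h2 h; tauto
            fin_cases c <;> simp_all
          exact (Finset.card_le_card this).trans (by simp)
        · have : pcAllowed K U S T s(x, y) ⊆ {0, 2} := by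
            intro c hc
            simp only [pcAllowed, Finset.mem_filter] at hc
            have h2 := (hc.2.2 hK x y rfl).2
            have : c ≠ 1 := fun h => hxy (h2 h)
            fin_cases c <;> simp_all
          exact (Finset.card_le_card this).trans (by simp)
  · have : pcAllowed K U S T e ⊆ {0} := by
      intro c hc
      simp only [pcAllowed, Finset.mem_filter] at hc
      simpa using hc.2.1 hR
    have h1 := Finset.card_le_card this
    simp only [Finset.card_singleton] at h1
    simp only [hR, if_false, mul_one]
    split_ifs <;> omega

lemma pcFamily_card {n : ℕ} (K U S T : Finset (Fin n)) :
    (Fintype.piFinset (pcAllowed K U S T)).card ≤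
      3 ^ (pcTouch K).card * 2 ^ (pcRest S T).card := by
  rw [Fintype.card_piFinset]
  refine (Finset.prod_le_prod' fun e _ => pcAllowed_card K U S T e).trans ?_
  rw [Finset.prod_mul_distrib, Finset.prod_ite, Finset.prod_ite]
  simp

open scoped Classical in
/-- Finite counting bound. -/
lemma pc_count (n k s : ℕ) :
    ({G ∈ obtfSet n | ∃ K : Set (Fin n),
          K.ncard ≤ k ∧ G.BlueBipartiteOn Kᶜ ∧
          ∃ S T : Set (Fin n), S ⊆ Kᶜ ∧ T ⊆ Kᶜ ∧ Disjoint S T ∧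
            S.ncard = s ∧ T.ncard = s ∧
            ∀ x ∈ S, ∀ y ∈ T, ¬ G.Adj x y}.ncard) * 2 ^ (s * s) ≤
      2 ^ (4 * n) * (3 ^ (k * n) * 2 ^ (n * (n - 1) / 2)) := by
  set Y := {G ∈ obtfSet n | ∃ K : Set (Fin n),
          K.ncard ≤ k ∧ G.BlueBipartiteOn Kᶜ ∧
          ∃ S T : Set (Fin n), S ⊆ Kᶜ ∧ T ⊆ Kᶜ ∧ Disjoint S T ∧
            S.ncard = s ∧ T.ncard = s ∧
            ∀ x ∈ S, ∀ y ∈ T, ¬ G.Adj x y} with hY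
  let F := Finset (Fin n)
  let Q : Finset (F × F × F × F) := Finset.univ.filter (fun q =>
    q.1.card ≤ k ∧ Disjoint q.2.2.1 q.2.2.2 ∧ q.2.2.1.card = s ∧ q.2.2.2.card = s)
  let B : F × F × F × F → Finset (Sym2 (Fin n) → Fin 3) := fun q =>
    Fintype.piFinset (pcAllowed q.1 q.2.1 q.2.2.1 q.2.2.2)
  have hsub : pcStatus '' Y ⊆ ((Q.biUnion B : Finset _) : Set (Sym2 (Fin n) → Fin 3)) := by
    rintro _ ⟨G, ⟨-, K, hK, ⟨U, -, hUU⟩, S, T, -, -, hST, hS, hT, hno⟩, rfl⟩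
    simp only [Finset.coe_biUnion, Set.mem_iUnion, Finset.mem_coe]
    refine ⟨(K.toFinset, U.toFinset, S.toFinset, T.toFinset), ?_, ?_⟩
    · simp only [Q, Finset.mem_filter, Finset.mem_univ, true_and]
      rw [Set.ncard_eq_toFinset_card'] at hK hS hT
      exact ⟨hK, Set.disjoint_toFinset.2 hST, hS, hT⟩
    · simp only [B, Fintype.mem_piFinset, pcAllowed, Finset.mem_filter, Finset.mem_univ, true_and]
      intro e
      refine ⟨?_, ?_⟩
      · intro he
        induction e using Sym2.ind with
        | _ x y =>
          apply pcStatus_zero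
          simp only [pcRest, Finset.mem_sdiff, Finset.mem_filter, Finset.mem_univ, true_and,
            not_and, not_not, Sym2.mk_isDiag_iff] at he
          by_cases hxy : x = y
          · subst hxy
            exact G.graph.loopless.irrefl x
          · have := he hxy
            simp only [pcCross, Finset.mem_image, Finset.mem_product, Set.mem_toFinset] at this
            obtain ⟨⟨a, b⟩, ⟨ha, hb⟩, hab⟩ := this
            rcases Sym2.eq_iff.1 hab with ⟨rfl, rfl⟩ | ⟨rfl, rfl⟩
            · exact hno _ ha _ hb
            · exact fun h => hno _ ha _ hb (SimpleGraph.Adj.symm h)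
      · rintro he x y rfl
        have hx : x ∈ Kᶜ := by
          intro hx
          apply he
          simp only [pcTouch, Finset.mem_image, Finset.mem_product, Set.mem_toFinset]
          exact ⟨(x, y), ⟨hx, Finset.mem_univ _⟩, rfl⟩
        have hy : y ∈ Kᶜ := by
          intro hy
          apply he
          simp only [pcTouch, Finset.mem_image, Finset.mem_product, Set.mem_toFinset]
          exact ⟨(y, x), ⟨hy, Finset.mem_univ _⟩, Sym2.eq_swap⟩
        rw [pcStatus_red, pcStatus_blue]
        simpa only [Set.mem_toFinset] using hUU x hx y hy
  have h1 : Y.ncard ≤ (Q.biUnion B).card := by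
    rw [← Set.ncard_image_of_injective Y pcStatus_injective, ← Set.ncard_coe_finset]
    exact Set.ncard_le_ncard hsub (Finset.finite_toSet _)
  have h2 : (Q.biUnion B).card * 2 ^ (s * s) ≤
      ∑ q ∈ Q, 3 ^ (k * n) * 2 ^ (n * (n - 1) / 2) := by
    refine (Nat.mul_le_mul_right _ Finset.card_biUnion_le).trans ?_
    rw [Finset.sum_mul]
    refine Finset.sum_le_sum fun q hq => ?_
    simp only [Q, Finset.mem_filter, Finset.mem_univ, true_and] at hq
    obtain ⟨hk, hd, hS, hT⟩ := hq
    have hr := pcRest_card q.2.2.1 q.2.2.2 hd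
    rw [hS, hT] at hr
    rw [← hr, pow_add, ← mul_assoc]
    refine Nat.mul_le_mul_right _ ((pcFamily_card _ _ _ _).trans ?_)
    refine Nat.mul_le_mul_right _ (Nat.pow_le_pow_right (by norm_num) ?_)
    exact (pcTouch_card _).trans (Nat.mul_le_mul_right _ hk)
  have h3 : Q.card ≤ 2 ^ (4 * n) := by
    refine (Finset.card_le_univ Q).trans ?_
    simp only [F, Fintype.card_prod, Fintype.card_finset, Fintype.card_fin]
    rw [← pow_add, ← pow_add, ← pow_add]
    exact Nat.pow_le_pow_right (by norm_num) (by omega)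
  rw [Finset.sum_const, smul_eq_mul] at h2
  exact (Nat.mul_le_mul_right _ h1).trans (h2.trans (Nat.mul_le_mul_right _ h3))

/-- Equation (3.11): if `A, β > 0` and `C'' < A² - β log₂ 3`, then for large `n` the
number of OBTF graphs `G` admitting `K ⊆ [n]` with `|K| ≤ β log₂ n`, `G - K`
blue-bipartite, and disjoint `S, T ⊆ [n] ∖ K` of size `⌈A √(n log₂ n)⌉` with no edge
of `G` between `S` and `T`, is less than `2^{C(n,2) - C'' n log₂ n}`. -/
theorem pathological_count (A β C'' : ℝ) (hA : 0 < A) (hβ : 0 < β)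
    (hC : C'' < A ^ 2 - β * Real.logb 2 3) :
    ∃ N : ℕ, ∀ n : ℕ, N ≤ n →
      ({G ∈ obtfSet n | ∃ K : Set (Fin n),
          (K.ncard : ℝ) ≤ β * Real.logb 2 n ∧ G.BlueBipartiteOn Kᶜ ∧
          ∃ S T : Set (Fin n), S ⊆ Kᶜ ∧ T ⊆ Kᶜ ∧ Disjoint S T ∧
            S.ncard = ⌈A * Real.sqrt (n * Real.logb 2 n)⌉₊ ∧
            T.ncard = ⌈A * Real.sqrt (n * Real.logb 2 n)⌉₊ ∧
            ∀ x ∈ S, ∀ y ∈ T, ¬ G.Adj x y}.ncard : ℝ) <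
        (2 : ℝ) ^ (((n * (n - 1) / 2 : ℕ) : ℝ) - C'' * n * Real.logb 2 n) := by
  have hlog : Tendsto (fun n : ℕ => Real.logb 2 (n : ℝ)) atTop atTop :=
    (Real.tendsto_logb_atTop (by norm_num)).comp tendsto_natCast_atTop_atTop
  have hδ : 0 < A ^ 2 - β * Real.logb 2 3 - C'' := by linarith
  obtain ⟨N, hN⟩ := eventually_atTop.1
    (hlog.eventually_gt_atTop (4 / (A ^ 2 - β * Real.logb 2 3 - C'')))
  refine ⟨max N 1, fun n hn => ?_⟩
  have hn1 : 1 ≤ n := le_trans (le_max_right _ _) hn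
  have hnN := hN n (le_trans (le_max_left _ _) hn)
  rw [div_lt_iff₀ hδ] at hnN
  have hn0 : (0 : ℝ) < n := by exact_mod_cast hn1
  have hL : 0 ≤ Real.logb 2 n := Real.logb_nonneg (by norm_num) (by exact_mod_cast hn1)
  set L := Real.logb 2 n with hLdef
  set s := ⌈A * Real.sqrt (n * L)⌉₊ with hs
  have hc := pc_count n ⌊β * L⌋₊ s
  simp only [Nat.le_floor_iff (mul_nonneg hβ.le hL)] at hc
  set Y := {G ∈ obtfSet n | ∃ K : Set (Fin n),
          (K.ncard : ℝ) ≤ β * L ∧ G.BlueBipartiteOn Kᶜ ∧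
          ∃ S T : Set (Fin n), S ⊆ Kᶜ ∧ T ⊆ Kᶜ ∧ Disjoint S T ∧
            S.ncard = s ∧ T.ncard = s ∧
            ∀ x ∈ S, ∀ y ∈ T, ¬ G.Adj x y} with hY
  have hcR : (Y.ncard : ℝ) * 2 ^ (s * s) ≤
      2 ^ (4 * n) * (3 ^ (⌊β * L⌋₊ * n) * 2 ^ (n * (n - 1) / 2)) := by exact_mod_cast hc
  generalize n * (n - 1) / 2 = m at hcR ⊢
  have hs2 : A ^ 2 * (n * L) ≤ (s : ℝ) * s := by
    have h1 : A * Real.sqrt (n * L) ≤ s := Nat.le_ceil _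
    have h0 : 0 ≤ A * Real.sqrt (n * L) := by positivity
    have h2 := mul_self_le_mul_self h0 h1
    have h3 := Real.mul_self_sqrt (show 0 ≤ n * L by positivity)
    calc A ^ 2 * (n * L) = (A * Real.sqrt (n * L)) * (A * Real.sqrt (n * L)) := by
          rw [← h3]; ring_nf; rw [Real.sqrt_sq (Real.sqrt_nonneg _)]
      _ ≤ _ := h2
  have hfl : (⌊β * L⌋₊ : ℝ) ≤ β * L := Nat.floor_le (mul_nonneg hβ.le hL)
  have hl3 : 0 ≤ Real.logb 2 3 := Real.logb_nonneg (by norm_num) (by norm_num)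
  have h3 : (3 : ℝ) = 2 ^ Real.logb 2 3 :=
    (Real.rpow_logb (by norm_num) (by norm_num) (by norm_num)).symm
  have h3p : (3 : ℝ) ^ (⌊β * L⌋₊ * n) = 2 ^ (Real.logb 2 3 * (⌊β * L⌋₊ * n : ℝ)) := by
    rw [Real.rpow_mul (by norm_num), ← h3, ← Nat.cast_mul, Real.rpow_natCast]
  rw [h3p, ← Real.rpow_natCast 2 (s * s), ← Real.rpow_natCast 2 (4 * n),
    ← Real.rpow_natCast 2 m, ← Real.rpow_add (by norm_num), ← Real.rpow_add (by norm_num),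
    ← le_div_iff₀ (by positivity), ← Real.rpow_sub (by norm_num)] at hcR
  refine hcR.trans_lt (Real.rpow_lt_rpow_of_exponent_lt (by norm_num) ?_)
  push_cast
  have e1 : Real.logb 2 3 * (⌊β * L⌋₊ * n : ℝ) ≤ Real.logb 2 3 * (β * L * n) := by gcongr
  have e2 := mul_lt_mul_of_pos_right hnN hn0
  nlinarith
end
end

section
/- For every G ∈ 𝓕(n), |𝓟(G)| ≤ 2^{η(G)}, where η(G) is the number of triangle-components of G. -/
open Filter

noncomputable section

/-- The type of `2n` literals: `(i, false)` is `xᵢ` and `(i, true)` is `x̄ᵢ`. -/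
abbrev Lit (n : ℕ) := Fin n × Bool

/-- Negation of a literal. -/
def Lit.bar {n : ℕ} (u : Lit n) : Lit n := (u.1, !u.2)

/-- `𝓟(n)`: partial orders on the `2n` literals in which `xᵢ` and `x̄ᵢ` are
incomparable for every `i`, and `u ≤ v` iff `v̄ ≤ ū`. -/
def LitPoset (n : ℕ) : Type :=
  {r : Lit n → Lit n → Prop //
    IsPartialOrder (Lit n) r ∧ (∀ (i : Fin n) (b : Bool), ¬ r (i, b) (i, !b)) ∧
    ∀ u v : Lit n, r u v ↔ r v.bar u.bar}

/-- The covering relation `u ⋖ v` of a partial order `r`. -/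
def Covers {n : ℕ} (r : Lit n → Lit n → Prop) (u v : Lit n) : Prop :=
  u ≠ v ∧ r u v ∧ ∀ z : Lit n, r u z → r z v → z = u ∨ z = v

/-- `G` is the colored graph `G(P)` of the poset `P`: red edges `ij` come from covers
`xᵢ ⋖ x̄ⱼ` or `x̄ᵢ ⋖ xⱼ`, and blue edges `ij` from covers `xᵢ ⋖ xⱼ` or `x̄ᵢ ⋖ x̄ⱼ`. -/
def GraphOf {n : ℕ} (P : LitPoset n) (G : ColoredGraph n) : Prop :=
  ∀ i j : Fin n,
    (G.red.Adj i j ↔ i ≠ j ∧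
      (Covers P.1 (i, false) (j, true) ∨ Covers P.1 (i, true) (j, false))) ∧
    (G.blue.Adj i j ↔ i ≠ j ∧
      (Covers P.1 (i, false) (j, false) ∨ Covers P.1 (i, true) (j, true)))

/-- `𝓟(G) = {P ∈ 𝓟(n) : G(P) = G}`. -/
def PsetOf {n : ℕ} (G : ColoredGraph n) : Set (LitPoset n) := {P | GraphOf P G}

/-- `T = (a, b, c)` is a triangle of `G`. -/
def IsTri {n : ℕ} (G : ColoredGraph n) (T : Fin n × Fin n × Fin n) : Prop :=
  G.Adj T.1 T.2.1 ∧ G.Adj T.2.1 T.2.2 ∧ G.Adj T.1 T.2.2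

/-- `e` is an edge of the triangle `T`. -/
def EdgeOf {n : ℕ} (e : Sym2 (Fin n)) (T : Fin n × Fin n × Fin n) : Prop :=
  e = s(T.1, T.2.1) ∨ e = s(T.2.1, T.2.2) ∨ e = s(T.1, T.2.2)

/-- Edges `e, f` are triangle-equivalent: `e = f` or there is a sequence
`T₀, …, T_l` of triangles with `e` an edge of `T₀`, `f` an edge of `T_l`, and
consecutive triangles sharing an edge. -/
def TriEquiv {n : ℕ} (G : ColoredGraph n) (e f : Sym2 (Fin n)) : Prop :=
  e = f ∨ ∃ (l : ℕ) (T : ℕ → Fin n × Fin n × Fin n),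
    (∀ i ≤ l, IsTri G (T i)) ∧ EdgeOf e (T 0) ∧ EdgeOf f (T l) ∧
    ∀ i < l, ∃ g : Sym2 (Fin n), EdgeOf g (T i) ∧ EdgeOf g (T (i + 1))

/-- `η(G)`: the number of triangle-components of `G`, i.e. of classes of edges under
triangle-equivalence. -/
def eta {n : ℕ} (G : ColoredGraph n) : ℕ :=
  Nat.card (Quot (fun e f : G.graph.edgeSet => TriEquiv G e.1 f.1))

/-- `G` is triangle-connected: all pairs of its edges are triangle-equivalent. -/
def TriConnected {n : ℕ} (G : ColoredGraph n) : Prop :=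
  ∀ e ∈ G.graph.edgeSet, ∀ f ∈ G.graph.edgeSet, TriEquiv G e f

section Helpers

variable {n : ℕ}

/-- The color of an edge as a Boolean. -/
def colB (G : ColoredGraph n) (i j : Fin n) : Bool := by
  classical exact decide (G.blue.Adj i j)

lemma colB_comm (G : ColoredGraph n) (i j : Fin n) : colB G i j = colB G j i := by
  simp [colB, G.blue.adj_comm]

lemma lp_trans (P : LitPoset n) {u v w : Lit n} (h : P.1 u v) (h' : P.1 v w) : P.1 u w :=
  P.2.1.trans _ _ _ h h'

lemma lp_bar (P : LitPoset n) {i j : Fin n} {a b : Bool} (h : P.1 (i, a) (j, b)) :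
    P.1 (j, !b) (i, !a) := (P.2.2.2 _ _).1 h

lemma lp_irr (P : LitPoset n) {i : Fin n} {a : Bool} (h : P.1 (i, a) (i, !a)) : False :=
  P.2.2.1 i a h

lemma lp_irr' (P : LitPoset n) {i : Fin n} {a : Bool} (h : P.1 (i, !a) (i, a)) : False :=
  P.2.2.1 i (!a) (by simpa using h)

lemma cov_bar (P : LitPoset n) {i j : Fin n} {a b : Bool} (h : Covers P.1 (i, a) (j, b)) :
    Covers P.1 (j, !b) (i, !a) := by
  obtain ⟨h1, h2, h3⟩ := h
  refine ⟨?_, lp_bar P h2, ?_⟩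
  · intro h
    apply h1
    simp only [Prod.mk.injEq, Bool.not_eq_not] at h
    simp at h ⊢
    exact ⟨h.1.symm, by simp [h.2]⟩
  · rintro ⟨k, c⟩ hz hz'
    have e1 := lp_bar P hz
    have e2 := lp_bar P hz'
    simp only [Bool.not_not] at e1 e2
    rcases h3 _ e2 e1 with h | h
    · right
      simp only [Prod.mk.injEq] at h ⊢
      exact ⟨h.1, by rw [← h.2]; simp⟩
    · left
      simp only [Prod.mk.injEq] at h ⊢
      exact ⟨h.1, by rw [← h.2]; simp⟩

/-- Uniqueness of the orientation of a pair. -/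
lemma lp_unique (P : LitPoset n) {i j : Fin n} (hij : i ≠ j) {a b a' b' : Bool}
    (h : P.1 (i, a) (j, b)) (h' : P.1 (i, a') (j, b')) : a = a' ∧ b = b' := by
  by_cases ha : a = a'
  · subst ha
    refine ⟨rfl, ?_⟩
    by_contra hb
    have hb : b' = !b := by cases b <;> cases b' <;> simp_all
    subst hb
    have := lp_bar P h'
    rw [Bool.not_not] at this
    exact lp_irr P (lp_trans P h this)
  · exfalso
    have ha : a' = !a := by cases a <;> cases a' <;> simp_all
    subst ha
    have h2 := lp_bar P h'
    rw [Bool.not_not] at h2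
    by_cases hb : b = b'
    · subst hb
      exact lp_irr' P (lp_trans P h2 h)
    · have hb : b' = !b := by cases b <;> cases b' <;> simp_all
      subst hb
      rw [Bool.not_not] at h2
      have := P.2.1.antisymm _ _ h h2
      exact hij (congrArg Prod.fst this)

lemma adj_ne' {G : ColoredGraph n} {i j : Fin n} (h : G.Adj i j) : i ≠ j :=
  SimpleGraph.Adj.ne h

lemma adj_symm' {G : ColoredGraph n} {i j : Fin n} (h : G.Adj i j) : G.Adj j i :=
  SimpleGraph.Adj.symm h

lemma edge_ori {G : ColoredGraph n} {P : LitPoset n} (hP : GraphOf P G) {i j : Fin n}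
    (h : G.Adj i j) : ∃ a, Covers P.1 (i, a) (j, !(a ^^ colB G i j)) := by
  obtain ⟨hr, hb⟩ := hP i j
  rcases h with h | h
  · have hnb : ¬ G.blue.Adj i j := fun h' => G.disj i j ⟨h, h'⟩
    rcases (hr.1 h).2 with h | h
    · exact ⟨false, by simpa [colB, hnb] using h⟩
    · exact ⟨true, by simpa [colB, hnb] using h⟩
  · have hb' := h
    rcases (hb.1 h).2 with h | h
    · exact ⟨false, by simpa [colB, hb'] using h⟩
    · exact ⟨true, by simpa [colB, hb'] using h⟩

lemma cov_adj {G : ColoredGraph n} {P : LitPoset n} (hP : GraphOf P G) {i j : Fin n}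
    {a b : Bool} (h : Covers P.1 (i, a) (j, b)) : G.Adj i j := by
  have hij : i ≠ j := by
    rintro rfl
    by_cases hab : a = b
    · subst hab; exact h.1 rfl
    · have hb : b = !a := by cases a <;> cases b <;> simp_all
      subst hb
      exact lp_irr P h.2.1
  obtain ⟨hr, hb⟩ := hP i j
  cases a <;> cases b
  · exact Or.inr (hb.2 ⟨hij, Or.inl h⟩)
  · exact Or.inl (hr.2 ⟨hij, Or.inl h⟩)
  · exact Or.inl (hr.2 ⟨hij, Or.inr h⟩)
  · exact Or.inr (hb.2 ⟨hij, Or.inr h⟩)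

lemma obtf_xor {G : ColoredGraph n} (hG : G.OBTF) {i j k : Fin n}
    (h1 : G.Adj i j) (h2 : G.Adj j k) (h3 : G.Adj i k) :
    colB G i k = (colB G i j ^^ colB G j k) := by
  have := hG i j k h1 h2 h3
  by_cases e1 : G.blue.Adj i j <;> by_cases e2 : G.blue.Adj j k <;>
    by_cases e3 : G.blue.Adj i k <;>
    simp_all [ColoredGraph.blueInd, colB, Nat.odd_iff]

lemma tri_ori {G : ColoredGraph n} (hG : G.OBTF) (P : LitPoset n) {i j k : Fin n}
    (h1 : G.Adj i j) (h2 : G.Adj j k) (h3 : G.Adj i k) (hP : GraphOf P G)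
    {a a' : Bool}
    (c1 : Covers P.1 (i, a) (j, !(a ^^ colB G i j)))
    (c2 : Covers P.1 (i, a') (k, !(a' ^^ colB G i k))) : a = a' := by
  by_contra hne
  have ha : a' = !a := by cases a <;> cases a' <;> simp_all
  subst ha
  have r1 := c1.2.1
  have r2 := lp_bar P c2.2.1
  rw [Bool.not_not, Bool.not_not] at r2
  -- the path from `k` to `j` through `i`
  have r3 := lp_trans P r2 r1
  obtain ⟨c, hc⟩ := edge_ori hP (adj_symm' h2)
  obtain ⟨e1, e2⟩ := lp_unique P (adj_ne' h2).symm r3 hc.2.1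
  rw [obtf_xor hG h1 h2 h3] at e1
  rw [colB_comm G k j] at e2
  revert e1 e2
  cases a <;> cases c <;> cases colB G i j <;> cases colB G j k <;> simp

/-- Two posets orient the edge `ij` the same way. -/
def Agr (G : ColoredGraph n) (P Q : LitPoset n) (i j : Fin n) : Prop :=
  ∃ a, Covers P.1 (i, a) (j, !(a ^^ colB G i j)) ∧ Covers Q.1 (i, a) (j, !(a ^^ colB G i j))

lemma Agr.symm {G : ColoredGraph n} {P Q : LitPoset n} {i j : Fin n} (h : Agr G P Q i j) :
    Agr G P Q j i := by
  obtain ⟨a, h1, h2⟩ := h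
  refine ⟨a ^^ colB G i j, ?_, ?_⟩
  · have := cov_bar P h1
    simpa [colB_comm G j i] using this
  · have := cov_bar Q h2
    simpa [colB_comm G j i] using this

lemma Agr.tri {G : ColoredGraph n} (hG : G.OBTF) {P Q : LitPoset n} (hP : GraphOf P G)
    (hQ : GraphOf Q G) {i j k : Fin n}
    (h1 : G.Adj i j) (h2 : G.Adj j k) (h3 : G.Adj i k) (h : Agr G P Q i j) :
    Agr G P Q i k := by
  obtain ⟨a, hp, hq⟩ := h
  obtain ⟨b, hb⟩ := edge_ori hP h3
  obtain ⟨c, hc⟩ := edge_ori hQ h3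
  have e1 := tri_ori hG P h1 h2 h3 hP hp hb
  have e2 := tri_ori hG Q h1 h2 h3 hQ hq hc
  subst e1; subst e2
  exact ⟨a, hb, hc⟩

/-- Agreement on an unordered pair. -/
def AgrE (G : ColoredGraph n) (P Q : LitPoset n) (e : Sym2 (Fin n)) : Prop :=
  ∀ i j, e = s(i, j) → Agr G P Q i j

lemma agrE_iff {G : ColoredGraph n} {P Q : LitPoset n} {i j : Fin n} :
    AgrE G P Q s(i, j) ↔ Agr G P Q i j := by
  refine ⟨fun h => h i j rfl, fun h k l hkl => ?_⟩
  rcases Sym2.eq_iff.1 hkl with ⟨rfl, rfl⟩ | ⟨rfl, rfl⟩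
  · exact h
  · exact h.symm

lemma AgrE.tri {G : ColoredGraph n} (hG : G.OBTF) {P Q : LitPoset n} (hP : GraphOf P G)
    (hQ : GraphOf Q G) {T : Fin n × Fin n × Fin n} (hT : IsTri G T) {e f : Sym2 (Fin n)}
    (he : EdgeOf e T) (hf : EdgeOf f T) (h : AgrE G P Q e) : AgrE G P Q f := by
  obtain ⟨i, j, k⟩ := T
  obtain ⟨h1, h2, h3⟩ := hT
  simp only at h1 h2 h3
  have key : Agr G P Q i j ∧ Agr G P Q i k ∧ Agr G P Q j k := by
    rcases he with rfl | rfl | rfl <;> rw [agrE_iff] at h <;> simp only at h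
    · exact ⟨h, h.tri hG hP hQ h1 h2 h3, h.symm.tri hG hP hQ (adj_symm' h1) h3 h2⟩
    · have hj : Agr G P Q j i := h.tri hG hP hQ h2 (adj_symm' h3) (adj_symm' h1)
      exact ⟨hj.symm, hj.symm.tri hG hP hQ h1 h2 h3, h⟩
    · have hj : Agr G P Q i j := h.tri hG hP hQ h3 (adj_symm' h2) h1
      exact ⟨hj, h, hj.symm.tri hG hP hQ (adj_symm' h1) h3 h2⟩
  rcases hf with rfl | rfl | rfl <;> rw [agrE_iff]
  · exact key.1
  · exact key.2.2
  · exact key.2.1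

lemma AgrE.equiv {G : ColoredGraph n} (hG : G.OBTF) {P Q : LitPoset n} (hP : GraphOf P G)
    (hQ : GraphOf Q G) {e f : Sym2 (Fin n)} (hef : TriEquiv G e f) :
    AgrE G P Q e ↔ AgrE G P Q f := by
  rcases hef with rfl | ⟨l, T, hT, he, hf, hs⟩
  · rfl
  · have key : ∀ m ≤ l, ∀ g, EdgeOf g (T m) → (AgrE G P Q e ↔ AgrE G P Q g) := by
      intro m
      induction m with
      | zero =>
        intro hm g hg
        exact ⟨AgrE.tri hG hP hQ (hT 0 hm) he hg, AgrE.tri hG hP hQ (hT 0 hm) hg he⟩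
      | succ m ih =>
        intro hm g hg
        obtain ⟨g', h1, h2⟩ := hs m hm
        rw [ih (by omega) g' h1]
        exact ⟨AgrE.tri hG hP hQ (hT _ hm) h2 hg, AgrE.tri hG hP hQ (hT _ hm) hg h2⟩
    exact key l le_rfl f hf

lemma rel_of_cov (P Q : LitPoset n) (h : ∀ u v, Covers P.1 u v → Q.1 u v) :
    ∀ u v, P.1 u v → Q.1 u v := by
  have key : ∀ m : ℕ, ∀ u v, P.1 u v → {z | P.1 u z ∧ P.1 z v}.ncard = m → Q.1 u v := by
    intro m
    induction m using Nat.strong_induction_on with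
    | _ m ih =>
      intro u v huv hm
      by_cases he : u = v
      · subst he; exact Q.2.1.refl _
      by_cases hc : Covers P.1 u v
      · exact h _ _ hc
      · have : ∃ z, P.1 u z ∧ P.1 z v ∧ z ≠ u ∧ z ≠ v := by
          by_contra hcon
          push Not at hcon
          refine hc ⟨he, huv, fun z h1 h2 => ?_⟩
          by_cases hz : z = u
          · exact Or.inl hz
          · exact Or.inr (hcon z h1 h2 hz)
        obtain ⟨z, h1, h2, h3, h4⟩ := this
        have l1 : {w | P.1 u w ∧ P.1 w z}.ncard < m := by
          rw [← hm]
          refine Set.ncard_lt_ncard ⟨fun w hw => ⟨hw.1, lp_trans P hw.2 h2⟩, fun hs => ?_⟩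
          have : P.1 v z := (hs (show v ∈ _ from ⟨huv, P.2.1.refl v⟩)).2
          exact h4 (P.2.1.antisymm _ _ h2 this)
        have l2 : {w | P.1 z w ∧ P.1 w v}.ncard < m := by
          rw [← hm]
          refine Set.ncard_lt_ncard ⟨fun w hw => ⟨lp_trans P h1 hw.1, hw.2⟩, fun hs => ?_⟩
          have : P.1 z u := (hs (show u ∈ _ from ⟨P.2.1.refl u, huv⟩)).1
          exact h3 (P.2.1.antisymm _ _ this h1)
        exact lp_trans Q (ih _ l1 u z h1 rfl) (ih _ l2 z v h2 rfl)
  exact fun u v huv => key _ u v huv rfl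

lemma rel_of_agr {G : ColoredGraph n} {P Q : LitPoset n} (hP : GraphOf P G)
    (h : ∀ i j, G.Adj i j → Agr G P Q i j) : ∀ u v, P.1 u v → Q.1 u v := by
  apply rel_of_cov
  rintro ⟨i, a⟩ ⟨j, b⟩ hc
  have hadj := cov_adj hP hc
  obtain ⟨a', h1, h2⟩ := h i j hadj
  obtain ⟨rfl, hb⟩ := lp_unique P (adj_ne' hadj) hc.2.1 h1.2.1
  rw [hb]
  exact h2.2.1

lemma agr_of_bit {G : ColoredGraph n} {P Q : LitPoset n} (hP : GraphOf P G)
    (hQ : GraphOf Q G) {i j : Fin n} (hij : G.Adj i j)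
    (h : (∃ b, P.1 (i, false) (j, b)) ↔ ∃ b, Q.1 (i, false) (j, b)) : Agr G P Q i j := by
  obtain ⟨a, ha⟩ := edge_ori hP hij
  obtain ⟨c, hc⟩ := edge_ori hQ hij
  have hac : a = c := by
    cases a
    · obtain ⟨b, hb⟩ := h.1 ⟨_, ha.2.1⟩
      exact (lp_unique Q (adj_ne' hij) hb hc.2.1).1
    · cases c
      · obtain ⟨b, hb⟩ := h.2 ⟨_, hc.2.1⟩
        exact (lp_unique P (adj_ne' hij) ha.2.1 hb).1
      · rfl
  subst hac
  exact ⟨a, ha, hc⟩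

end Helpers

/-- For every `G ∈ 𝓕(n)`, `|𝓟(G)| ≤ 2^{η(G)}`, with `η(G)` the number of
triangle-components of `G`. -/
theorem card_PsetOf_le_two_pow_eta {n : ℕ} (G : ColoredGraph n) (hG : G ∈ obtfSet n) :
    (PsetOf G).ncard ≤ 2 ^ eta G := by
  classical
  have hO : G.OBTF := hG
  let C := Quot (fun e f : G.graph.edgeSet => TriEquiv G e.1 f.1)
  let bit : PsetOf G → C → Bool := fun P q =>
    decide (∃ b, P.1.1 ((Quot.out q.out.1).1, false) ((Quot.out q.out.1).2, b))
  have hinj : Function.Injective bit := by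
    rintro ⟨P, hP⟩ ⟨Q, hQ⟩ hPQ
    have hP' : GraphOf P G := hP
    have hQ' : GraphOf Q G := hQ
    have hrep : ∀ q : C, AgrE G P Q q.out.1 := by
      intro q
      have hs : s((Quot.out q.out.1).1, (Quot.out q.out.1).2) = q.out.1 := Quot.out_eq q.out.1
      have hq := congrFun hPQ q
      simp only [bit, decide_eq_decide] at hq
      have hadj : G.Adj (Quot.out q.out.1).1 (Quot.out q.out.1).2 := by
        have := q.out.2
        rw [← hs, SimpleGraph.mem_edgeSet] at this
        exact this
      rw [← hs, agrE_iff]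
      exact agr_of_bit hP' hQ' hadj hq
    have hall : ∀ e : G.graph.edgeSet, AgrE G P Q e.1 := by
      intro e
      have lift : ∀ a b : G.graph.edgeSet,
          Relation.EqvGen (fun e f : G.graph.edgeSet => TriEquiv G e.1 f.1) a b →
          (AgrE G P Q a.1 ↔ AgrE G P Q b.1) := by
        intro a b h
        induction h with
        | rel _ _ h => exact AgrE.equiv hO hP' hQ' h
        | refl => rfl
        | symm _ _ _ ih => exact ih.symm
        | trans _ _ _ _ _ ih1 ih2 => exact ih1.trans ih2
      have := Quot.eqvGen_exact (Quot.out_eq (Quot.mk _ e : C))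
      exact (lift _ _ this).1 (hrep _)
    have hagr : ∀ i j, G.Adj i j → Agr G P Q i j := fun i j hij =>
      agrE_iff.1 (hall ⟨s(i, j), hij⟩)
    apply Subtype.ext
    apply Subtype.ext
    funext u v
    refine propext ⟨rel_of_agr hP' hagr u v, rel_of_agr hQ' (fun i j hij => ?_) u v⟩
    obtain ⟨a, h1, h2⟩ := hagr i j hij
    exact ⟨a, h2, h1⟩
  have hle := Nat.card_le_card_of_injective bit hinj
  rw [Nat.card_fun, Nat.card_eq_fintype_card (α := Bool), Fintype.card_bool] at hle
  exact hle
end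
end

section
/- If G ∈ 𝓑(n) is triangle-connected, then |𝓟(G)| ≤ 2. -/
open Filter

noncomputable section

namespace TriAux

variable {n : ℕ}

lemma bar_bar (u : Lit n) : u.bar.bar = u := by
  simp [Lit.bar]

lemma covers_bar (P : LitPoset n) {u v : Lit n} (h : Covers P.1 u v) :
    Covers P.1 v.bar u.bar := by
  obtain ⟨h1, h2, h3⟩ := h
  have hs := P.2.2.2
  refine ⟨fun h => h1 ?_, (hs u v).1 h2, fun z hz1 hz2 => ?_⟩
  · rw [← bar_bar u, ← bar_bar v, h]
  · have a := (hs _ _).1 hz1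
    have b := (hs _ _).1 hz2
    rw [bar_bar] at a b
    rcases h3 _ b a with h | h
    · right; rw [← h, bar_bar]
    · left; rw [← h, bar_bar]

/-- A finite partial order is generated by its covers. -/
lemma le_of_covers_gen {α : Type} [Fintype α] (p q : α → α → Prop) (hP : IsPartialOrder α p)
    (hQ : IsPartialOrder α q)
    (h : ∀ u v, u ≠ v → p u v → (∀ z, p u z → p z v → z = u ∨ z = v) → q u v) :
    ∀ u v, p u v → q u v := by
  classical
  intro u v huv
  let _ : PartialOrder α :=
    { le := p
      le_refl := fun a => hP.refl a
      le_trans := fun a b c => hP.trans a b c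
      le_antisymm := fun a b => hP.antisymm a b }
  let _ : LocallyFiniteOrder α := Fintype.toLocallyFiniteOrder
  have h1 : u ≤ v := huv
  rw [le_iff_reflTransGen_covBy] at h1
  clear huv
  induction h1 with
  | refl => exact hQ.refl _
  | @tail b c hb hc ih =>
    refine hQ.trans _ _ _ ih ?_
    exact h b c hc.ne hc.le fun z hz1 hz2 => hc.wcovBy.eq_or_eq hz1 hz2

/-- A poset on the literals is determined by its covers. -/
lemma le_of_covers (P Q : LitPoset n)
    (h : ∀ u v, Covers P.1 u v → Covers Q.1 u v) : ∀ u v, P.1 u v → Q.1 u v :=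
  le_of_covers_gen P.1 Q.1 P.2.1 Q.2.1 fun u v h1 h2 h3 => (h u v ⟨h1, h2, h3⟩).2.1

/-- The edge `ij` has sign `s` in `P`, after switching by `w`. -/
def E (P : LitPoset n) (w : Fin n → Bool) (i j : Fin n) (s : Bool) : Prop :=
  Covers P.1 (i, s ^^ w i) (j, !(s ^^ w j))

variable {P : LitPoset n} {w : Fin n → Bool}

lemma E_symm {i j s} (h : E P w i j s) : E P w j i s := by
  simpa [E, Lit.bar] using covers_bar P h

lemma E_tri {i j k s r} (h1 : E P w i j s) (h2 : E P w j k (!s)) (h3 : E P w i k r) :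
    False := by
  have hP := P.2.1
  have hn := P.2.2.1
  have a1 := h1.2.1
  have a2 := h2.2.1
  have a3 := h3.2.1
  have b3 := (E_symm h3).2.1
  have e : (!s ^^ w j) = !(s ^^ w j) := by simp
  rw [e] at a2
  have c := hP.trans _ _ _ a1 a2
  have e' : (!(!s ^^ w k)) = (s ^^ w k) := by simp
  rw [e'] at c
  by_cases hr : r = s
  · subst hr
    exact hn _ _ (hP.trans _ _ _ c b3)
  · have : r = !s := by cases r <;> cases s <;> simp_all
    subst this
    have e2 : (!(!s ^^ w i)) = (s ^^ w i) := by simp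
    rw [e2] at b3
    have d := hP.trans _ _ _ b3 c
    have e3 : (s ^^ w k) = !(!s ^^ w k) := by simp
    rw [e3] at d
    exact hn _ _ d

lemma E_unique {i j s r} (h1 : E P w i j s) (h2 : E P w i j r) : s = r := by
  by_contra hr
  have : r = !s := by cases r <;> cases s <;> simp_all
  subst this
  have hP := P.2.1
  have a1 := h1.2.1
  have a2 := (E_symm h2).2.1
  have e : (!s ^^ w j) = !(s ^^ w j) := by simp
  have e2 : (!(!s ^^ w i)) = (s ^^ w i) := by simp
  rw [e, e2] at a2
  exact h1.1 (hP.antisymm _ _ a1 a2)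

lemma E_tri_eq {i j k s t r} (h1 : E P w i j s) (h2 : E P w j k t) (h3 : E P w i k r) :
    s = t ∧ s = r := by
  constructor
  · by_contra h
    have : t = !s := by cases t <;> cases s <;> simp_all
    subst this
    exact E_tri h1 h2 h3
  · by_contra h
    have : r = !s := by cases r <;> cases s <;> simp_all
    subst this
    exact E_tri (E_symm h1) h3 h2

/-- The edge `e` has sign `s`. -/
def ES (P : LitPoset n) (w : Fin n → Bool) (e : Sym2 (Fin n)) (s : Bool) : Prop :=
  ∃ i j, e = s(i, j) ∧ E P w i j s

lemma ES_mk {i j s} : ES P w s(i, j) s ↔ E P w i j s := by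
  constructor
  · rintro ⟨a, b, h, hE⟩
    rcases Sym2.eq_iff.1 h with ⟨rfl, rfl⟩ | ⟨rfl, rfl⟩
    · exact hE
    · exact E_symm hE
  · exact fun h => ⟨i, j, rfl, h⟩

lemma ES_unique {e s r} (h1 : ES P w e s) (h2 : ES P w e r) : s = r := by
  obtain ⟨i, j, rfl, h⟩ := h1
  exact E_unique h (ES_mk.1 h2)

variable {G : ColoredGraph n}

lemma tri_all (hE : ∀ i j, G.Adj i j → ∃ s, E P w i j s) {T} (hT : IsTri G T) :
    ∃ s, ∀ g, EdgeOf g T → ES P w g s := by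
  obtain ⟨h1, h2, h3⟩ := hT
  obtain ⟨s, h1⟩ := hE _ _ h1
  obtain ⟨t, h2⟩ := hE _ _ h2
  obtain ⟨r, h3⟩ := hE _ _ h3
  obtain ⟨rfl, rfl⟩ := E_tri_eq h1 h2 h3
  refine ⟨s, ?_⟩
  rintro g (rfl | rfl | rfl)
  · exact ES_mk.2 h1
  · exact ES_mk.2 h2
  · exact ES_mk.2 h3

lemma triEquiv_ES (hE : ∀ i j, G.Adj i j → ∃ s, E P w i j s) {e f} (h : TriEquiv G e f)
    {s} (he : ES P w e s) : ES P w f s := by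
  rcases h with rfl | ⟨l, T, hT, h0, hl, hs⟩
  · exact he
  · have key : ∀ i ≤ l, ∀ g, EdgeOf g (T i) → ES P w g s := by
      intro i
      induction i with
      | zero =>
        intro hi g hg
        obtain ⟨t, ht⟩ := tri_all hE (hT 0 hi)
        rw [ES_unique he (ht e h0)]
        exact ht g hg
      | succ i ih =>
        intro hi g hg
        obtain ⟨t, ht⟩ := tri_all hE (hT (i + 1) hi)
        obtain ⟨g', hg1, hg2⟩ := hs i (by omega)
        rw [ES_unique (ih (by omega) g' hg1) (ht g' hg2)]
        exact ht g hg
    exact key l le_rfl f hl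

/-- All edges have sign `s`. -/
def Good (G : ColoredGraph n) (P : LitPoset n) (w : Fin n → Bool) (s : Bool) : Prop :=
  ∀ i j, G.Adj i j → E P w i j s

lemma exists_good (hT : TriConnected G) (hE : ∀ i j, G.Adj i j → ∃ s, E P w i j s) :
    ∃ s, Good G P w s := by
  by_cases h : ∃ i j, G.Adj i j
  · obtain ⟨i, j, hij⟩ := h
    obtain ⟨s, hs⟩ := hE i j hij
    refine ⟨s, fun a b hab => ES_mk.1 (triEquiv_ES hE (hT s(i, j) hij s(a, b) hab) (ES_mk.2 hs))⟩
  · push Not at h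
    exact ⟨true, fun i j hij => (h i j hij).elim⟩

lemma adj_of_covers (hG : GraphOf P G) {i j b c} (h : Covers P.1 (i, b) (j, c)) :
    (b = c ∧ G.blue.Adj i j) ∨ (b = !c ∧ G.red.Adj i j) := by
  have hij : i ≠ j := by
    rintro rfl
    have h1 := h.1
    have : c = !b := by cases c <;> cases b <;> simp_all
    subst this
    exact P.2.2.1 _ _ h.2.1
  have := hG i j
  cases b <;> cases c <;> simp_all

end TriAux

/-- Lemma 4.1: if `G ∈ 𝓑(n)` is triangle-connected, then `|𝓟(G)| ≤ 2`. -/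
theorem card_PsetOf_le_two {n : ℕ} (G : ColoredGraph n) (hG : G ∈ bbSet n)
    (hT : TriConnected G) : (PsetOf G).ncard ≤ 2 := by
  classical
  obtain ⟨U, -, hU⟩ := hG
  let w : Fin n → Bool := fun i => decide (i ∈ U)
  have hblue : ∀ i j, G.blue.Adj i j → w i = !(w j) := by
    intro i j h
    have := (hU i trivial j trivial).1 h
    by_cases h1 : i ∈ U <;> by_cases h2 : j ∈ U <;> simp_all [w]
  have hred : ∀ i j, G.red.Adj i j → w i = w j := by
    intro i j h
    have := (hU i trivial j trivial).2 h
    by_cases h1 : i ∈ U <;> by_cases h2 : j ∈ U <;> simp_all [w]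
  have hcov : ∀ P ∈ PsetOf G, ∀ i j b c, Covers P.1 (i, b) (j, c) →
      G.Adj i j ∧ b = ((b ^^ w i) ^^ w i) ∧ c = !((b ^^ w i) ^^ w j) := by
    intro P hP i j b c h
    rcases TriAux.adj_of_covers hP h with ⟨hbc, h⟩ | ⟨hbc, h⟩
    · refine ⟨Or.inr h, by simp, ?_⟩
      rw [hblue i j h, hbc]
      cases c <;> cases w j <;> rfl
    · refine ⟨Or.inl h, by simp, ?_⟩
      rw [hred i j h, hbc]
      cases c <;> cases w j <;> rfl
  have hcovE : ∀ P ∈ PsetOf G, ∀ i j b c, Covers P.1 (i, b) (j, c) →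
      TriAux.E P w i j (b ^^ w i) := by
    intro P hP i j b c h
    obtain ⟨-, h1, h2⟩ := hcov P hP i j b c h
    unfold TriAux.E
    rw [← h1, ← h2]
    exact h
  have hgood : ∀ P ∈ PsetOf G, ∃ s, TriAux.Good G P w s := by
    intro P hP
    refine TriAux.exists_good hT fun i j hij => ?_
    rcases hij with h | h
    · rcases ((hP i j).1.1 h).2 with h | h
      · exact ⟨_, hcovE P hP _ _ _ _ h⟩
      · exact ⟨_, hcovE P hP _ _ _ _ h⟩
    · rcases ((hP i j).2.1 h).2 with h | h
      · exact ⟨_, hcovE P hP _ _ _ _ h⟩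
      · exact ⟨_, hcovE P hP _ _ _ _ h⟩
  have hle : ∀ P ∈ PsetOf G, ∀ Q, ∀ s, TriAux.Good G P w s → TriAux.Good G Q w s →
      ∀ u v, P.1 u v → Q.1 u v := by
    intro P hP Q s hPs hQs
    refine TriAux.le_of_covers P Q ?_
    rintro ⟨i, b⟩ ⟨j, c⟩ h
    obtain ⟨hadj, h1, h2⟩ := hcov P hP i j b c h
    have hs := TriAux.E_unique (hcovE P hP i j b c h) (hPs i j hadj)
    have hq := hQs i j hadj
    unfold TriAux.E at hq
    rw [← hs, ← h1, ← h2] at hq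
    exact hq
  choose! f hf using hgood
  have hinj : Set.InjOn f (PsetOf G) := by
    intro P hP Q hQ hPQ
    have h1 := hf P hP
    have h2 := hf Q hQ
    rw [← hPQ] at h2
    apply Subtype.ext
    funext u v
    exact propext ⟨hle P hP Q _ h1 h2 u v, hle Q hQ P _ h2 h1 u v⟩
  calc (PsetOf G).ncard = (f '' PsetOf G).ncard := hinj.ncard_image.symm
    _ ≤ (Set.univ : Set Bool).ncard := Set.ncard_le_ncard (Set.subset_univ _)
    _ = 2 := by simp
end
end
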